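/- Let D₁,…,D_n ⊂ ℝ² be bounded domains whose boundaries are finite disjoint unions of Jordan curves, let α₁,…,α_n ∈ ℝ, and let ω₀ = Σⱼ αⱼ 1_{Dⱼ} be a uniformly rotating multi-patch solution of the 2D Euler equation with angular velocity Ω ∈ ℝ. If Ω ≤ (1/2)·ess inf_{ℝ²} ω₀ or Ω ≥ (1/2)·ess sup_{ℝ²} ω₀, then ω₀ is radially symmetric: if Ω ≠ 0 then ω₀ agrees almost everywhere with a function of |x|, and if Ω = 0 then there exists a ∈ ℝ² such that ω₀ agrees almost everywhere with a function of |x − a|. -/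

import Mathlib

open MeasureTheory Metric Set Filter

noncomputable section

/-- The plane `ℝ²`. -/
abbrev E2 : Type := EuclideanSpace ℝ (Fin 2)

/-- The Newtonian potential `N(x) = (1/(2π)) log(1/|x|)` on `ℝ²`. -/
def NewtonianPotential (x : E2) : ℝ := (1 / (2 * Real.pi)) * Real.log (1 / ‖x‖)

/-- The convolution `(N * ω)(x) = ∫ N(x-y) ω(y) dy`. -/
def newtonConv (ω : E2 → ℝ) (x : E2) : ℝ := ∫ y, NewtonianPotential (x - y) * ω y

/-- A Jordan curve: the image of a continuous injective map from the unit circle into `ℝ²`. -/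
def IsJordanCurve (Γ : Set E2) : Prop :=
  ∃ f : Metric.sphere (0 : E2) 1 → E2, Continuous f ∧ Function.Injective f ∧ Γ = Set.range f

/-- The boundary of `D` is a finite union of mutually disjoint Jordan curves. -/
def BoundaryIsFiniteUnionOfJordanCurves (D : Set E2) : Prop :=
  ∃ (k : ℕ) (Γ : Fin k → Set E2), (∀ i, IsJordanCurve (Γ i)) ∧
    (Pairwise fun i j => Disjoint (Γ i) (Γ j)) ∧ frontier D = ⋃ i, Γ i

namespace RotPatch
open Topology

/-- Euclidean inner product. -/
def dot (a b : ℂ) : ℝ := a.re * b.re + a.im * b.im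

/-- Planar cross product. -/
def wedge (a b : ℂ) : ℝ := a.re * b.im - a.im * b.re

def dL (v : ℂ) : ℂ →L[ℝ] ℝ := v.re • Complex.reCLM + v.im • Complex.imCLM

@[simp] lemma dL_apply (v w : ℂ) : dL v w = dot v w := by simp [dL, dot]

lemma dot_comm (a b : ℂ) : dot a b = dot b a := by simp [dot]; ring
lemma dot_add_right (a b c : ℂ) : dot a (b + c) = dot a b + dot a c := by simp [dot]; ring
lemma dot_add_left (a b c : ℂ) : dot (a + b) c = dot a c + dot b c := by simp [dot]; ring
lemma dot_sub_right (a b c : ℂ) : dot a (b - c) = dot a b - dot a c := by simp [dot]; ring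
lemma dot_sub_left (a b c : ℂ) : dot (a - b) c = dot a c - dot b c := by simp [dot]; ring
lemma dot_smul_right (t : ℝ) (a b : ℂ) : dot a (t • b) = t * dot a b := by simp [dot]; ring
lemma dot_smul_left (t : ℝ) (a b : ℂ) : dot (t • a) b = t * dot a b := by simp [dot]; ring
lemma dot_neg_left (a b : ℂ) : dot (-a) b = - dot a b := by simp [dot]; ring
lemma dot_neg_right (a b : ℂ) : dot a (-b) = - dot a b := by simp [dot]; ring
@[simp] lemma dot_zero_left (b : ℂ) : dot 0 b = 0 := by simp [dot]
@[simp] lemma dot_zero_right (b : ℂ) : dot b 0 = 0 := by simp [dot]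
lemma dot_self (a : ℂ) : dot a a = ‖a‖ ^ 2 := by
  rw [← Complex.normSq_eq_norm_sq, Complex.normSq_apply]; rfl
lemma dot_sq_add_wedge_sq (a b : ℂ) : dot a b ^ 2 + wedge a b ^ 2 = (‖a‖ * ‖b‖) ^ 2 := by
  rw [mul_pow, ← dot_self, ← dot_self]; simp only [dot, wedge]; ring
lemma abs_dot_le (a b : ℂ) : |dot a b| ≤ ‖a‖ * ‖b‖ := by
  apply abs_le_of_sq_le_sq _ (by positivity)
  nlinarith [dot_sq_add_wedge_sq a b, sq_nonneg (wedge a b)]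
lemma abs_wedge_le (a b : ℂ) : |wedge a b| ≤ ‖a‖ * ‖b‖ := by
  apply abs_le_of_sq_le_sq _ (by positivity)
  nlinarith [dot_sq_add_wedge_sq a b, sq_nonneg (dot a b)]
lemma wedge_sub_left (a b c : ℂ) : wedge (a - b) c = wedge a c - wedge b c := by
  simp [wedge]; ring
lemma wedge_sub_right (a b c : ℂ) : wedge a (b - c) = wedge a b - wedge a c := by
  simp [wedge]; ring
lemma wedge_smul_right (t : ℝ) (a b : ℂ) : wedge a (t • b) = t * wedge a b := by
  simp [wedge]; ring
lemma wedge_smul_left (t : ℝ) (a b : ℂ) : wedge (t • a) b = t * wedge a b := by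
  simp [wedge]; ring

@[fun_prop] lemma Continuous.dot' {X : Type*} [TopologicalSpace X] {a b : X → ℂ}
    (ha : Continuous a) (hb : Continuous b) : Continuous fun x => dot (a x) (b x) := by
  unfold dot; fun_prop
@[fun_prop] lemma Continuous.wedge' {X : Type*} [TopologicalSpace X] {a b : X → ℂ}
    (ha : Continuous a) (hb : Continuous b) : Continuous fun x => wedge (a x) (b x) := by
  unfold wedge; fun_prop
@[fun_prop] lemma Measurable.dot' {X : Type*} [MeasurableSpace X] {a b : X → ℂ}
    (ha : Measurable a) (hb : Measurable b) : Measurable fun x => dot (a x) (b x) := by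
  unfold dot; fun_prop
@[fun_prop] lemma Measurable.wedge' {X : Type*} [MeasurableSpace X] {a b : X → ℂ}
    (ha : Measurable a) (hb : Measurable b) : Measurable fun x => wedge (a x) (b x) := by
  unfold wedge; fun_prop
lemma continuous_dL : Continuous dL := by
  unfold dL; fun_prop
lemma norm_dL_sub_le (v w : ℂ) : ‖dL v - dL w‖ ≤ ‖v - w‖ := by
  refine ContinuousLinearMap.opNorm_le_bound _ (norm_nonneg _) fun x => ?_
  rw [sub_apply, dL_apply, dL_apply, ← dot_sub_left, Real.norm_eq_abs]
  exact abs_dot_le _ _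
lemma dL_eq_zero {v : ℂ} (h : dL v = 0) : v = 0 := by
  have := congrArg (fun L => L v) h
  simp only [dL_apply, zero_apply, dot_self] at this
  simpa using this
lemma dL_add (v w : ℂ) : dL (v + w) = dL v + dL w := by
  ext <;> simp [dot_add_left]
lemma dL_smul (t : ℝ) (w : ℂ) : dL (t • w) = t • dL w := by
  ext <;> simp [dot]; ring
@[simp] lemma dL_zero : dL 0 = 0 := by
  ext <;> simp

/-- `φ` is continuously differentiable with gradient the given one. -/
def IsC1 (φ : ℂ → ℝ) (φ' : ℂ → ℂ) : Prop := (∀ x, HasFDerivAt φ (dL (φ' x)) x) ∧ Continuous φ'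

def IsC1c (φ : ℂ → ℝ) (φ' : ℂ → ℂ) : Prop := IsC1 φ φ' ∧ ∃ R, ∀ x, R ≤ ‖x‖ → φ x = 0

lemma IsC1.continuous {φ φ'} (h : IsC1 φ φ') : Continuous φ :=
  continuous_iff_continuousAt.2 fun x => (h.1 x).continuousAt

lemma IsC1.eq_zero_of_eventually {φ φ'} (h : IsC1 φ φ') {x : ℂ} {c : ℝ}
    (hx : ∀ᶠ y in 𝓝 x, φ y = c) : φ' x = 0 := by
  apply dL_eq_zero
  have h1 : HasFDerivAt φ (0 : ℂ →L[ℝ] ℝ) x :=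
    (hasFDerivAt_const c x).congr_of_eventuallyEq hx
  exact (h.1 x).unique h1

lemma IsC1c.bound {φ φ'} (h : IsC1c φ φ') :
    ∃ R > 0, ∀ x, R ≤ ‖x‖ → φ x = 0 ∧ φ' x = 0 := by
  obtain ⟨h1, R, hR⟩ := h
  refine ⟨|R| + 1, by positivity, fun x hx => ⟨hR x (by linarith [le_abs_self R]), ?_⟩⟩
  apply h1.eq_zero_of_eventually (c := 0)
  have : {y : ℂ | R < ‖y‖} ∈ 𝓝 x :=
    (isOpen_lt continuous_const continuous_norm).mem_nhds (by
      simp only [mem_ofPred_eq]; linarith [le_abs_self R])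
  filter_upwards [this] with y hy using hR y (le_of_lt hy)

lemma IsC1.mul {φ φ' η η'} (h : IsC1 φ φ') (k : IsC1 η η') :
    IsC1 (fun x => φ x * η x) (fun x => φ x • η' x + η x • φ' x) := by
  refine ⟨fun x => ?_, ?_⟩
  · rw [dL_add, dL_smul, dL_smul]; exact (h.1 x).mul (k.1 x)
  · have := h.continuous; have := k.continuous; have := h.2; have := k.2; fun_prop

lemma IsC1.add {φ φ' η η'} (h : IsC1 φ φ') (k : IsC1 η η') :
    IsC1 (fun x => φ x + η x) (fun x => φ' x + η' x) := by
  refine ⟨fun x => ?_, ?_⟩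
  · rw [dL_add]; exact (h.1 x).add (k.1 x)
  · have := h.2; have := k.2; fun_prop

lemma IsC1.comp {φ φ'} (h : IsC1 φ φ') {γ γ' : ℝ → ℝ} (hγ : ∀ s, HasDerivAt γ (γ' s) s)
    (hγ' : Continuous γ') : IsC1 (fun x => γ (φ x)) (fun x => γ' (φ x) • φ' x) := by
  refine ⟨fun x => ?_, ?_⟩
  · rw [dL_smul]; exact (hγ (φ x)).comp_hasFDerivAt x (h.1 x)
  · have := h.continuous; have := h.2; fun_prop

lemma IsC1c.mul {φ φ' η η'} (h : IsC1c φ φ') (k : IsC1 η η') :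
    IsC1c (fun x => φ x * η x) (fun x => φ x • η' x + η x • φ' x) := by
  refine ⟨h.1.mul k, ?_⟩
  obtain ⟨R, hR⟩ := h.2
  exact ⟨R, fun x hx => by simp [hR x hx]⟩

lemma isC1_const (c : ℝ) : IsC1 (fun _ => c) (fun _ => 0) :=
  ⟨fun x => by simpa using hasFDerivAt_const c x, continuous_const⟩

lemma isC1_dot (e y : ℂ) : IsC1 (fun x => dot e (x - y)) (fun _ => e) := by
  refine ⟨fun x => ?_, continuous_const⟩
  have := (dL e).hasFDerivAt.comp x ((hasFDerivAt_id x).sub_const y)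
  simpa [Function.comp_def] using this

lemma isC1_normSq : IsC1 (fun x => ‖x‖ ^ 2) (fun x => (2 : ℝ) • x) := by
  have h := ((isC1_dot 1 0).mul (isC1_dot 1 0)).add ((isC1_dot Complex.I 0).mul (isC1_dot Complex.I 0))
  convert h using 2 with x x
  · rw [← dot_self]; simp [dot]
  · apply Complex.ext <;> simp [dot] <;> ring

lemma IsC1.shift {φ φ'} (h : IsC1 φ φ') (y : ℂ) :
    IsC1 (fun x => φ (y + x)) (fun x => φ' (y + x)) := by
  refine ⟨fun x => ?_, by have := h.2; fun_prop⟩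
  have := (h.1 (y + x)).comp x ((hasFDerivAt_id x).const_add y)
  simpa [Function.comp_def] using this

lemma IsC1c.shift {φ φ'} (h : IsC1c φ φ') (y : ℂ) :
    IsC1c (fun x => φ (y + x)) (fun x => φ' (y + x)) := by
  refine ⟨h.1.shift y, ?_⟩
  obtain ⟨R, hR⟩ := h.2
  refine ⟨R + ‖y‖, fun x hx => hR _ ?_⟩
  have := norm_sub_le (y + x) y
  simp at this
  linarith

/-! ### integrability -/

lemma integrable_of_bdd {E : Type*} [NormedAddCommGroup E] {H : ℂ → E}
    (hm : AEStronglyMeasurable H volume) {C R : ℝ} (hC : ∀ x, ‖H x‖ ≤ C)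
    (hR : ∀ x, R ≤ ‖x‖ → H x = 0) : Integrable H := by
  have h1 : IntegrableOn H (ball 0 R) := by
    apply Measure.integrableOn_of_bounded (M := C) (measure_ball_lt_top).ne hm
    exact Eventually.of_forall hC
  rw [integrableOn_iff_integrable_of_support_subset] at h1
  · exact h1
  · intro x hx
    simp only [mem_ball, dist_zero_right]
    by_contra hcon
    exact hx (hR x (not_lt.1 hcon))

lemma exists_bound_of_cont {E : Type*} [NormedAddCommGroup E] {H : ℂ → E}
    (hm : Continuous H) {R : ℝ}
    (hR : ∀ x, R ≤ ‖x‖ → H x = 0) : ∃ C, 0 ≤ C ∧ ∀ x, ‖H x‖ ≤ C := by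
  obtain ⟨C, hC⟩ := (isCompact_closedBall (0:ℂ) R).exists_bound_of_continuousOn hm.continuousOn
  refine ⟨|C|, abs_nonneg _, fun x => ?_⟩
  by_cases hx : ‖x‖ ≤ R
  · exact (hC x (by simpa using hx)).trans (le_abs_self _)
  · rw [hR x (not_le.1 hx).le]; simp

lemma integrable_of_cont {E : Type*} [NormedAddCommGroup E] {H : ℂ → E}
    (hm : Continuous H) {R : ℝ}
    (hR : ∀ x, R ≤ ‖x‖ → H x = 0) : Integrable H := by
  obtain ⟨C, -, hC⟩ := exists_bound_of_cont hm hR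
  exact integrable_of_bdd hm.aestronglyMeasurable hC hR

lemma integrableOn_inv_norm (R : ℝ) : IntegrableOn (fun z : ℂ => ‖z‖⁻¹) (ball 0 R) := by
  have h2 : IntegrableOn (fun _ : ℝ => (1:ℝ)) (Ioo 0 R) := by simp
  have := (integrableOn_fun_norm_addHaar (E := ℂ) volume (f := fun r : ℝ => r⁻¹) (r := R)).2
    (h2.congr_fun (fun r hr => ?_) measurableSet_Ioo)
  · exact this
  · simp [Complex.finrank_real_complex, hr.1.ne']

end RotPatch

namespace RotPatch
open Topology

/-- The kernel `z / |z|²`. -/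
def kk (z : ℂ) : ℂ := (‖z‖ ^ 2)⁻¹ • z

lemma norm_kk (z : ℂ) : ‖kk z‖ = ‖z‖⁻¹ := by
  rw [kk, norm_smul]
  by_cases h : z = 0
  · simp [h]
  · have : ‖z‖ ≠ 0 := by simpa using h
    rw [norm_inv, norm_pow, norm_norm]; field_simp

lemma kk_neg (z : ℂ) : kk (-z) = - kk z := by simp [kk]
lemma kk_sub_comm (x y : ℂ) : kk (x - y) = - kk (y - x) := by rw [← kk_neg, neg_sub]

@[fun_prop] lemma measurable_kk : Measurable kk := by unfold kk; fun_prop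

/-- truncated inverse norm -/
def tk (R : ℝ) (z : ℂ) : ℝ := (ball (0:ℂ) R).indicator (fun z => ‖z‖⁻¹) z

lemma integrable_tk (R : ℝ) : Integrable (tk R) :=
  (integrable_indicator_iff measurableSet_ball).2 (integrableOn_inv_norm R)

lemma measurable_tk (R : ℝ) : Measurable (tk R) :=
  Measurable.indicator (by fun_prop) measurableSet_ball

lemma tk_nonneg (R : ℝ) (z : ℂ) : 0 ≤ tk R z := indicator_nonneg (fun _ _ => by positivity) _

lemma tk_eq {R : ℝ} {z : ℂ} (h : ‖z‖ < R) : tk R z = ‖z‖⁻¹ := by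
  simp [tk, h]

lemma integrable_sing {E : Type*} [NormedAddCommGroup E] {H : ℂ → E}
    (hm : AEStronglyMeasurable H volume) {C R : ℝ} (x : ℂ) (hC : ∀ y, ‖H y‖ ≤ C * (1 + ‖x - y‖⁻¹))
    (hR : ∀ y, R ≤ ‖y‖ → H y = 0) : Integrable H := by
  have h1 : Integrable (fun y => (ball (0:ℂ) R).indicator (fun _ => C) y + C * tk (R + ‖x‖) (x - y)) := by
    refine Integrable.add ?_ (((integrable_tk (R + ‖x‖)).comp_sub_left x).const_mul C)
    rw [integrable_indicator_iff measurableSet_ball]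
    exact integrableOn_const measure_ball_lt_top.ne
  refine h1.mono' hm (Eventually.of_forall fun y => ?_)
  by_cases hy : R ≤ ‖y‖
  · rw [hR y hy]
    have : y ∉ ball (0:ℂ) R := by simpa using hy
    rw [indicator_of_notMem this, norm_zero, zero_add]
    have := hC y
    have h2 : 0 ≤ C := by
      have h3 : 0 ≤ C * (1 + ‖x - y‖⁻¹) := (norm_nonneg _).trans this
      by_contra hc
      have : 0 < 1 + ‖x - y‖⁻¹ := by positivity
      nlinarith
    exact mul_nonneg h2 (tk_nonneg _ _)
  · have h3 : y ∈ ball (0:ℂ) R := by simpa using hy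
    rw [indicator_of_mem h3, tk_eq]
    · linarith [hC y]
    · have := norm_sub_le x y; push Not at hy; linarith

lemma integrable_sing_prod {E : Type*} [NormedAddCommGroup E] {H : ℂ × ℂ → E}
    (hm : AEStronglyMeasurable H (volume.prod volume)) {C R : ℝ}
    (hC : ∀ p, ‖H p‖ ≤ C * (1 + ‖p.1 - p.2‖⁻¹))
    (hR : ∀ p, R ≤ ‖p.1‖ → H p = 0) (hR' : ∀ p, R ≤ ‖p.2‖ → H p = 0) :
    Integrable H (volume.prod volume) := by
  have h0 : Integrable ((ball (0:ℂ) R).indicator (fun _ => (1:ℝ))) := by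
    rw [integrable_indicator_iff measurableSet_ball]; exact integrableOn_const measure_ball_lt_top.ne
  have h1 : Integrable (fun p : ℂ × ℂ => C * ((ball (0:ℂ) R).indicator (fun _ => (1:ℝ)) p.1 *
      (ball (0:ℂ) R).indicator (fun _ => (1:ℝ)) p.2) +
      C * ((ball (0:ℂ) R).indicator (fun _ => (1:ℝ)) p.2 * tk (R + R) (p.1 - p.2)))
      (volume.prod volume) := by
    refine Integrable.add ((h0.mul_prod h0).const_mul C) ?_
    have := Integrable.convolution_integrand (ContinuousLinearMap.mul ℝ ℝ) h0 (integrable_tk (R + R))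
    exact this.const_mul C
  refine h1.mono' hm (Eventually.of_forall fun p => ?_)
  have hC0 : 0 ≤ C := by
      have h3 : 0 ≤ C * (1 + ‖p.1 - p.2‖⁻¹) := (norm_nonneg _).trans (hC p)
      by_contra hc
      have : 0 < 1 + ‖p.1 - p.2‖⁻¹ := by positivity
      nlinarith
  have hnn : ∀ z, 0 ≤ (ball (0:ℂ) R).indicator (fun _ => (1:ℝ)) z :=
    fun z => indicator_nonneg (fun _ _ => by positivity) _
  have hpos : 0 ≤ C * ((ball (0:ℂ) R).indicator (fun _ => (1:ℝ)) p.1 *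
      (ball (0:ℂ) R).indicator (fun _ => (1:ℝ)) p.2) +
      C * ((ball (0:ℂ) R).indicator (fun _ => (1:ℝ)) p.2 * tk (R + R) (p.1 - p.2)) := by
    have := hnn p.1; have := hnn p.2; have := tk_nonneg (R + R) (p.1 - p.2); positivity
  by_cases h1 : R ≤ ‖p.1‖
  · rw [hR p h1, norm_zero]; exact hpos
  by_cases h2 : R ≤ ‖p.2‖
  · rw [hR' p h2, norm_zero]; exact hpos
  have h3 : p.1 ∈ ball (0:ℂ) R := by simpa using h1
  have h4 : p.2 ∈ ball (0:ℂ) R := by simpa using h2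
  rw [indicator_of_mem h3, indicator_of_mem h4, tk_eq]
  · linarith [hC p]
  · have := norm_sub_le p.1 p.2; push Not at h1 h2; linarith

/-! ### fundamental solution -/

lemma kk_polar {r : ℝ} (hr : 0 < r) (θ : ℝ) :
    r • kk (Complex.polarCoord.symm (r, θ)) = Complex.exp (θ * Complex.I) := by
  have h1 : Complex.polarCoord.symm (r, θ) = r * Complex.exp (θ * Complex.I) := by
    rw [Complex.polarCoord_symm_apply, Complex.exp_mul_I]; push_cast; rfl
  rw [h1, kk, norm_mul, Complex.norm_exp_ofReal_mul_I, Complex.norm_real, mul_one, Real.norm_eq_abs,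
    sq_abs]
  have : (r : ℂ) ≠ 0 := by exact_mod_cast hr.ne'
  simp only [Complex.real_smul]
  push_cast
  field_simp

lemma K_zero {φ φ'} (h : IsC1c φ φ') : ∫ x, dot (kk x) (φ' x) = - (2 * Real.pi) * φ 0 := by
  obtain ⟨R, hR0, hR⟩ := h.bound
  rw [← Complex.integral_comp_polarCoord_symm]
  have hc : Continuous φ' := h.1.2
  set F : ℝ × ℝ → ℝ := fun p => dot (Complex.exp (p.2 * Complex.I)) (φ' (p.1 * Complex.exp (p.2 * Complex.I)))
    with hF
  have hFc : Continuous F := by rw [hF]; fun_prop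
  have e1 : ∫ p in polarCoord.target, p.1 • dot (kk (Complex.polarCoord.symm p)) (φ' (Complex.polarCoord.symm p))
      = ∫ p in polarCoord.target, F p := by
    refine setIntegral_congr_fun polarCoord.open_target.measurableSet fun p hp => ?_
    have hp1 : 0 < p.1 := by simpa using hp.1
    simp only [hF]
    rw [smul_eq_mul, ← dot_smul_left, kk_polar hp1 p.2]
    congr 2
    rw [Complex.polarCoord_symm_apply, Complex.exp_mul_I]; push_cast; rfl
  rw [e1]
  obtain ⟨C, hC0, hC⟩ := exists_bound_of_cont hc (fun x hx => (hR x hx).2)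
  have hnorm : ∀ p : ℝ × ℝ, ‖(p.1 : ℂ) * Complex.exp (p.2 * Complex.I)‖ = |p.1| := by
    intro p; rw [norm_mul, Complex.norm_exp_ofReal_mul_I, Complex.norm_real, mul_one, Real.norm_eq_abs]
  have hint : IntegrableOn F (Ioi (0:ℝ) ×ˢ Ioo (-Real.pi) Real.pi) := by
    have h1 : IntegrableOn F (Ioo (0:ℝ) R ×ˢ Ioo (-Real.pi) Real.pi) := by
      apply Measure.integrableOn_of_bounded (M := C)
      · rw [Measure.volume_eq_prod, Measure.prod_prod]
        simp [ENNReal.mul_eq_top]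
      · exact hFc.aestronglyMeasurable
      · refine Eventually.of_forall fun p => ?_
        refine (abs_dot_le _ _).trans ?_
        rw [Complex.norm_exp_ofReal_mul_I, one_mul]
        exact hC _
    refine IntegrableOn.of_forall_sdiff_eq_zero h1 (measurableSet_Ioi.prod measurableSet_Ioo) ?_
    rintro p ⟨hp, hp'⟩
    have : R ≤ ‖(p.1 : ℂ) * Complex.exp (p.2 * Complex.I)‖ := by
      rw [hnorm]
      by_contra hcon
      exact hp' ⟨⟨hp.1, (le_abs_self _).trans_lt (not_le.1 hcon)⟩, hp.2⟩
    simp only [hF]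
    rw [(hR _ this).2, dot_zero_right]
  have e2 : ∫ p in polarCoord.target, F p = ∫ θ in Ioo (-Real.pi) Real.pi, ∫ r in Ioi (0:ℝ), F (r, θ) := by
    have hint' : IntegrableOn (fun q : ℝ × ℝ => F q.swap) (Ioo (-Real.pi) Real.pi ×ˢ Ioi (0:ℝ)) := by
      have := hint.swap
      exact this
    have e3 := setIntegral_prod (μ := volume) (ν := volume) (fun q : ℝ × ℝ => F q.swap) hint'
    simp only [Prod.swap_prod_mk] at e3
    rw [← e3, setIntegral_prod_swap, Measure.volume_eq_prod]
    rfl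
  rw [e2]
  have e4 : ∀ θ : ℝ, ∫ r in Ioi (0:ℝ), F (r, θ) = - φ 0 := by
    intro θ
    have hd : ∀ r ∈ Ici (0:ℝ), HasDerivAt (fun r : ℝ => φ (r * Complex.exp (θ * Complex.I))) (F (r, θ)) r := by
      intro r _
      have h1 : HasDerivAt (fun r : ℝ => (r : ℂ) * Complex.exp (θ * Complex.I)) (Complex.exp (θ * Complex.I)) r := by
        simpa using (Complex.ofRealCLM.hasDerivAt (x := r)).mul_const (Complex.exp (θ * Complex.I))
      have := (h.1.1 ((r : ℂ) * Complex.exp (θ * Complex.I))).comp_hasDerivAt r h1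
      rw [dL_apply, dot_comm] at this
      exact this
    have hz : ∀ r : ℝ, R ≤ r → φ (r * Complex.exp (θ * Complex.I)) = 0 ∧ F (r, θ) = 0 := by
      intro r hr
      have h2 : R ≤ ‖(r : ℂ) * Complex.exp (θ * Complex.I)‖ := by
        rw [hnorm (r, θ)]; exact hr.trans (le_abs_self _)
      exact ⟨(hR _ h2).1, by simp only [hF]; rw [(hR _ h2).2, dot_zero_right]⟩
    have hi : IntegrableOn (fun r => F (r, θ)) (Ioi 0) := by
      have h1 : IntegrableOn (fun r => F (r, θ)) (Ioc 0 R) := by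
        have hc2 : Continuous fun r => F (r, θ) := by fun_prop
        exact (hc2.integrableOn_Icc (a := 0) (b := R)).mono_set Ioc_subset_Icc_self
      refine IntegrableOn.of_forall_sdiff_eq_zero h1 measurableSet_Ioi ?_
      rintro r ⟨hr, hr'⟩
      refine (hz r ?_).2
      by_contra hcon
      exact hr' ⟨hr, (not_le.1 hcon).le⟩
    have ht : Tendsto (fun r : ℝ => φ (r * Complex.exp (θ * Complex.I))) atTop (𝓝 0) := by
      apply tendsto_const_nhds.congr'
      filter_upwards [eventually_ge_atTop R] with r hr
      exact (hz r hr).1.symm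
    rw [integral_Ioi_of_hasDerivAt_of_tendsto' hd hi ht]
    simp
  simp only [e4]
  rw [setIntegral_const]
  simp [Real.volume_real_Ioo_of_le (show -Real.pi ≤ Real.pi by linarith [Real.pi_pos])]
  left; ring

lemma K_at {φ φ'} (h : IsC1c φ φ') (y : ℂ) :
    ∫ x, dot (kk (x - y)) (φ' x) = - (2 * Real.pi) * φ y := by
  have := K_zero (h.shift y)
  rw [add_zero] at this
  rw [← this, ← integral_add_right_eq_self (fun x => dot (kk (x - y)) (φ' x)) y]
  simp [add_comm]

end RotPatch

namespace RotPatch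
open Topology

lemma IsC1c.integrable {φ φ'} (h : IsC1c φ φ') : Integrable φ := by
  obtain ⟨R, -, hR⟩ := h.bound
  exact integrable_of_cont h.1.continuous (fun x hx => (hR x hx).1)

lemma IsC1c.integrable' {φ φ'} (h : IsC1c φ φ') : Integrable φ' := by
  obtain ⟨R, -, hR⟩ := h.bound
  exact integrable_of_cont h.1.2 (fun x hx => (hR x hx).2)

lemma int_dot_const {φ φ'} (h : IsC1c φ φ') (e : ℂ) : ∫ x, dot e (φ' x) = 0 := by
  have hd : Differentiable ℝ φ := fun x => (h.1.1 x).differentiableAt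
  have hf : ∀ x, fderiv ℝ φ x e = dot e (φ' x) := fun x => by
    rw [(h.1.1 x).fderiv, dL_apply, dot_comm]
  have hi : Integrable (fun x => dot e (φ' x)) := by
    obtain ⟨R, -, hR⟩ := h.bound
    have := h.1.2
    exact integrable_of_cont (by fun_prop) (R := R) (fun x hx => by rw [(hR x hx).2]; simp)
  have := integral_mul_fderiv_eq_neg_fderiv_mul_of_integrable (μ := (volume : Measure ℂ)) (𝕜 := ℝ)
    (f := fun _ => (1:ℝ)) (g := φ) (v := e) (by simp) (by simpa [hf] using hi)
    (by simpa using h.integrable) (fun x _ => differentiableAt_const _) (fun x _ => hd x)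
  simpa [hf] using this

lemma int_lin {φ φ'} (h : IsC1c φ φ') (a e : ℂ) :
    ∫ x, dot a x * dot e (φ' x) = - dot a e * ∫ x, φ x := by
  have h1 := h.mul (isC1_dot a 0)
  have h2 := int_dot_const h1 e
  simp only [sub_zero, dot_add_right, dot_smul_right] at h2
  obtain ⟨R, -, hR⟩ := h.bound
  have hc := h.1.2
  have hi : Integrable (fun x => dot a x * dot e (φ' x)) :=
    integrable_of_cont (by fun_prop) (R := R) (fun x hx => by rw [(hR x hx).2]; simp)
  rw [integral_add (h.integrable.mul_const _) hi, integral_mul_const] at h2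
  rw [dot_comm a e]; linarith

lemma int_dot_id {φ φ'} (h : IsC1c φ φ') : ∫ x, dot x (φ' x) = - 2 * ∫ x, φ x := by
  have h1 := int_lin h 1 1
  have h2 := int_lin h Complex.I Complex.I
  obtain ⟨R, -, hR⟩ := h.bound
  have hc := h.1.2
  have hi : ∀ a e, Integrable (fun x => dot a x * dot e (φ' x)) := fun a e =>
    integrable_of_cont (by fun_prop) (R := R) (fun x hx => by rw [(hR x hx).2]; simp)
  have : ∀ x, dot x (φ' x) = dot 1 x * dot 1 (φ' x) + dot Complex.I x * dot Complex.I (φ' x) := by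
    intro x; simp [dot]
  simp only [this]
  rw [integral_add (hi _ _) (hi _ _), h1, h2]
  simp [dot]; ring

lemma int_wedge_id {φ φ'} (h : IsC1c φ φ') : ∫ x, wedge x (φ' x) = 0 := by
  have h1 := int_lin h 1 Complex.I
  have h2 := int_lin h Complex.I 1
  obtain ⟨R, -, hR⟩ := h.bound
  have hc := h.1.2
  have hi : ∀ a e, Integrable (fun x => dot a x * dot e (φ' x)) := fun a e =>
    integrable_of_cont (by fun_prop) (R := R) (fun x hx => by rw [(hR x hx).2]; simp)
  have : ∀ x, wedge x (φ' x) = dot 1 x * dot Complex.I (φ' x) - dot Complex.I x * dot 1 (φ' x) := by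
    intro x; simp [dot, wedge]
  simp only [this]
  rw [integral_sub (hi _ _) (hi _ _), h1, h2]
  simp [dot]

lemma K_two {φ φ'} (h : IsC1c φ φ') (y e : ℂ) :
    ∫ x, dot (kk (x - y)) (φ' x) * dot e (x - y) = - ∫ x, φ x * dot (kk (x - y)) e := by
  have h1 := K_at (h.mul (isC1_dot e y)) y
  simp only [dot_add_right, dot_smul_right, sub_self, dot_zero_right, mul_zero] at h1
  obtain ⟨R, -, hR⟩ := h.bound
  have hc := h.1.2
  have hc1 := h.1.continuous
  obtain ⟨C, hC0, hC⟩ := exists_bound_of_cont hc1 (fun x hx => (hR x hx).1)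
  obtain ⟨C', hC0', hC'⟩ := exists_bound_of_cont hc (fun x hx => (hR x hx).2)
  have hi1 : Integrable (fun x => φ x * dot (kk (x - y)) e) := by
    have hm := hc1.measurable
    refine integrable_sing (Measurable.aestronglyMeasurable (by fun_prop)) y (C := C * ‖e‖) (R := R)
      (fun x => ?_) (fun x hx => by simp [(hR x hx).1])
    rw [norm_mul]
    have h3 := abs_dot_le (kk (x - y)) e
    rw [norm_kk, norm_sub_rev] at h3
    calc ‖φ x‖ * ‖dot (kk (x - y)) e‖ ≤ C * (‖y - x‖⁻¹ * ‖e‖) := by gcongr; exact hC x; exact h3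
      _ ≤ C * ‖e‖ * (1 + ‖y - x‖⁻¹) := by nlinarith [mul_nonneg hC0 (norm_nonneg e)]
  have hi2 : Integrable (fun x => dot e (x - y) * dot (kk (x - y)) (φ' x)) := by
    have hm := hc.measurable
    refine integrable_of_bdd (Measurable.aestronglyMeasurable (by fun_prop)) (C := ‖e‖ * C') (R := R)
      (fun x => ?_) (fun x hx => by simp [(hR x hx).2])
    rw [norm_mul]
    have h3 := abs_dot_le (kk (x - y)) (φ' x)
    rw [norm_kk] at h3
    calc ‖dot e (x - y)‖ * ‖dot (kk (x - y)) (φ' x)‖ ≤ (‖e‖ * ‖x - y‖) * (‖x - y‖⁻¹ * ‖φ' x‖) := by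
          gcongr; exact abs_dot_le _ _; exact h3
      _ = ‖e‖ * ‖φ' x‖ * (‖x - y‖ * ‖x - y‖⁻¹) := by ring
      _ ≤ ‖e‖ * C' * 1 := by
          gcongr
          · exact hC' x
          · exact mul_inv_le_one
      _ = _ := by ring
  rw [integral_add hi1 hi2] at h1
  simp only [mul_comm (dot (kk _) (φ' _)) _]
  linarith

/-- reflection -/
def RR (r v : ℂ) : ℂ := v - (2 * dot (kk r) v) • r

lemma dot_kk_mul (r v w : ℂ) : dot (kk r) v * dot r w = dot (kk r) w * dot r v := by
  simp only [kk, dot_smul_left]; ring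

lemma dot_kk_self {r : ℂ} (h : r ≠ 0) : dot (kk r) r = 1 := by
  have : ‖r‖ ≠ 0 := by simpa using h
  rw [kk, dot_smul_left, dot_self]; field_simp

lemma norm_RR (r v : ℂ) : ‖RR r v‖ = ‖v‖ := by
  by_cases h : r = 0
  · simp [RR, h]
  have h1 : ‖r‖ ≠ 0 := by simpa using h
  have : ‖RR r v‖ ^ 2 = ‖v‖ ^ 2 := by
    rw [← dot_self, RR, dot_sub_left, dot_sub_right, dot_sub_right, dot_smul_left, dot_smul_right,
      dot_smul_right, dot_smul_left, dot_self, dot_self, dot_comm v r]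
    simp only [kk, dot_smul_left]
    field_simp
    ring
  exact (sq_eq_sq₀ (norm_nonneg _) (norm_nonneg _)).1 this

lemma wedge_RR (r v : ℂ) : wedge r (RR r v) = wedge r v := by
  rw [RR, wedge_sub_right, wedge_smul_right]; simp [wedge]; ring_nf; simp

lemma RR_neg (r v : ℂ) : RR (-r) v = RR r v := by
  rw [RR, RR, kk_neg, dot_neg_left]; simp

lemma dot_RR_comm (r v w : ℂ) : dot v (RR r w) = dot w (RR r v) := by
  simp only [RR, dot_sub_right, dot_smul_right, kk, dot_smul_left]
  rw [dot_comm v w, dot_comm v r, dot_comm w r]; ring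

@[fun_prop] lemma measurable_RR {X : Type*} [MeasurableSpace X] {a b : X → ℂ}
    (ha : Measurable a) (hb : Measurable b) : Measurable fun x => RR (a x) (b x) := by
  unfold RR; fun_prop

lemma F_three {ψ ψ'} (h : IsC1c ψ ψ') :
    ∫ y, ∫ x, dot (ψ' x) (RR (x - y) (ψ' y)) = 4 * Real.pi * ∫ x, ψ x ^ 2 := by
  obtain ⟨R, -, hR⟩ := h.bound
  have hc := h.1.2
  have hc1 := h.1.continuous
  obtain ⟨C, hC0, hC⟩ := exists_bound_of_cont hc1 (fun x hx => (hR x hx).1)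
  obtain ⟨C', hC0', hC'⟩ := exists_bound_of_cont hc (fun x hx => (hR x hx).2)
  have hm := hc.measurable
  have hm1 := hc1.measurable
  have e1 : ∀ y, ∫ x, dot (ψ' x) (RR (x - y) (ψ' y)) = 2 * ∫ x, ψ x * dot (kk (x - y)) (ψ' y) := by
    intro y
    have e2 : ∀ x, dot (ψ' x) (RR (x - y) (ψ' y)) =
        dot (ψ' y) (ψ' x) - 2 * (dot (kk (x - y)) (ψ' x) * dot (ψ' y) (x - y)) := by
      intro x
      rw [RR, dot_sub_right, dot_smul_right, dot_comm (ψ' y) (ψ' x), dot_comm (ψ' y) (x - y),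
        dot_kk_mul, dot_comm (ψ' x) (x - y)]
      ring
    simp only [e2]
    rw [integral_sub, int_dot_const h, integral_const_mul, K_two h]
    · ring
    · exact integrable_of_cont (by fun_prop) (R := R) (fun x hx => by rw [(hR x hx).2]; simp)
    · refine integrable_of_bdd (Measurable.aestronglyMeasurable (by fun_prop)) (C := 2 * (‖ψ' y‖ * C')) (R := R)
        (fun x => ?_) (fun x hx => by simp [(hR x hx).2])
      rw [norm_mul, norm_mul, Real.norm_two]
      have h3 := abs_dot_le (kk (x - y)) (ψ' x)
      rw [norm_kk] at h3
      refine mul_le_mul_of_nonneg_left ?_ (by norm_num)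
      calc ‖dot (kk (x - y)) (ψ' x)‖ * ‖dot (ψ' y) (x - y)‖ ≤ (‖x - y‖⁻¹ * ‖ψ' x‖) * (‖ψ' y‖ * ‖x - y‖) := by
            gcongr; exact h3; exact abs_dot_le _ _
        _ = ‖ψ' y‖ * ‖ψ' x‖ * (‖x - y‖ * ‖x - y‖⁻¹) := by ring
        _ ≤ ‖ψ' y‖ * C' * 1 := by
            gcongr
            · exact hC' x
            · exact mul_inv_le_one
        _ = _ := by ring
  simp only [e1]
  rw [integral_const_mul, integral_integral_swap]
  · have e3 : ∀ x, ∫ y, ψ x * dot (kk (x - y)) (ψ' y) = 2 * Real.pi * ψ x ^ 2 := by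
      intro x
      rw [integral_const_mul]
      have : ∀ y, dot (kk (x - y)) (ψ' y) = - dot (kk (y - x)) (ψ' y) := by
        intro y; rw [kk_sub_comm, dot_neg_left]
      simp only [this]
      rw [integral_neg, K_at h]; ring
    simp only [e3]
    rw [integral_const_mul]; ring
  · refine integrable_sing_prod (Measurable.aestronglyMeasurable (by unfold Function.uncurry; fun_prop)) (C := C * C') (R := R) ?_ ?_ ?_
    · rintro ⟨y, x⟩
      simp only [Function.uncurry]
      rw [norm_mul]
      have h3 := abs_dot_le (kk (x - y)) (ψ' y)
      rw [norm_kk, norm_sub_rev] at h3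
      calc ‖ψ x‖ * ‖dot (kk (x - y)) (ψ' y)‖ ≤ C * (‖y - x‖⁻¹ * C') := by
            gcongr
            · exact hC x
            · exact h3.trans (by gcongr; exact hC' y)
        _ ≤ C * C' * (1 + ‖y - x‖⁻¹) := by nlinarith [mul_nonneg hC0 hC0']
    · rintro ⟨y, x⟩ hp; simp [Function.uncurry, (hR y hp).2]
    · rintro ⟨y, x⟩ hp; simp [Function.uncurry, (hR x hp).1]

end RotPatch

namespace RotPatch
open Topology

/-- bounded compactly supported measurable vorticity -/
structure Vort (ω : ℂ → ℝ) (C R : ℝ) : Prop where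
  meas : Measurable ω
  C0 : 0 ≤ C
  R0 : 0 < R
  bdd : ∀ x, |ω x| ≤ C
  supp : ∀ x, R ≤ ‖x‖ → ω x = 0

def pot (ω : ℂ → ℝ) (x : ℂ) : ℝ := ∫ y, (-(1 / (2 * Real.pi)) * Real.log ‖x - y‖) * ω y
def gp (ω : ℂ → ℝ) (x : ℂ) : ℂ := ∫ y, (-(1 / (2 * Real.pi)) * ω y) • kk (x - y)

def ke (ε : ℝ) (z : ℂ) : ℂ := (‖z‖ ^ 2 + ε ^ 2)⁻¹ • z

lemma norm_ke_le {ε : ℝ} (hε : 0 < ε) (z : ℂ) : ‖ke ε z‖ ≤ ε⁻¹ := by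
  rw [ke, norm_smul, norm_inv, Real.norm_eq_abs, abs_of_pos (by positivity), inv_mul_le_iff₀ (by positivity)]
  rw [← div_eq_mul_inv, le_div_iff₀ hε]
  nlinarith [sq_nonneg (‖z‖ - ε), norm_nonneg z]

lemma norm_ke_sub_le (ε : ℝ) (z : ℂ) : ‖ke ε z - kk z‖ ≤ ‖z‖⁻¹ := by
  by_cases h : z = 0
  · simp [ke, kk, h]
  have h1 : 0 < ‖z‖ := by simpa using h
  rw [ke, kk, ← sub_smul, norm_smul, Real.norm_eq_abs]
  have h2 : (‖z‖ ^ 2 + ε ^ 2)⁻¹ ≤ (‖z‖ ^ 2)⁻¹ := by gcongr; nlinarith [sq_nonneg ε]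
  have h3 : 0 ≤ (‖z‖ ^ 2 + ε ^ 2)⁻¹ := by positivity
  have h4 : |(‖z‖ ^ 2 + ε ^ 2)⁻¹ - (‖z‖ ^ 2)⁻¹| ≤ (‖z‖ ^ 2)⁻¹ := by
    rw [abs_le]; constructor <;> linarith
  calc _ ≤ (‖z‖ ^ 2)⁻¹ * ‖z‖ := by gcongr
    _ = _ := by field_simp

def ee (n : ℕ) : ℝ := 1 / ((n : ℝ) + 1)
lemma ee_pos (n : ℕ) : 0 < ee n := by unfold ee; positivity
lemma ee_le_one (n : ℕ) : ee n ≤ 1 := by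
  unfold ee; rw [div_le_one (by positivity)]; linarith [(Nat.cast_nonneg n : (0:ℝ) ≤ n)]
lemma tendsto_ee : Tendsto ee atTop (𝓝 0) := tendsto_one_div_add_atTop_nhds_zero_nat

@[fun_prop] lemma continuous_ke (n : ℕ) : Continuous (ke (ee n)) := by
  unfold ke
  have : ∀ z : ℂ, ‖z‖ ^ 2 + ee n ^ 2 ≠ 0 := fun z => by have := ee_pos n; positivity
  fun_prop (disch := assumption)

def JJ (ρ : ℝ) (n : ℕ) : ℝ := ∫ z in ball (0:ℂ) ρ, ‖ke (ee n) z - kk z‖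

lemma tendsto_JJ (ρ : ℝ) : Tendsto (JJ ρ) atTop (𝓝 0) := by
  have : (0:ℝ) = ∫ z in ball (0:ℂ) ρ, (0:ℝ) := by simp
  rw [this]
  refine tendsto_integral_of_dominated_convergence (fun z => ‖z‖⁻¹) (fun n => ?_) (integrableOn_inv_norm ρ)
    (fun n => Eventually.of_forall fun z => ?_) (Eventually.of_forall fun z => ?_)
  · have := (continuous_ke n).measurable
    exact Measurable.aestronglyMeasurable (by fun_prop)
  · rw [norm_norm]; exact norm_ke_sub_le _ _
  · have h1 : Tendsto (fun n => ke (ee n) z) atTop (𝓝 (kk z)) := by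
      by_cases hz : z = 0
      · simp [hz, ke, kk]
      have h2 : ‖z‖ ^ 2 + 0 ^ 2 ≠ 0 := by simpa using hz
      have := (((tendsto_const_nhds (x := ‖z‖ ^ 2)).add (tendsto_ee.pow 2)).inv₀ h2).smul_const z
      simpa [ke, kk] using this
    have := (h1.sub (tendsto_const_nhds (x := kk z))).norm
    simpa using this

variable {ω : ℂ → ℝ} {C R : ℝ}

lemma Vort.integrable (h : Vort ω C R) : Integrable ω :=
  integrable_of_bdd h.meas.aestronglyMeasurable h.bdd h.supp

def gpe (ω : ℂ → ℝ) (n : ℕ) (x : ℂ) : ℂ := ∫ y, (-(1 / (2 * Real.pi)) * ω y) • ke (ee n) (x - y)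
def pote (ω : ℂ → ℝ) (n : ℕ) (x : ℂ) : ℝ :=
  ∫ y, (-(1 / (2 * Real.pi)) * ω y) * (1 / 2 * Real.log (‖x - y‖ ^ 2 + ee n ^ 2))

lemma Vort.integrable_gp (h : Vort ω C R) (x : ℂ) :
    Integrable fun y => (-(1 / (2 * Real.pi)) * ω y) • kk (x - y) := by
  have := h.meas
  refine integrable_sing (Measurable.aestronglyMeasurable (by fun_prop)) x (C := 1 / (2 * Real.pi) * C) (R := R)
    (fun y => ?_) (fun y hy => by rw [h.supp y hy]; simp)
  rw [norm_smul, norm_kk, norm_mul, norm_neg, Real.norm_of_nonneg (by positivity : 0 ≤ 1 / (2 * Real.pi)),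
    Real.norm_eq_abs]
  have := h.bdd y
  have := h.C0
  gcongr
  linarith

lemma Vort.integrable_gpe (h : Vort ω C R) (n : ℕ) (x : ℂ) :
    Integrable fun y => (-(1 / (2 * Real.pi)) * ω y) • ke (ee n) (x - y) := by
  have := h.meas
  have := (continuous_ke n).measurable
  have hp := ee_pos n
  refine integrable_of_bdd (Measurable.aestronglyMeasurable (by fun_prop))
    (C := 1 / (2 * Real.pi) * C * (ee n)⁻¹) (R := R)
    (fun y => ?_) (fun y hy => by rw [h.supp y hy]; simp)
  rw [norm_smul, norm_mul, norm_neg, Real.norm_of_nonneg (by positivity : 0 ≤ 1 / (2 * Real.pi)),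
    Real.norm_eq_abs]
  have := h.bdd y
  have := h.C0
  have := norm_ke_le hp (x - y)
  gcongr

lemma Vort.gpe_sub_le (h : Vort ω C R) (n : ℕ) {ρ : ℝ} {x : ℂ} (hx : ‖x‖ < ρ) :
    ‖gpe ω n x - gp ω x‖ ≤ (1 / (2 * Real.pi) * C) * JJ (ρ + R) n := by
  rw [gpe, gp, ← integral_sub (h.integrable_gpe n x) (h.integrable_gp x)]
  have hm := (continuous_ke n).measurable
  have hi : IntegrableOn (fun z => ‖ke (ee n) z - kk z‖) (ball (0:ℂ) (ρ + R)) :=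
    (integrableOn_inv_norm (ρ + R)).mono' (Measurable.aestronglyMeasurable (by fun_prop))
      (Eventually.of_forall fun z => by rw [norm_norm]; exact norm_ke_sub_le _ _)
  have hi2 := (integrable_indicator_iff measurableSet_ball).2 hi
  have e1 : JJ (ρ + R) n = ∫ y, (ball (0:ℂ) (ρ + R)).indicator (fun z => ‖ke (ee n) z - kk z‖) (x - y) := by
    rw [integral_sub_left_eq_self (fun z => (ball (0:ℂ) (ρ + R)).indicator (fun z => ‖ke (ee n) z - kk z‖) z)
      volume x, integral_indicator measurableSet_ball]; rfl
  rw [e1, ← integral_const_mul]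
  refine norm_integral_le_of_norm_le ((hi2.comp_sub_left x).const_mul _) (Eventually.of_forall fun y => ?_)
  by_cases hy : R ≤ ‖y‖
  · rw [h.supp y hy]
    simp only [mul_zero, zero_smul, sub_self, norm_zero]
    have := h.C0
    have : 0 ≤ (ball (0:ℂ) (ρ + R)).indicator (fun z => ‖ke (ee n) z - kk z‖) (x - y) :=
      indicator_nonneg (fun _ _ => norm_nonneg _) _
    positivity
  · have : x - y ∈ ball (0:ℂ) (ρ + R) := by
      simp only [mem_ball, dist_zero_right]
      push Not at hy
      linarith [norm_sub_le x y]
    rw [indicator_of_mem this, ← smul_sub, norm_smul, norm_mul, norm_neg,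
      Real.norm_of_nonneg (by positivity : 0 ≤ 1 / (2 * Real.pi)), Real.norm_eq_abs]
    have := h.bdd y
    gcongr

lemma Vort.tendstoUniformlyOn_gpe (h : Vort ω C R) (ρ : ℝ) :
    TendstoUniformlyOn (gpe ω) (gp ω) atTop (ball 0 ρ) := by
  rw [Metric.tendstoUniformlyOn_iff]
  intro ε hε
  have : Tendsto (fun n => (1 / (2 * Real.pi) * C) * JJ (ρ + R) n) atTop (𝓝 ((1 / (2 * Real.pi) * C) * 0)) :=
    (tendsto_JJ _).const_mul _
  rw [mul_zero] at this
  filter_upwards [this.eventually_lt_const hε] with n hn x hx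
  rw [dist_comm, dist_eq_norm]
  exact (h.gpe_sub_le n (by simpa using hx)).trans_lt hn

lemma Vort.continuous_gpe (h : Vort ω C R) (n : ℕ) : Continuous (gpe ω n) := by
  have hp := ee_pos n
  refine continuous_of_dominated (bound := fun y => 1 / (2 * Real.pi) * |ω y| * (ee n)⁻¹)
    (fun x => (h.integrable_gpe n x).aestronglyMeasurable) (fun x => Eventually.of_forall fun y => ?_) ?_
    (Eventually.of_forall fun y => by fun_prop)
  · rw [norm_smul, norm_mul, norm_neg, Real.norm_of_nonneg (by positivity : 0 ≤ 1 / (2 * Real.pi)),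
      Real.norm_eq_abs]
    have := norm_ke_le hp (x - y)
    gcongr
  · exact (h.integrable.abs.const_mul _).mul_const _

lemma Vort.continuous_gp (h : Vort ω C R) : Continuous (gp ω) := by
  rw [continuous_iff_continuousAt]
  intro x
  have h1 : ContinuousOn (gp ω) (ball 0 (‖x‖ + 1)) :=
    (h.tendstoUniformlyOn_gpe (‖x‖ + 1)).continuousOn
      (Frequently.of_forall fun n => (h.continuous_gpe n).continuousOn)
  exact h1.continuousAt (isOpen_ball.mem_nhds (by simp))

lemma isC1_reglog (n : ℕ) (y : ℂ) : ∀ x, HasFDerivAt (fun x => 1 / 2 * Real.log (‖x - y‖ ^ 2 + ee n ^ 2))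
    (dL (ke (ee n) (x - y))) x := by
  intro x
  have h1 := ((isC1_normSq.1 (x - y)).comp x ((hasFDerivAt_id x).sub_const y)).add_const (ee n ^ 2)
  have hp : ‖x - y‖ ^ 2 + ee n ^ 2 ≠ 0 := by have := ee_pos n; positivity
  have h2 := ((h1.log hp).const_mul (1/2))
  refine h2.congr_fderiv ?_
  rw [ke, dL_smul, dL_smul]
  ext v
  simp
  ring

lemma abs_log_le {s : ℝ} (hs : 0 < s) : |Real.log s| ≤ s + s⁻¹ := by
  have h1 := Real.log_le_sub_one_of_pos hs
  have h2 := Real.log_le_sub_one_of_pos (inv_pos.2 hs)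
  rw [Real.log_inv] at h2
  have := inv_pos.2 hs
  rw [abs_le]; constructor <;> linarith

lemma abs_reglog_le {z : ℂ} (hz : z ≠ 0) (n : ℕ) :
    |1 / 2 * Real.log (‖z‖ ^ 2 + ee n ^ 2)| ≤ ‖z‖ ^ 2 + ‖z‖ + ‖z‖⁻¹ := by
  have h0 : 0 < ‖z‖ := by simpa using hz
  have hp := ee_pos n
  have hp1 := ee_le_one n
  have h1 := Real.log_le_sub_one_of_pos (show 0 < ‖z‖ ^ 2 + ee n ^ 2 by positivity)
  have h2 := abs_log_le h0
  have h3 : Real.log (‖z‖ ^ 2) ≤ Real.log (‖z‖ ^ 2 + ee n ^ 2) :=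
    Real.log_le_log (by positivity) (by nlinarith)
  rw [Real.log_pow] at h3
  push_cast at h3
  have h4 := neg_abs_le (Real.log ‖z‖)
  have h5 : 0 < ‖z‖⁻¹ := by positivity
  rw [abs_le]; constructor <;> nlinarith

lemma Vort.pote_bound (h : Vort ω C R) (x : ℂ) :
    Integrable (fun y => (1 / (2 * Real.pi)) * |ω y| * (‖x - y‖ ^ 2 + ‖x - y‖ + ‖x - y‖⁻¹)) := by
  have := h.meas
  have hC := h.C0
  have hR := h.R0
  set K := (‖x‖ + R) ^ 2 + (‖x‖ + R) + 1 with hK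
  refine integrable_sing (Measurable.aestronglyMeasurable (by fun_prop)) x (C := 1 / (2 * Real.pi) * C * K) (R := R)
    (fun y => ?_) (fun y hy => by rw [h.supp y hy]; simp)
  rw [Real.norm_of_nonneg (by positivity)]
  by_cases hy : R ≤ ‖y‖
  · rw [h.supp y hy]; simp; positivity
  have h1 : ‖x - y‖ ≤ ‖x‖ + R := by
      push Not at hy
      linarith [norm_sub_le x y]
  have := h.bdd y
  rw [mul_assoc _ K]
  gcongr
  have h2 : ‖x - y‖ ^ 2 ≤ (‖x‖ + R) ^ 2 := by gcongr
  have h3 : 0 ≤ ‖x - y‖⁻¹ := by positivity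
  have h4 : 1 ≤ K := by rw [hK]; nlinarith [norm_nonneg x, sq_nonneg (‖x‖ + R)]
  nlinarith

lemma Vort.integrable_pote (h : Vort ω C R) (n : ℕ) (x : ℂ) :
    Integrable (fun y => (-(1 / (2 * Real.pi)) * ω y) * (1 / 2 * Real.log (‖x - y‖ ^ 2 + ee n ^ 2))) := by
  have := h.meas
  refine (h.pote_bound x).mono' (Measurable.aestronglyMeasurable (by fun_prop)) ?_
  have hx : ∀ᵐ y ∂(volume : Measure ℂ), y ≠ x := by simp [ae_iff, measure_singleton]
  filter_upwards [hx] with y hy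
  rw [norm_mul, norm_mul, norm_neg, Real.norm_of_nonneg (by positivity : 0 ≤ 1 / (2 * Real.pi)),
    Real.norm_eq_abs, Real.norm_eq_abs]
  gcongr
  exact abs_reglog_le (sub_ne_zero.2 hy.symm) n

lemma Vort.hasFDerivAt_pote (h : Vort ω C R) (n : ℕ) (x : ℂ) :
    HasFDerivAt (pote ω n) (dL (gpe ω n x)) x := by
  have hp := ee_pos n
  have e : dL (gpe ω n x) = ∫ y, (-(1 / (2 * Real.pi)) * ω y) • dL (ke (ee n) (x - y)) := by
    have hi := h.integrable_gpe n x
    have hi2 : Integrable (fun y => (-(1 / (2 * Real.pi)) * ω y) • dL (ke (ee n) (x - y))) := by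
      have h3 := (Complex.reCLM.integrable_comp hi).smul_const Complex.reCLM
      have h4 := (Complex.imCLM.integrable_comp hi).smul_const Complex.imCLM
      refine (h3.add h4).congr (Eventually.of_forall fun y => ?_)
      ext v
      simp [dot]
      ring
    ext v
    rw [dL_apply, ContinuousLinearMap.integral_apply hi2, gpe, dot_comm]
    rw [← dL_apply, ← (dL v).integral_comp_comm hi]
    congr 1; ext y
    rw [dL_apply, dot_smul_right, dot_comm v]
    simp
  rw [e]
  refine hasFDerivAt_integral_of_dominated_of_fderiv_le (s := univ)
    (bound := fun y => 1 / (2 * Real.pi) * |ω y| * (ee n)⁻¹) univ_mem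
    (Eventually.of_forall fun x => (h.integrable_pote n x).aestronglyMeasurable) (h.integrable_pote n x)
    ?_ (Eventually.of_forall fun y x _ => ?_) ((h.integrable.abs.const_mul _).mul_const _)
    (Eventually.of_forall fun y x _ => (isC1_reglog n y x).const_mul _)
  · have := h.meas.aestronglyMeasurable (μ := (volume : Measure ℂ))
    refine (this.const_mul (-(1 / (2 * Real.pi)))).smul ?_
    exact (continuous_dL.comp (by fun_prop)).aestronglyMeasurable
  · rw [norm_smul, norm_mul, norm_neg, Real.norm_of_nonneg (by positivity : 0 ≤ 1 / (2 * Real.pi)),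
      Real.norm_eq_abs]
    have h1 := norm_dL_sub_le (ke (ee n) (x - y)) 0
    simp only [dL_zero, sub_zero] at h1
    have := h1.trans (norm_ke_le hp (x - y))
    gcongr

lemma Vort.tendsto_pote (h : Vort ω C R) (x : ℂ) :
    Tendsto (fun n => pote ω n x) atTop (𝓝 (pot ω x)) := by
  have hx : ∀ᵐ y ∂(volume : Measure ℂ), y ≠ x := by simp [ae_iff, measure_singleton]
  refine tendsto_integral_of_dominated_convergence _ (fun n => (h.integrable_pote n x).aestronglyMeasurable)
    (h.pote_bound x) (fun n => ?_) ?_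
  · filter_upwards [hx] with y hy
    rw [norm_mul, norm_mul, norm_neg, Real.norm_of_nonneg (by positivity : 0 ≤ 1 / (2 * Real.pi)),
      Real.norm_eq_abs, Real.norm_eq_abs]
    gcongr
    exact abs_reglog_le (sub_ne_zero.2 hy.symm) n
  · filter_upwards [hx] with y hy
    have h0 : ‖x - y‖ ^ 2 + 0 ^ 2 ≠ 0 := by simpa [sub_eq_zero] using hy.symm
    have h1 := (((tendsto_const_nhds (x := ‖x - y‖ ^ 2)).add (tendsto_ee.pow 2)).log h0)
    have h2 := (h1.const_mul (1 / 2)).const_mul (-(1 / (2 * Real.pi)) * ω y)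
    convert h2 using 2
    rw [zero_pow two_ne_zero, add_zero, Real.log_pow]; push_cast; ring

lemma Vort.isC1 (h : Vort ω C R) : IsC1 (pot ω) (gp ω) := by
  refine ⟨fun x => ?_, h.continuous_gp⟩
  refine hasFDerivAt_of_tendstoUniformlyOn (l := atTop) (s := ball 0 (‖x‖ + 1)) (f := pote ω)
    (f' := fun n x => dL (gpe ω n x)) (g' := fun x => dL (gp ω x)) isOpen_ball ?_
    (fun n x _ => h.hasFDerivAt_pote n x) (fun x _ => h.tendsto_pote x) (by simp)
  have := h.tendstoUniformlyOn_gpe (‖x‖ + 1)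
  rw [Metric.tendstoUniformlyOn_iff] at this ⊢
  intro ε hε
  filter_upwards [this ε hε] with n hn x hx
  refine lt_of_le_of_lt ?_ (hn x hx)
  rw [dist_eq_norm, dist_eq_norm]
  exact norm_dL_sub_le _ _

lemma Vort.weak (h : Vort ω C R) {φ φ'} (k : IsC1c φ φ') :
    ∫ x, dot (gp ω x) (φ' x) = ∫ x, ω x * φ x := by
  obtain ⟨R', -, hR'⟩ := k.bound
  have hc := k.1.2
  obtain ⟨C', hC0', hC'⟩ := exists_bound_of_cont hc (fun x hx => (hR' x hx).2)
  have hm := hc.measurable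
  have hm2 := h.meas
  have hC := h.C0
  have e1 : ∀ x, dot (gp ω x) (φ' x) = ∫ y, (-(1 / (2 * Real.pi)) * ω y) * dot (kk (x - y)) (φ' x) := by
    intro x
    rw [dot_comm, ← dL_apply, gp, ← (dL (φ' x)).integral_comp_comm (h.integrable_gp x)]
    congr 1; ext y
    rw [dL_apply, dot_smul_right, dot_comm]
  simp only [e1]
  rw [integral_integral_swap]
  · congr 1; ext y
    rw [integral_const_mul, K_at k]
    field_simp
  · refine integrable_sing_prod (Measurable.aestronglyMeasurable (by unfold Function.uncurry; fun_prop))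
      (C := (1 / (2 * Real.pi) * C) * C') (R := max R R') ?_ ?_ ?_
    · rintro ⟨x, y⟩
      simp only [Function.uncurry]
      rw [norm_mul, norm_mul, norm_neg, Real.norm_of_nonneg (by positivity : 0 ≤ 1 / (2 * Real.pi)),
        Real.norm_eq_abs, Real.norm_eq_abs]
      have h3 := abs_dot_le (kk (x - y)) (φ' x)
      rw [norm_kk] at h3
      have := h.bdd y
      calc 1 / (2 * Real.pi) * |ω y| * |dot (kk (x - y)) (φ' x)| ≤ (1 / (2 * Real.pi) * C) * (‖x - y‖⁻¹ * C') := by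
            gcongr
            exact h3.trans (by gcongr; exact hC' x)
        _ = (1 / (2 * Real.pi) * C) * C' * ‖x - y‖⁻¹ := by ring
        _ ≤ _ := by gcongr; linarith
    · rintro ⟨x, y⟩ hp
      simp [Function.uncurry, (hR' x ((le_max_right _ _).trans hp)).2]
    · rintro ⟨x, y⟩ hp
      simp [Function.uncurry, h.supp y ((le_max_left _ _).trans hp)]

end RotPatch

namespace RotPatch
open Topology

/-- Abstract data used in the main argument. -/
structure Core (u : ℂ → ℝ) (g : ℂ → ℂ) (f : ℂ → ℝ) (T : Set ℝ) (Cf : ℝ) : Prop where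
  c1 : IsC1 u g
  fm : Measurable f
  fb : ∀ x, |f x| ≤ Cf
  fnn : ∀ x, 0 ≤ f x
  weak : ∀ φ φ', IsC1c φ φ' → ∫ x, dot (g x) (φ' x) = ∫ x, f x * φ x
  proper : ∀ τ, ∃ R, ∀ x, R ≤ ‖x‖ → u x < τ
  fin : T.Finite
  loc : ∀ x, u x ∉ T → ∀ᶠ y in 𝓝 x, f y = f x

variable {u : ℂ → ℝ} {g : ℂ → ℂ} {f : ℂ → ℝ} {T : Set ℝ} {Cf : ℝ}

lemma isC1_of_local {φ : ℂ → ℝ} {φ' : ℂ → ℂ}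
    (h : ∀ x, ∃ η η', IsC1 η η' ∧ ∀ᶠ y in 𝓝 x, φ y = η y ∧ φ' y = η' y) : IsC1 φ φ' := by
  refine ⟨fun x => ?_, continuous_iff_continuousAt.2 fun x => ?_⟩
  · obtain ⟨η, η', h1, h2⟩ := h x
    rw [h2.self_of_nhds.2]
    exact (h1.1 x).congr_of_eventuallyEq (h2.mono fun y hy => hy.1)
  · obtain ⟨η, η', h1, h2⟩ := h x
    exact h1.2.continuousAt.congr (h2.mono fun y hy => hy.2.symm)

lemma IsC1.ae_grad_eq_zero (h : IsC1 u g) (t : ℝ) : ∀ᵐ x, u x = t → g x = 0 := by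
  have hs : MeasurableSet {x | u x = t} := (isClosed_eq h.continuous continuous_const).measurableSet
  have h1 : ApproximatesLinearOn (fun x => ((u x - t : ℝ) : ℂ)) (0 : ℂ →L[ℝ] ℂ) {x | u x = t} 0 := by
    intro x hx y hy
    simp only [mem_ofPred_eq] at hx hy
    simp [hx, hy]
  have h2 := h1.norm_fderiv_sub_le (μ := volume) hs (fun x => Complex.ofRealCLM.comp (dL (g x)))
    (fun x _ => ((Complex.ofRealCLM.hasFDerivAt).comp x ((h.1 x).sub_const t)).hasFDerivWithinAt)
  rw [ae_restrict_iff' hs] at h2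
  filter_upwards [h2] with x hx hxt
  have h3 := hx hxt
  simp only [sub_zero, nonpos_iff_eq_zero, nnnorm_eq_zero] at h3
  apply dL_eq_zero
  ext v
  have := congrArg (fun L => L v) h3
  simpa using this

lemma IsC1.const_of_grad_zero {φ φ'} (h : IsC1 φ φ') (h0 : ∀ x, φ' x = 0) (x y : ℂ) : φ x = φ y := by
  refine is_const_of_fderiv_eq_zero (𝕜 := ℝ) (fun x => (h.1 x).differentiableAt) (fun x => ?_) x y
  rw [(h.1 x).fderiv, h0, dL_zero]

lemma hasDerivAt_maxsq (s : ℝ) : HasDerivAt (fun s : ℝ => (max s 0) ^ 2) (2 * max s 0) s := by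
  rcases lt_trichotomy s 0 with hs | hs | hs
  · have : (fun s : ℝ => (max s 0) ^ 2) =ᶠ[𝓝 s] fun _ => 0 := by
      filter_upwards [gt_mem_nhds hs] with y hy; simp [hy.le]
    rw [max_eq_right hs.le, mul_zero]
    exact (hasDerivAt_const s 0).congr_of_eventuallyEq this
  · subst hs
    simp only [max_self, mul_zero]
    rw [hasDerivAt_iff_isLittleO_nhds_zero]
    simp only [zero_add, max_self, smul_zero, sub_zero]
    have h1 : (fun h : ℝ => max h 0 ^ 2 - 0 ^ 2) =O[𝓝 0] fun h : ℝ => h ^ 2 := by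
      refine Asymptotics.IsBigO.of_bound 1 (Eventually.of_forall fun h => ?_)
      simp only [ne_eq, OfNat.ofNat_ne_zero, not_false_eq_true, zero_pow, sub_zero, norm_pow,
        Real.norm_eq_abs, one_mul]
      rw [abs_of_nonneg (le_max_right _ _), sq_abs]
      rcases le_total h 0 with hh | hh
      · simp [hh]; positivity
      · simp [hh]
    exact h1.trans_isLittleO (Asymptotics.isLittleO_pow_id one_lt_two)
  · have : (fun s : ℝ => (max s 0) ^ 2) =ᶠ[𝓝 s] fun s => s ^ 2 := by
      filter_upwards [lt_mem_nhds hs] with y hy; simp [hy.le]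
    rw [max_eq_left hs.le]
    simpa using (hasDerivAt_pow 2 s).congr_of_eventuallyEq this

/-- maximum principle -/
lemma Core.mp (K : Core u g f T Cf) {b : ℝ} {d : ℂ → ℝ}
    (hd : ∀ x, u x < b → ∀ᶠ y in 𝓝 x, d y = d x) {R : ℝ} (hR : ∀ x, R ≤ ‖x‖ → d x = 0)
    {x : ℂ} (hx : u x < b) : d x = 0 := by
  have hu := K.c1.continuous
  set ε := (b - u x) / 2 with hε
  have hε0 : 0 < ε := by rw [hε]; linarith
  set φ : ℂ → ℝ := fun y => d y ^ 2 * (max (b - ε - u y) 0) ^ 2 with hφ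
  set φ' : ℂ → ℂ := fun y => (-(d y ^ 2 * (2 * max (b - ε - u y) 0))) • g y with hφ'
  have h1 : IsC1 φ φ' := by
    apply isC1_of_local
    intro z
    by_cases hz : u z < b
    · have ha : IsC1 (fun y => b - ε - u y) (fun y => - g y) := by
        refine ⟨fun y => ?_, K.c1.2.neg⟩
        have := (K.c1.1 y).const_sub (b - ε)
        refine this.congr_fderiv ?_
        ext <;> simp [dot_neg_left]
      have hb := (isC1_const (d z ^ 2)).mul (ha.comp hasDerivAt_maxsq (by fun_prop))
      refine ⟨_, _, hb, ?_⟩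
      filter_upwards [hd z hz] with y hy
      refine ⟨by simp only [hφ, hy], ?_⟩
      simp only [hφ', hy, smul_neg, smul_zero, add_zero, neg_smul, smul_smul]
    · refine ⟨_, _, isC1_const 0, ?_⟩
      have : ∀ᶠ y in 𝓝 z, b - ε < u y :=
        hu.continuousAt.eventually_const_lt (by push Not at hz; linarith)
      filter_upwards [this] with y hy
      have : max (b - ε - u y) 0 = 0 := max_eq_right (by linarith)
      simp [hφ, hφ', this]
  have h2 : IsC1c φ φ' := ⟨h1, R, fun y hy => by simp [hφ, hR y hy]⟩
  have h3 := K.weak φ φ' h2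
  have h4 : 0 ≤ ∫ x, f x * φ x := integral_nonneg fun y =>
    mul_nonneg (K.fnn y) (by simp only [hφ]; positivity)
  have h5 : ∀ y, dot (g y) (φ' y) = -(d y ^ 2 * (2 * max (b - ε - u y) 0) * ‖g y‖ ^ 2) := by
    intro y; simp only [hφ']; rw [dot_smul_right, dot_self]; ring
  have h6 : Continuous fun y => - dot (g y) (φ' y) := by
    have := h1.2; have := K.c1.2; fun_prop
  have h7 : ∀ y, 0 ≤ - dot (g y) (φ' y) := fun y => by
    rw [h5, neg_neg]; positivity
  have h8 : (fun y => - dot (g y) (φ' y)) = fun _ => 0 := by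
    have h9 : ∫ y, - dot (g y) (φ' y) = 0 := by
      apply le_antisymm
      · rw [integral_neg, h3]; linarith
      · exact integral_nonneg h7
    obtain ⟨R', -, hR'⟩ := h2.bound
    rw [integral_eq_zero_iff_of_nonneg h7 (integrable_of_cont h6 (R := R') fun y hy => by
      rw [(hR' y hy).2]; simp)] at h9
    exact (h6.ae_eq_iff_eq volume continuous_const).1 h9
  have h10 : ∀ y, φ' y = 0 := by
    intro y
    have := congrFun h8 y
    rw [h5, neg_neg] at this
    rcases mul_eq_zero.1 this with h | h
    · simp only [hφ']; rw [h]; simp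
    · have : g y = 0 := by simpa using h
      simp only [hφ']; rw [this]; simp
  obtain ⟨R', hR0', hR'⟩ := h2.bound
  have h11 : φ x = φ R' := h1.const_of_grad_zero h10 _ _
  rw [(hR' R' (by simp [abs_of_pos hR0'])).1] at h11
  simp only [hφ] at h11
  rcases mul_eq_zero.1 h11 with h | h
  · simpa using h
  · exfalso
    have h12 : max (b - ε - u x) 0 = 0 := by simpa using h
    have := le_max_left (b - ε - u x) 0
    rw [h12] at this
    linarith

lemma isPreconnected_outer {R : ℝ} (_hR : 0 ≤ R) : IsPreconnected {x : ℂ | R < ‖x‖} := by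
  have h1 : IsPreconnected ((Ioi R) ×ˢ (univ : Set ℝ)) := isPreconnected_Ioi.prod isPreconnected_univ
  have h2 := h1.image (fun p : ℝ × ℝ => (p.1 : ℂ) * Complex.exp (p.2 * Complex.I)) (by fun_prop)
  convert h2
  ext z
  simp only [mem_ofPred_eq, mem_image, mem_prod, mem_Ioi, mem_univ, and_true]
  constructor
  · intro hz
    exact ⟨(‖z‖, Complex.arg z), hz, Complex.norm_mul_exp_arg_mul_I z⟩
  · rintro ⟨p, hp, rfl⟩
    rw [norm_mul, Complex.norm_exp_ofReal_mul_I, mul_one, Complex.norm_real]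
    exact hp.trans_le (le_abs_self _)

lemma eventually_const_of_deriv_zero {ψ : ℂ → ℝ} {U : Set ℂ} (hU : IsOpen U)
    (h : ∀ x ∈ U, HasFDerivAt ψ (0 : ℂ →L[ℝ] ℝ) x) {x : ℂ} (hx : x ∈ U) : ∀ᶠ y in 𝓝 x, ψ y = ψ x := by
  obtain ⟨r, hr, hb⟩ := Metric.isOpen_iff.1 hU x hx
  filter_upwards [ball_mem_nhds x hr] with y hy
  exact isOpen_ball.is_const_of_fderiv_eq_zero (𝕜 := ℝ) (convex_ball x r).isPreconnected
    (fun z hz => (h z (hb hz)).differentiableAt.differentiableWithinAt)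
    (fun z hz => (h z (hb hz)).fderiv) hy (mem_ball_self hr)

/-- extension of `f` from the layer as a locally constant function. -/
lemma Core.star (K : Core u g f T Cf) {a a' b : ℝ} (haa : a < a') (hab : a' < b)
    (hT : ∀ t ∈ T, ¬ (a < t ∧ t < b)) :
    ∃ c : ℂ → ℝ, (∀ x, a' < u x → ∀ᶠ y in 𝓝 x, c y = c x) ∧ ∀ x, a' < u x → u x < b → c x = f x := by
  have hu := K.c1.continuous
  obtain ⟨a'', ha1, ha2⟩ := exists_between hab
  have hgap : ∀ x, a < u x → u x < b → ∀ᶠ y in 𝓝 x, f y = f x := fun x h1 h2 =>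
    K.loc x fun h => hT _ h ⟨h1, h2⟩
  obtain ⟨χ, hχ0, hχ1, -⟩ := exists_contMDiffMap_zero_one_nhds_of_isClosed (n := 2) (modelWithCornersSelf ℝ ℂ)
    (s := {x | u x ≤ a} ∪ {x | b ≤ u x}) (t := {x | a' ≤ u x} ∩ {x | u x ≤ a''})
    ((isClosed_le hu continuous_const).union (isClosed_le continuous_const hu))
    ((isClosed_le continuous_const hu).inter (isClosed_le hu continuous_const))
    (by
      rw [Set.disjoint_left]
      rintro x (hx | hx) ⟨h1, h2⟩ <;> simp only [mem_ofPred_eq] at hx h1 h2 <;> linarith)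
  have hχs : ContDiff ℝ 2 (χ : ℂ → ℝ) := χ.contMDiff.contDiff
  rw [eventually_nhdsSet_iff_forall] at hχ0 hχ1
  set η : ℂ → ℝ := fun x => χ x * f x with hη
  have hηs : ContDiff ℝ 2 η := by
    rw [contDiff_iff_contDiffAt]
    intro x
    by_cases hx : x ∈ {x | u x ≤ a} ∪ {x | b ≤ u x}
    · refine (contDiffAt_const (c := (0:ℝ))).congr_of_eventuallyEq ?_
      filter_upwards [hχ0 x hx] with y hy
      simp [hη, hy]
    · have h1 : a < u x ∧ u x < b := by
        simp only [mem_union, mem_ofPred_eq, not_or, not_le] at hx; exact hx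
      refine (hχs.contDiffAt.mul (contDiffAt_const (c := f x))).congr_of_eventuallyEq ?_
      filter_upwards [hgap x h1.1 h1.2] with y hy
      simp [hη, hy]
  have hη1 : ContDiff ℝ 1 (fderiv ℝ η) := hηs.fderiv_right (by norm_num)
  have hηc : ∀ x, a' ≤ u x → u x ≤ a'' → fderiv ℝ η x = 0 := by
    intro x h1 h2
    have : η =ᶠ[𝓝 x] fun _ => f x := by
      filter_upwards [hχ1 x ⟨h1, h2⟩, hgap x (by linarith) (by linarith)] with y hy hy'
      simp [hη, hy, hy']
    rw [this.fderiv_eq, fderiv_fun_const]; rfl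
  classical
  set W : ℂ → (ℂ →L[ℝ] ℝ) := fun x => if a' < u x then fderiv ℝ η x else 0 with hW
  have hW1 : ∀ x, a' < u x → W =ᶠ[𝓝 x] fderiv ℝ η := by
    intro x hx
    filter_upwards [hu.continuousAt.eventually_const_lt hx] with y hy
    simp [hW, hy]
  have hW2z : ∀ x, u x < a'' → W x = 0 := by
    intro x hx
    by_cases h : a' < u x
    · simp only [hW, h, if_true]; exact hηc x h.le hx.le
    · simp only [hW, h, if_false]
  have hW2 : ∀ x, u x ≤ a' → W =ᶠ[𝓝 x] fun _ => 0 := by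
    intro x hx
    filter_upwards [hu.continuousAt.eventually_lt_const (show u x < a'' by linarith)] with y hy
    exact hW2z y hy
  obtain ⟨ψ₀, hψ₀⟩ := convex_univ.exists_forall_hasFDerivAt_of_fderiv_symmetric (𝕜 := ℝ) (E := ℂ) (F := ℝ) (ω := W)
    isOpen_univ (by
      intro x _
      apply DifferentiableAt.differentiableWithinAt
      by_cases h : a' < u x
      · exact ((hη1.differentiable (by norm_num)) x).congr_of_eventuallyEq (hW1 x h)
      · exact (differentiableAt_const 0).congr_of_eventuallyEq (hW2 x (not_lt.1 h))) (by
      intro x _ v w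
      by_cases h : a' < u x
      · rw [(hW1 x h).fderiv_eq]
        exact second_derivative_symmetric (𝕜 := ℝ) (f := η) (f' := fderiv ℝ η)
          (fun y => (hηs.differentiable (by norm_num) y).hasFDerivAt)
          ((hη1.differentiable (by norm_num) x).hasFDerivAt) v w
      · rw [(hW2 x (not_lt.1 h)).fderiv_eq]; simp)
  simp only [mem_univ, true_implies] at hψ₀
  obtain ⟨R₀, hR₀⟩ := K.proper a'
  set R := |R₀| with hRdef
  have hR : ∀ x : ℂ, R < ‖x‖ → u x < a' := fun x hx => hR₀ x ((le_abs_self _).trans hx.le)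
  have hRo : IsOpen {x : ℂ | R < ‖x‖} := isOpen_lt continuous_const continuous_norm
  obtain ⟨k, hk⟩ := hRo.exists_is_const_of_fderiv_eq_zero (𝕜 := ℝ) (f := ψ₀)
    (isPreconnected_outer (abs_nonneg _))
    (fun x _ => (hψ₀ x).differentiableAt.differentiableWithinAt)
    (fun x hx => by rw [(hψ₀ x).fderiv, hW2z x (by linarith [hR x hx])]; rfl)
  set ψ : ℂ → ℝ := fun x => ψ₀ x - k with hψdef
  have hψ : ∀ x, HasFDerivAt ψ (W x) x := fun x => (hψ₀ x).sub_const k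
  have hψfar : ∀ x, R + 1 ≤ ‖x‖ → ψ x = 0 := fun x hx => by
    simp only [hψdef]; rw [hk x (show x ∈ {x : ℂ | R < ‖x‖} by simp only [mem_ofPred_eq]; linarith)]; simp
  have hψz : ∀ x, u x < a'' → ψ x = 0 := fun x hx => by
    refine K.mp (b := a'') (d := ψ) (fun y hy => ?_) hψfar hx
    exact eventually_const_of_deriv_zero (isOpen_lt hu continuous_const)
      (fun z hz => by rw [← hW2z z hz]; exact hψ z) hy
  set c : ℂ → ℝ := fun x => η x - ψ x with hc
  have hcl : ∀ x, a' < u x → ∀ᶠ y in 𝓝 x, c y = c x := by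
    intro x hx
    refine eventually_const_of_deriv_zero (isOpen_lt continuous_const hu) (fun z hz => ?_) hx
    have h1 := ((hηs.differentiable (by norm_num) z).hasFDerivAt).sub (hψ z)
    have h2 : W z = fderiv ℝ η z := (hW1 z hz).self_of_nhds
    rwa [h2, sub_self] at h1
  have hcf : ∀ x, a' < u x → u x < a'' → c x = f x := by
    intro x h1 h2
    simp only [hc, hψz x h2, hη, sub_zero]
    rw [(hχ1 x ⟨h1.le, h2.le⟩).self_of_nhds, one_mul]
  refine ⟨c, hcl, fun x h1 h2 => ?_⟩
  set d : ℂ → ℝ := fun x => if a' < u x then c x - f x else 0 with hd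
  have hdz : ∀ y, u y < a'' → d y = 0 := by
    intro y hy
    by_cases h : a' < u y
    · simp only [hd, h, if_true, hcf y h hy, sub_self]
    · simp only [hd, h, if_false]
  have hd0 := K.mp (b := b) (d := d) (R := R + 1) (fun y hy => ?_) (fun y hy => ?_) h2
  · simp only [hd, h1, if_true] at hd0; linarith
  · by_cases h : u y < a''
    · rw [hdz y h]
      filter_upwards [hu.continuousAt.eventually_lt_const h] with z hz using hdz z hz
    · have h3 : a' < u y := by linarith
      filter_upwards [hu.continuousAt.eventually_const_lt h3, hcl y h3, hgap y (by linarith) hy] with z hz1 hz2 hz3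
      simp only [hd, hz1, h3, if_true, hz2, hz3]
  · exact hdz y (by linarith [hR y (by linarith)])

end RotPatch

namespace RotPatch
open Topology

variable {u : ℂ → ℝ} {g : ℂ → ℂ} {f : ℂ → ℝ} {T : Set ℝ} {Cf : ℝ}

/-- smooth step profile -/
def bet (h s : ℝ) : ℝ := Real.smoothTransition (s / h)
/-- its derivative -/
def bb (h s : ℝ) : ℝ := deriv (bet h) s

lemma contDiff_bet (h : ℝ) : ContDiff ℝ 1 (bet h) := by
  unfold bet
  exact Real.smoothTransition.contDiff.comp (contDiff_id.div_const h)

lemma bet_deriv (h s : ℝ) : HasDerivAt (bet h) (bb h s) s :=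
  ((contDiff_bet h).differentiable (by norm_num) s).hasDerivAt

@[fun_prop] lemma continuous_bet (h : ℝ) : Continuous (bet h) := (contDiff_bet h).continuous
@[fun_prop] lemma continuous_bb (h : ℝ) : Continuous (bb h) := (contDiff_bet h).continuous_deriv (by norm_num)

lemma bet_nonneg (h s : ℝ) : 0 ≤ bet h s := Real.smoothTransition.nonneg _
lemma bet_le_one (h s : ℝ) : bet h s ≤ 1 := Real.smoothTransition.le_one _

variable {h : ℝ}

lemma bet_zero (hh : 0 < h) {s : ℝ} (hs : s ≤ 0) : bet h s = 0 :=
  Real.smoothTransition.zero_of_nonpos (div_nonpos_of_nonpos_of_nonneg hs hh.le)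

lemma bet_one (hh : 0 < h) {s : ℝ} (hs : h ≤ s) : bet h s = 1 :=
  Real.smoothTransition.one_of_one_le ((one_le_div hh).2 hs)

lemma bet_mono (hh : 0 < h) : Monotone (bet h) := fun _ _ hab =>
  Real.smoothTransition.monotone (div_le_div_of_nonneg_right hab hh.le)

lemma bb_nonneg (hh : 0 < h) (s : ℝ) : 0 ≤ bb h s := (bet_mono hh).deriv_nonneg

lemma bb_zero (hh : 0 < h) {s : ℝ} (hs : s ≤ 0) : bb h s = 0 := by
  have : IsLocalMin (bet h) s := by
    refine Eventually.of_forall fun y => ?_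
    rw [bet_zero hh hs]; exact bet_nonneg _ _
  exact this.deriv_eq_zero

lemma bb_one (hh : 0 < h) {s : ℝ} (hs : h ≤ s) : bb h s = 0 := by
  have : IsLocalMax (bet h) s := by
    refine Eventually.of_forall fun y => ?_
    rw [bet_one hh hs]; exact bet_le_one _ _
  exact this.deriv_eq_zero

/-- profile with derivative, vanishing on the negative half-line -/
structure Prof (γ γ' : ℝ → ℝ) : Prop where
  der : ∀ s, HasDerivAt γ (γ' s) s
  cont : Continuous γ'
  zero : ∀ s, s ≤ 0 → γ s = 0
  zero' : ∀ s, s ≤ 0 → γ' s = 0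

lemma Prof.continuous {γ γ'} (p : Prof γ γ') : Continuous γ :=
  continuous_iff_continuousAt.2 fun s => (p.der s).continuousAt

lemma prof_bet (hh : 0 < h) : Prof (bet h) (bb h) :=
  ⟨bet_deriv h, continuous_bb h, fun _ hs => bet_zero hh hs, fun _ hs => bb_zero hh hs⟩

lemma prof_bet_sq (hh : 0 < h) : Prof (fun s => bet h s ^ 2) (fun s => 2 * bet h s * bb h s) :=
  ⟨fun s => by
    have := (bet_deriv h s).fun_pow 2
    simpa using this, by fun_prop,
    fun _ hs => by simp [bet_zero hh hs], fun _ hs => by simp [bet_zero hh hs]⟩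

/-- locally bounded measurable -/
def LB (F : ℂ → ℝ) : Prop := Measurable F ∧ ∀ R : ℝ, ∃ C, ∀ x, ‖x‖ ≤ R → |F x| ≤ C

lemma LB.mul {F G : ℂ → ℝ} (hF : LB F) (hG : LB G) : LB (fun x => F x * G x) := by
  refine ⟨hF.1.mul hG.1, fun R => ?_⟩
  obtain ⟨C, hC⟩ := hF.2 R
  obtain ⟨D, hD⟩ := hG.2 R
  refine ⟨C * D, fun x hx => ?_⟩
  rw [abs_mul]
  exact mul_le_mul (hC x hx) (hD x hx) (abs_nonneg _) ((abs_nonneg _).trans (hC x hx))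

lemma lb_of_cont {F : ℂ → ℝ} (hF : Continuous F) : LB F := by
  refine ⟨hF.measurable, fun R => ?_⟩
  obtain ⟨C, hC⟩ := (isCompact_closedBall (0:ℂ) R).exists_bound_of_continuousOn hF.continuousOn
  exact ⟨C, fun x hx => hC x (by simpa using hx)⟩

lemma LB.neg {F : ℂ → ℝ} (hF : LB F) : LB (fun x => - F x) :=
  ⟨hF.1.neg, fun R => by obtain ⟨C, hC⟩ := hF.2 R; exact ⟨C, fun x hx => by rw [abs_neg]; exact hC x hx⟩⟩

lemma LB.add {F G : ℂ → ℝ} (hF : LB F) (hG : LB G) : LB (fun x => F x + G x) := by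
  refine ⟨hF.1.add hG.1, fun R => ?_⟩
  obtain ⟨C, hC⟩ := hF.2 R
  obtain ⟨D, hD⟩ := hG.2 R
  exact ⟨C + D, fun x hx => (abs_add_le _ _).trans (add_le_add (hC x hx) (hD x hx))⟩

lemma Core.lb (K : Core u g f T Cf) : LB f := ⟨K.fm, fun _ => ⟨Cf, fun x _ => K.fb x⟩⟩

lemma Core.int_gen (K : Core u g f T Cf) {F : ℂ → ℝ} (hF : LB F) {γ : ℝ → ℝ} (hγ : Measurable γ)
    {Cγ : ℝ} (hb : ∀ s, |γ s| ≤ Cγ) (hz : ∀ s, s < 0 → γ s = 0) (t : ℝ) :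
    Integrable (fun x => F x * γ (u x - t)) := by
  obtain ⟨R, hR⟩ := K.proper t
  obtain ⟨C, hC⟩ := hF.2 R
  have hu := K.c1.continuous
  have hC0 : 0 ≤ |C| := abs_nonneg C
  have hCg : 0 ≤ Cγ := (abs_nonneg _).trans (hb 0)
  refine integrable_of_bdd (C := |C| * Cγ) (R := R) ?_ (fun x => ?_) (fun x hx => ?_)
  · exact (hF.1.mul (hγ.comp (hu.measurable.sub_const t))).aestronglyMeasurable
  · by_cases hx : ‖x‖ ≤ R
    · rw [Real.norm_eq_abs, abs_mul]
      exact mul_le_mul ((hC x hx).trans (le_abs_self _)) (hb _) (abs_nonneg _) hC0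
    · rw [hz _ (by linarith [hR x (by linarith)])]; simp; positivity
  · rw [hz _ (by linarith [hR x hx])]; simp

lemma Core.bddAbove (K : Core u g f T Cf) : ∃ U, ∀ x, u x ≤ U := by
  obtain ⟨R, hR⟩ := K.proper 0
  obtain ⟨C, hC⟩ := (isCompact_closedBall (0:ℂ) R).exists_bound_of_continuousOn
    K.c1.continuous.continuousOn
  refine ⟨|C|, fun x => ?_⟩
  by_cases hx : ‖x‖ ≤ R
  · exact (le_abs_self _).trans ((hC x (by simpa using hx)).trans (le_abs_self _))
  · exact (hR x (by linarith)).le.trans (abs_nonneg _)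

lemma Core.int1 (K : Core u g f T Cf) {F : ℂ → ℝ} (hF : LB F) {γ : ℝ → ℝ} (hγ : Continuous γ)
    (hz : ∀ s, s ≤ 0 → γ s = 0) (t : ℝ) :
    Integrable (fun x => F x * γ (u x - t)) := by
  obtain ⟨U, hU⟩ := K.bddAbove
  obtain ⟨C, hC⟩ := (isCompact_Icc (a := (0:ℝ)) (b := U - t)).exists_bound_of_continuousOn hγ.continuousOn
  have := K.int_gen hF (γ := fun s => if s ≤ U - t then γ s else 0)
    (Measurable.ite measurableSet_Iic hγ.measurable measurable_const) (Cγ := |C|) (fun s => ?_) (fun s hs => ?_) t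
  · refine this.congr (Eventually.of_forall fun x => ?_)
    simp [hU x]
  · split_ifs with h1
    · by_cases h2 : s ≤ 0
      · rw [hz _ h2]; simp
      · exact (hC s ⟨by linarith, h1⟩).trans (le_abs_self _)
    · simp
  · simp [hz s hs.le]

lemma Core.derT (K : Core u g f T Cf) {F : ℂ → ℝ} (hF : LB F) {γ γ' : ℝ → ℝ} (p : Prof γ γ') (t : ℝ) :
    HasDerivAt (fun t => ∫ x, F x * γ (u x - t)) (-∫ x, F x * γ' (u x - t)) t := by
  obtain ⟨U, hU⟩ := K.bddAbove
  obtain ⟨R, hR⟩ := K.proper (t - 1)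
  obtain ⟨C, hC⟩ := hF.2 R
  have hu := K.c1.continuous
  have h1 := p.continuous
  have h2 := p.cont
  obtain ⟨D, hD⟩ := (isCompact_Icc (a := (0:ℝ)) (b := U - (t - 1))).exists_bound_of_continuousOn h2.continuousOn
  have key := hasDerivAt_integral_of_dominated_loc_of_deriv_le (μ := (volume : Measure ℂ))
    (F := fun t x => F x * γ (u x - t)) (F' := fun t x => F x * (- γ' (u x - t))) (x₀ := t)
    (s := ball t 1) (bound := (ball (0:ℂ) R).indicator fun _ => |C| * |D|) (ball_mem_nhds _ one_pos) ?_ ?_ ?_ ?_ ?_ ?_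
  · have := key.2
    simpa only [mul_neg, integral_neg] using this
  · exact Eventually.of_forall fun s => (K.int1 hF h1 p.zero s).aestronglyMeasurable
  · exact K.int1 hF h1 p.zero t
  · have := (K.int1 hF h2 p.zero' t).neg.aestronglyMeasurable
    simp only [mul_neg]
    exact this
  · refine Eventually.of_forall fun x s hs => ?_
    rw [mem_ball, Real.dist_eq, abs_lt] at hs
    by_cases hx : ‖x‖ < R
    · rw [indicator_of_mem (by simpa using hx), Real.norm_eq_abs, abs_mul, abs_neg]
      refine mul_le_mul ((hC x hx.le).trans (le_abs_self _)) ?_ (abs_nonneg _) (abs_nonneg _)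
      by_cases h3 : u x - s ≤ 0
      · rw [p.zero' _ h3]; simp
      · exact (hD _ ⟨by linarith, by linarith [hU x]⟩).trans (le_abs_self _)
    · rw [indicator_of_notMem (by simpa using hx), p.zero' _ (by linarith [hR x (by linarith)])]; simp
  · rw [integrable_indicator_iff measurableSet_ball]
    exact integrableOn_const measure_ball_lt_top.ne
  · refine Eventually.of_forall fun x s _ => ?_
    have : HasDerivAt (fun t => γ (u x - t)) (γ' (u x - s) * (-1)) s :=
      (p.der (u x - s)).comp s ((hasDerivAt_id s).const_sub (u x))
    simpa using this.const_mul (F x)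

/-- dominated convergence for sequences of cutoffs of `u` -/
lemma Core.dct (K : Core u g f T Cf) {F : ℂ → ℝ} (hF : LB F) {w : ℕ → ℂ → ℝ} {w0 : ℂ → ℝ}
    (hw : ∀ n, Measurable (w n)) (hb : ∀ n x, |w n x| ≤ 1) (t : ℝ) (hz : ∀ n x, u x < t → w n x = 0)
    (hl : ∀ x, Tendsto (fun n => w n x) atTop (𝓝 (w0 x))) :
    Tendsto (fun n => ∫ x, F x * w n x) atTop (𝓝 (∫ x, F x * w0 x)) := by
  obtain ⟨R, hR⟩ := K.proper t
  obtain ⟨C, hC⟩ := hF.2 R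
  refine tendsto_integral_of_dominated_convergence ((ball (0:ℂ) R).indicator fun _ => |C|) (fun n => ?_) ?_
    (fun n => Eventually.of_forall fun x => ?_) (Eventually.of_forall fun x => (hl x).const_mul _)
  · exact (hF.1.mul (hw n)).aestronglyMeasurable
  · rw [integrable_indicator_iff measurableSet_ball]
    exact integrableOn_const measure_ball_lt_top.ne
  · by_cases hx : ‖x‖ < R
    · rw [indicator_of_mem (by simpa using hx), Real.norm_eq_abs, abs_mul]
      calc _ ≤ |C| * 1 := mul_le_mul ((hC x hx.le).trans (le_abs_self _)) (hb n x) (abs_nonneg _) (abs_nonneg _)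
        _ = _ := mul_one _
    · rw [indicator_of_notMem (by simpa using hx), hz n x (hR x (by linarith))]; simp

/-- comparison of increments -/
lemma incr_le {Y Z Y' Z' : ℝ → ℝ} {s1 s2 : ℝ} (h12 : s1 ≤ s2)
    (hY : ∀ s ∈ Icc s1 s2, HasDerivAt Y (Y' s) s) (hZ : ∀ s ∈ Icc s1 s2, HasDerivAt Z (Z' s) s)
    (hle : ∀ s ∈ Icc s1 s2, Y' s ≤ Z' s) : Y s2 - Y s1 ≤ Z s2 - Z s1 := by
  have : MonotoneOn (fun s => Z s - Y s) (Icc s1 s2) := by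
    refine monotoneOn_of_deriv_nonneg (convex_Icc _ _) ?_ ?_ ?_
    · exact fun s hs => ((hZ s hs).sub (hY s hs)).continuousAt.continuousWithinAt
    · intro s hs
      have hs' := interior_subset hs
      exact ((hZ s hs').sub (hY s hs')).differentiableAt.differentiableWithinAt
    · intro s hs
      have hs' := interior_subset hs
      rw [((hZ s hs').fun_sub (hY s hs')).deriv]
      linarith [hle s hs']
  have := this (left_mem_Icc.2 h12) (right_mem_Icc.2 h12) h12
  simp only at this
  linarith

end RotPatch

namespace RotPatch
open Topology

variable {u : ℂ → ℝ} {g : ℂ → ℂ} {f : ℂ → ℝ} {T : Set ℝ} {Cf : ℝ} {h : ℝ}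

lemma Core.isC1_sub (K : Core u g f T Cf) (t : ℝ) : IsC1 (fun x => u x - t) g :=
  ⟨fun x => (K.c1.1 x).sub_const t, K.c1.2⟩

lemma Core.prof (K : Core u g f T Cf) {γ γ' : ℝ → ℝ} (p : Prof γ γ') (t : ℝ) :
    IsC1c (fun x => γ (u x - t)) (fun x => γ' (u x - t) • g x) := by
  refine ⟨(K.isC1_sub t).comp p.der p.cont, ?_⟩
  obtain ⟨R, hR⟩ := K.proper t
  exact ⟨R, fun x hx => p.zero _ (by linarith [hR x hx])⟩

lemma Core.lbg (K : Core u g f T Cf) : LB (fun x => ‖g x‖ ^ 2) := lb_of_cont (by have := K.c1.2; fun_prop)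
lemma Core.lbxg (K : Core u g f T Cf) : LB (fun x => dot x (g x)) := lb_of_cont (by have := K.c1.2; fun_prop)

lemma Core.lbs (K : Core u g f T Cf) : LB (fun x => √(f x)) := by
  refine ⟨K.fm.sqrt, fun R => ⟨√Cf, fun x _ => ?_⟩⟩
  rw [abs_of_nonneg (Real.sqrt_nonneg _)]
  exact Real.sqrt_le_sqrt ((le_abs_self _).trans (K.fb x))

/-- `∫ f β(u-t) = ∫ |∇u|² β'(u-t)` -/
lemma Core.B_eq (K : Core u g f T Cf) {γ γ' : ℝ → ℝ} (p : Prof γ γ') (t : ℝ) :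
    ∫ x, f x * γ (u x - t) = ∫ x, ‖g x‖ ^ 2 * γ' (u x - t) := by
  rw [← K.weak _ _ (K.prof p t)]
  congr 1; ext x; rw [dot_smul_right, dot_self]; ring

lemma Core.psi (K : Core u g f T Cf) {a b t : ℝ} (hh : 0 < h) (hat : a < t) (htb : t + h ≤ b)
    (hT : ∀ t ∈ T, ¬ (a < t ∧ t < b)) : ∃ ψ : ℂ → ℝ,
      IsC1c ψ (fun x => (√(f x) * bb h (u x - t)) • g x) ∧
      (∀ x, t + h ≤ u x → u x < b → ψ x = √(f x)) ∧
      ∫ x, ψ x ^ 2 = - ∫ x, (f x * dot x (g x)) * (bet h (u x - t) * bb h (u x - t)) := by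
  obtain ⟨c, hc1, hc2⟩ := K.star (a := a) (a' := (a + t) / 2) (b := b) (by linarith) (by linarith) hT
  have hu := K.c1.continuous
  set ψ : ℂ → ℝ := fun x => if (a + t) / 2 < u x then √(c x) * bet h (u x - t) else 0 with hψ
  have hψz : ∀ x, u x ≤ t → ψ x = 0 := by
    intro x hx
    simp only [hψ]; split_ifs
    · rw [bet_zero hh (by linarith), mul_zero]
    · rfl
  have hψ1 : IsC1c ψ (fun x => (√(f x) * bb h (u x - t)) • g x) := by
    refine ⟨isC1_of_local fun x => ?_, ?_⟩
    · by_cases hx : (a + t) / 2 < u x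
      · refine ⟨_, _, (isC1_const (√(c x))).mul ((K.prof (prof_bet hh) t).1), ?_⟩
        filter_upwards [hc1 x hx, hu.continuousAt.eventually_const_lt hx] with y hy hy2
        refine ⟨by simp only [hψ, hy2, if_true, hy], ?_⟩
        simp only [smul_zero, add_zero, smul_smul]
        by_cases hb : u y < b
        · rw [← hc2 y hy2 hb, hy]
        · rw [bb_one hh (by linarith)]; simp
      · refine ⟨_, _, isC1_const 0, ?_⟩
        filter_upwards [hu.continuousAt.eventually_lt_const (show u x < t by linarith)] with y hy
        exact ⟨hψz y hy.le, by rw [bb_zero hh (by linarith)]; simp⟩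
    · obtain ⟨R, hR⟩ := K.proper t
      exact ⟨R, fun x hx => hψz x (hR x hx).le⟩
  refine ⟨ψ, hψ1, fun x h1 h2 => ?_, ?_⟩
  · simp only [hψ]
    rw [if_pos (by linarith), bet_one hh (by linarith), hc2 x (by linarith) h2, mul_one]
  · have := int_dot_id (hψ1.mul hψ1.1)
    have h2 : ∀ x, dot x (ψ x • ((√(f x) * bb h (u x - t)) • g x) + ψ x • ((√(f x) * bb h (u x - t)) • g x))
        = 2 * ((f x * dot x (g x)) * (bet h (u x - t) * bb h (u x - t))) := by
      intro x
      rw [dot_add_right, dot_smul_right, dot_smul_right]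
      by_cases h3 : t < u x
      · by_cases h4 : u x < b
        · have : ψ x = √(f x) * bet h (u x - t) := by
            simp only [hψ]; rw [if_pos (by linarith), hc2 x (by linarith) h4]
          rw [this]
          have := Real.mul_self_sqrt (K.fnn x)
          linear_combination (2 * bet h (u x - t) * bb h (u x - t) * dot x (g x)) * this
        · rw [bb_one hh (by linarith)]; simp
      · rw [bb_zero hh (by linarith)]; simp
    simp only [h2] at this
    rw [integral_const_mul] at this
    have h5 : ∀ x, ψ x ^ 2 = ψ x * ψ x := fun x => sq _
    simp only [h5]
    linarith

/-- the vector deficit -/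
def defv (f : ℂ → ℝ) (g : ℂ → ℂ) (x y : ℂ) : ℂ := √(f x) • g y - √(f y) • RR (x - y) (g x)

/-- integrated squared deficit -/
def Def (u : ℂ → ℝ) (g : ℂ → ℂ) (f : ℂ → ℝ) (h t : ℝ) : ℝ :=
  ∫ p : ℂ × ℂ, (bb h (u p.1 - t) * bb h (u p.2 - t)) * ‖defv f g p.1 p.2‖ ^ 2 ∂(volume.prod volume)

lemma RR_smul (r v : ℂ) (c : ℝ) : RR r (c • v) = c • RR r v := by
  unfold RR; rw [dot_smul_right, smul_sub, smul_smul]; congr 2; ring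

lemma norm_sub_sq' (a b : ℂ) : ‖a - b‖ ^ 2 = ‖a‖ ^ 2 + ‖b‖ ^ 2 - 2 * dot a b := by
  rw [← dot_self, ← dot_self, ← dot_self, dot_sub_left, dot_sub_right, dot_sub_right, dot_comm b a]; ring

lemma norm_sq_le2 (a b : ℂ) : ‖a - b‖ ^ 2 ≤ 2 * (‖a‖ ^ 2 + ‖b‖ ^ 2) := by
  have := parallelogram_law_with_norm ℝ a b
  nlinarith [sq_nonneg ‖a + b‖]

lemma Def_nonneg (hh : 0 < h) (t : ℝ) : 0 ≤ Def u g f h t :=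
  integral_nonneg fun _ => mul_nonneg (mul_nonneg (bb_nonneg hh _) (bb_nonneg hh _)) (sq_nonneg _)

lemma Core.norm1 (K : Core u g f T Cf) (x y : ℂ) : ‖√(f x) • g y‖ ^ 2 = f x * ‖g y‖ ^ 2 := by
  rw [norm_smul, mul_pow, Real.norm_eq_abs, sq_abs, Real.sq_sqrt (K.fnn x)]

lemma Core.norm2 (K : Core u g f T Cf) (x y : ℂ) : ‖√(f y) • RR (x - y) (g x)‖ ^ 2 = f y * ‖g x‖ ^ 2 := by
  rw [norm_smul, mul_pow, Real.norm_eq_abs, sq_abs, Real.sq_sqrt (K.fnn y), norm_RR]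

lemma Core.measurable_defv (K : Core u g f T Cf) : Measurable fun p : ℂ × ℂ => defv f g p.1 p.2 := by
  have := K.fm
  have := K.c1.2.measurable
  unfold defv
  fun_prop

/-- product integrability -/
lemma Core.int2 (K : Core u g f T Cf) (hh : 0 < h) (t : ℝ) {F G : ℂ → ℝ} (hF : LB F) (hG : LB G) :
    Integrable (fun p : ℂ × ℂ => (bb h (u p.1 - t) * bb h (u p.2 - t)) * (F p.1 * G p.2))
      (volume.prod volume) := by
  have := (K.int1 hF (continuous_bb h) (fun s hs => bb_zero hh hs) t).mul_prod
    (K.int1 hG (continuous_bb h) (fun s hs => bb_zero hh hs) t)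
  refine this.congr (Eventually.of_forall fun p => ?_)
  simp only; ring

lemma int2_eq (h t : ℝ) (F G : ℂ → ℝ) :
    ∫ p : ℂ × ℂ, (bb h (u p.1 - t) * bb h (u p.2 - t)) * (F p.1 * G p.2) ∂(volume.prod volume)
      = (∫ x, F x * bb h (u x - t)) * ∫ x, G x * bb h (u x - t) := by
  rw [← integral_prod_mul]
  congr 1; ext p; ring

lemma Core.intDef (K : Core u g f T Cf) (hh : 0 < h) (t : ℝ) :
    Integrable (fun p : ℂ × ℂ => (bb h (u p.1 - t) * bb h (u p.2 - t)) * ‖defv f g p.1 p.2‖ ^ 2)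
      (volume.prod volume) := by
  have hu := K.c1.continuous.measurable
  have hd := K.measurable_defv
  have hbm := (continuous_bb h).measurable
  have h1 := ((K.int2 hh t K.lb K.lbg).add (K.int2 hh t K.lbg K.lb)).const_mul 2
  refine h1.mono' (by fun_prop) (Eventually.of_forall fun p => ?_)
  have h2 := mul_nonneg (bb_nonneg hh (u p.1 - t)) (bb_nonneg hh (u p.2 - t))
  rw [Real.norm_eq_abs, abs_of_nonneg (mul_nonneg h2 (sq_nonneg _))]
  have h3 := norm_sq_le2 (√(f p.1) • g p.2) (√(f p.2) • RR (p.1 - p.2) (g p.1))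
  rw [K.norm1, K.norm2] at h3
  have := mul_le_mul_of_nonneg_left h3 h2
  simp only [defv, Pi.add_apply]
  linarith

lemma Core.Def_eq (K : Core u g f T Cf) (hh : 0 < h) (t : ℝ) {ψ : ℂ → ℝ}
    (hψ : IsC1c ψ (fun x => (√(f x) * bb h (u x - t)) • g x)) :
    Def u g f h t = 2 * ((∫ x, f x * bb h (u x - t)) * ∫ x, f x * bet h (u x - t))
      - 8 * Real.pi * ∫ x, ψ x ^ 2 := by
  set ψ' : ℂ → ℂ := fun x => (√(f x) * bb h (u x - t)) • g x with hψ'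
  have hu := K.c1.continuous.measurable
  have hg := K.c1.2.measurable
  have hf := K.fm
  have hbm := (continuous_bb h).measurable
  have hψm : Measurable ψ' := hψ.1.2.measurable
  have hψi := hψ.integrable'
  have h0 : Integrable (fun p : ℂ × ℂ => dot (ψ' p.1) (RR (p.1 - p.2) (ψ' p.2))) (volume.prod volume) := by
    refine (hψi.norm.mul_prod hψi.norm).mono' (by fun_prop) (Eventually.of_forall fun p => ?_)
    refine (abs_dot_le _ _).trans ?_
    rw [norm_RR]
  have h1 := K.int2 hh t K.lb K.lbg
  have h2 := K.int2 hh t K.lbg K.lb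
  have h3 : ∀ p : ℂ × ℂ, (bb h (u p.1 - t) * bb h (u p.2 - t)) * ‖defv f g p.1 p.2‖ ^ 2
      = ((bb h (u p.1 - t) * bb h (u p.2 - t)) * (f p.1 * ‖g p.2‖ ^ 2)
        + (bb h (u p.1 - t) * bb h (u p.2 - t)) * (‖g p.1‖ ^ 2 * f p.2))
        - 2 * dot (ψ' p.1) (RR (p.1 - p.2) (ψ' p.2)) := by
    intro p
    rw [defv, norm_sub_sq', K.norm1, K.norm2]
    simp only [hψ']
    rw [RR_smul, dot_smul_left, dot_smul_right, dot_smul_left, dot_smul_right,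
      dot_RR_comm (p.1 - p.2) (g p.1) (g p.2)]
    ring
  unfold Def
  simp only [h3]
  rw [integral_sub (h1.fun_add h2) (h0.const_mul 2), integral_add h1 h2, integral_const_mul,
    int2_eq h t f (fun x => ‖g x‖ ^ 2), int2_eq h t (fun x => ‖g x‖ ^ 2) f, integral_prod_symm _ h0,
    F_three hψ, ← K.B_eq (prof_bet hh)]
  ring

/-- regularised Lyapunov functional -/
def Phh (u : ℂ → ℝ) (g : ℂ → ℂ) (f : ℂ → ℝ) (h t : ℝ) : ℝ :=
  1 / 2 * (∫ x, f x * bet h (u x - t)) ^ 2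
    + 2 * Real.pi * ∫ x, (f x * dot x (g x)) * bet h (u x - t) ^ 2

lemma Core.Phh_deriv (K : Core u g f T Cf) {a b t : ℝ} (hh : 0 < h) (hat : a < t) (htb : t + h ≤ b)
    (hT : ∀ t ∈ T, ¬ (a < t ∧ t < b)) :
    HasDerivAt (Phh u g f h) (-(1 / 2) * Def u g f h t) t := by
  obtain ⟨ψ, h1, -, h2⟩ := K.psi hh hat htb hT
  have h3 := K.derT K.lb (prof_bet hh) t
  have h4 := K.derT (K.lb.mul K.lbxg) (prof_bet_sq hh) t
  have h5 := ((h3.fun_pow 2).const_mul (1 / 2)).add (h4.const_mul (2 * Real.pi))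
  refine h5.congr_deriv ?_
  rw [K.Def_eq hh t h1, h2]
  have : ∫ x, f x * dot x (g x) * (2 * bet h (u x - t) * bb h (u x - t))
    = 2 * ∫ x, f x * dot x (g x) * (bet h (u x - t) * bb h (u x - t)) := by
    rw [← integral_const_mul]; congr 1; ext x; ring
  rw [this]
  simp only [Nat.cast_ofNat, Nat.add_one_sub_one, pow_one]
  ring

/-- lower bound of `A_t B_t` -/
lemma Core.AB_ge (K : Core u g f T Cf) {a b t : ℝ} (hh : 0 < h) (hat : a < t) (htb : t + h ≤ b)
    (hT : ∀ t ∈ T, ¬ (a < t ∧ t < b)) {t3 : ℝ} (ht3 : t + h ≤ t3) :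
    4 * Real.pi * (∫ x in {x | t3 < u x ∧ u x < b}, f x) ≤
      (∫ x, f x * bb h (u x - t)) * ∫ x, f x * bet h (u x - t) := by
  obtain ⟨ψ, h1, h2, -⟩ := K.psi hh hat htb hT
  have h3 := K.Def_eq hh t h1
  have h4 : 0 ≤ Def u g f h t := Def_nonneg hh t
  have hu := K.c1.continuous
  have hs : MeasurableSet {x | t3 < u x ∧ u x < b} :=
    ((isOpen_lt continuous_const hu).inter (isOpen_lt hu continuous_const)).measurableSet
  have h5 : Integrable fun x => ψ x ^ 2 := by
    have := (h1.mul h1.1).integrable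
    simpa only [sq] using this
  have h6 : ∫ x in {x | t3 < u x ∧ u x < b}, f x ≤ ∫ x, ψ x ^ 2 := by
    rw [← integral_indicator hs]
    refine integral_mono_of_nonneg (Eventually.of_forall fun x => ?_) h5 (Eventually.of_forall fun x => ?_)
    · exact indicator_nonneg (fun x _ => K.fnn x) x
    · refine indicator_le' (fun x hx => ?_) (fun x _ => sq_nonneg _) x
      rw [h2 x (by linarith [hx.1]) hx.2, Real.sq_sqrt (K.fnn x)]
  nlinarith [mul_le_mul_of_nonneg_left h6 Real.pi_pos.le]

end RotPatch

namespace RotPatch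
open Topology

variable {u : ℂ → ℝ} {g : ℂ → ℂ} {f : ℂ → ℝ} {T : Set ℝ} {Cf : ℝ} {h : ℝ}

def hv (s : ℝ) : ℝ := if 0 < s then 1 else 0
def hc (s : ℝ) : ℝ := if 0 ≤ s then 1 else 0

@[fun_prop] lemma measurable_hv : Measurable hv := Measurable.ite measurableSet_Ioi measurable_const measurable_const
@[fun_prop] lemma measurable_hc : Measurable hc := Measurable.ite measurableSet_Ici measurable_const measurable_const

lemma hv_nonneg (s : ℝ) : 0 ≤ hv s := by unfold hv; split_ifs <;> norm_num
lemma hv_abs (s : ℝ) : |hv s| ≤ 1 := by unfold hv; split_ifs <;> norm_num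
lemma hc_abs (s : ℝ) : |hc s| ≤ 1 := by unfold hc; split_ifs <;> norm_num
lemma hv_pos {s : ℝ} (hs : 0 < s) : hv s = 1 := by simp [hv, hs]
lemma hv_neg {s : ℝ} (hs : s ≤ 0) : hv s = 0 := by simp [hv, hs]

/-- superlevel integral -/
def MM (u F : ℂ → ℝ) (t : ℝ) : ℝ := ∫ x, F x * hv (u x - t)

lemma Core.int_hv (K : Core u g f T Cf) {F : ℂ → ℝ} (hF : LB F) (t : ℝ) :
    Integrable (fun x => F x * hv (u x - t)) :=
  K.int_gen hF measurable_hv hv_abs (fun _ hs => hv_neg hs.le) t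

lemma Core.int_hc (K : Core u g f T Cf) {F : ℂ → ℝ} (hF : LB F) (t : ℝ) :
    Integrable (fun x => F x * hc (u x - t)) :=
  K.int_gen hF measurable_hc hc_abs (fun s hs => by simp [hc, hs]) t

lemma tendsto_bet (s : ℝ) : Tendsto (fun n => bet (ee n) s) atTop (𝓝 (hv s)) := by
  by_cases hs : 0 < s
  · rw [hv_pos hs]
    refine tendsto_const_nhds.congr' ?_
    filter_upwards [tendsto_ee.eventually_lt_const hs] with n hn
    rw [bet_one (ee_pos n) hn.le]
  · rw [hv_neg (by linarith)]
    refine tendsto_const_nhds.congr fun n => ?_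
    rw [bet_zero (ee_pos n) (by linarith)]

lemma Core.lim_bet (K : Core u g f T Cf) {F : ℂ → ℝ} (hF : LB F) (t : ℝ) :
    Tendsto (fun n => ∫ x, F x * bet (ee n) (u x - t)) atTop (𝓝 (MM u F t)) := by
  have hu := K.c1.continuous
  refine K.dct hF (w := fun n x => bet (ee n) (u x - t)) (w0 := fun x => hv (u x - t)) (fun n => ?_)
    (fun n x => ?_) t (fun n x hx => ?_) (fun x => tendsto_bet _)
  · exact Continuous.measurable (by fun_prop)
  · rw [abs_of_nonneg (bet_nonneg _ _)]; exact bet_le_one _ _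
  · exact bet_zero (ee_pos n) (by linarith)

lemma Core.lim_bet_sq (K : Core u g f T Cf) {F : ℂ → ℝ} (hF : LB F) (t : ℝ) :
    Tendsto (fun n => ∫ x, F x * bet (ee n) (u x - t) ^ 2) atTop (𝓝 (MM u F t)) := by
  have hu := K.c1.continuous
  refine K.dct hF (w := fun n x => bet (ee n) (u x - t) ^ 2) (w0 := fun x => hv (u x - t)) (fun n => ?_)
    (fun n x => ?_) t (fun n x hx => ?_) (fun x => ?_)
  · exact Continuous.measurable (by fun_prop)
  · rw [abs_of_nonneg (sq_nonneg _)]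
    exact pow_le_one₀ (bet_nonneg _ _) (bet_le_one _ _)
  · rw [bet_zero (ee_pos n) (by linarith)]; simp
  · have := (tendsto_bet (u x - t)).pow 2
    have h2 : hv (u x - t) ^ 2 = hv (u x - t) := by unfold hv; split_ifs <;> norm_num
    rwa [h2] at this

lemma Core.lim_right (K : Core u g f T Cf) {F : ℂ → ℝ} (hF : LB F) {t : ℝ} {s : ℕ → ℝ}
    (hs : ∀ n, t ≤ s n) (hl : Tendsto s atTop (𝓝 t)) :
    Tendsto (fun n => MM u F (s n)) atTop (𝓝 (MM u F t)) := by
  have hu := K.c1.continuous.measurable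
  refine K.dct hF (w := fun n x => hv (u x - s n)) (w0 := fun x => hv (u x - t)) (fun n => by fun_prop)
    (fun n x => hv_abs _) t (fun n x hx => hv_neg (by linarith [hs n])) (fun x => ?_)
  by_cases hx : t < u x
  · rw [hv_pos (by linarith)]
    refine tendsto_const_nhds.congr' ?_
    filter_upwards [hl.eventually_lt_const hx] with n hn
    rw [hv_pos (by linarith)]
  · rw [hv_neg (by linarith)]
    refine tendsto_const_nhds.congr fun n => ?_
    rw [hv_neg (by linarith [hs n])]

lemma Core.lim_left (K : Core u g f T Cf) {F : ℂ → ℝ} (hF : LB F) {t : ℝ} {s : ℕ → ℝ}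
    (hs : ∀ n, s n < t) (hs1 : ∀ n, t - 1 ≤ s n) (hl : Tendsto s atTop (𝓝 t)) :
    Tendsto (fun n => MM u F (s n)) atTop (𝓝 (∫ x, F x * hc (u x - t))) := by
  have hu := K.c1.continuous.measurable
  refine K.dct hF (w := fun n x => hv (u x - s n)) (w0 := fun x => hc (u x - t)) (fun n => by fun_prop)
    (fun n x => hv_abs _) (t - 1) (fun n x hx => hv_neg (by linarith [hs1 n])) (fun x => ?_)
  by_cases hx : t ≤ u x
  · have : hc (u x - t) = 1 := by simp [hc, hx]
    rw [this]
    refine tendsto_const_nhds.congr fun n => ?_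
    rw [hv_pos (by linarith [hs n])]
  · have : hc (u x - t) = 0 := by simp [hc]; linarith
    rw [this]
    refine tendsto_const_nhds.congr' ?_
    filter_upwards [hl.eventually_const_lt (show u x < t by linarith)] with n hn
    rw [hv_neg (by linarith)]

lemma Core.MM_nonneg (K : Core u g f T Cf) (t : ℝ) : 0 ≤ MM u f t :=
  integral_nonneg fun x => mul_nonneg (K.fnn x) (hv_nonneg _)

lemma Core.MM_anti (K : Core u g f T Cf) : Antitone (MM u f) := by
  intro s t hst
  refine integral_mono (K.int_hv K.lb t) (K.int_hv K.lb s) fun x => ?_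
  refine mul_le_mul_of_nonneg_left ?_ (K.fnn x)
  unfold hv
  split_ifs with h1 h2 <;> linarith

/-- Lyapunov functional -/
def Ph (u : ℂ → ℝ) (g : ℂ → ℂ) (f : ℂ → ℝ) (t : ℝ) : ℝ :=
  1 / 2 * (MM u f t) ^ 2 + 2 * Real.pi * MM u (fun x => f x * dot x (g x)) t

lemma Core.lim_Phh (K : Core u g f T Cf) (t : ℝ) :
    Tendsto (fun n => Phh u g f (ee n) t) atTop (𝓝 (Ph u g f t)) :=
  (((K.lim_bet K.lb t).pow 2).const_mul _).add ((K.lim_bet_sq (K.lb.mul K.lbxg) t).const_mul _)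

lemma Core.ev_gap {b s : ℝ} (hs : s < b) : ∀ᶠ n in atTop, ∀ r ≤ s, r + ee n ≤ b := by
  filter_upwards [tendsto_ee.eventually_lt_const (show 0 < b - s by linarith)] with n hn r hr
  linarith

lemma Core.Ph_gap (K : Core u g f T Cf) {a b s1 s2 : ℝ} (h1 : a < s1) (h12 : s1 ≤ s2) (h2 : s2 < b)
    (hT : ∀ t ∈ T, ¬ (a < t ∧ t < b)) : Ph u g f s2 ≤ Ph u g f s1 := by
  refine le_of_tendsto_of_tendsto (K.lim_Phh s2) (K.lim_Phh s1) ?_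
  filter_upwards [Core.ev_gap h2] with n hn
  have := incr_le (Y := Phh u g f (ee n)) (Y' := fun t => -(1 / 2) * Def u g f (ee n) t)
    (Z := fun _ => 0) (Z' := fun _ => 0) h12
    (fun s hs => K.Phh_deriv (ee_pos n) (by linarith [hs.1]) (hn s hs.2) hT)
    (fun s _ => hasDerivAt_const s 0) (fun s _ => ?_)
  · simpa using this
  · have := Def_nonneg (u := u) (g := g) (f := f) (ee_pos n) s
    linarith

lemma Core.lim_Ph_left (K : Core u g f T Cf) {t : ℝ} {s : ℕ → ℝ}
    (hs : ∀ n, s n < t) (hs1 : ∀ n, t - 1 ≤ s n) (hl : Tendsto s atTop (𝓝 t)) :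
    Tendsto (fun n => Ph u g f (s n)) atTop (𝓝 (Ph u g f t
      + 1 / 2 * ((∫ x, f x * hc (u x - t)) ^ 2 - (MM u f t) ^ 2))) := by
  have h1 := ((K.lim_left K.lb hs hs1 hl).pow 2).const_mul (1 / 2)
  have h2 := (K.lim_left (K.lb.mul K.lbxg) hs hs1 hl).const_mul (2 * Real.pi)
  have h3 : ∫ x, (f x * dot x (g x)) * hc (u x - t) = MM u (fun x => f x * dot x (g x)) t := by
    refine integral_congr_ae ?_
    filter_upwards [K.c1.ae_grad_eq_zero t] with x hx
    by_cases h : u x = t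
    · rw [hx h]; simp
    · congr 1
      unfold hc hv
      rcases lt_or_gt_of_ne h with h | h
      · rw [if_neg (by linarith), if_neg (by linarith)]
      · rw [if_pos (by linarith), if_pos (by linarith)]
  have := h1.add h2
  rw [h3] at this
  refine this.congr' (Eventually.of_forall fun n => rfl) |>.trans (le_of_eq ?_)
  congr 1
  unfold Ph; ring

lemma Core.M_le_left (K : Core u g f T Cf) (t : ℝ) : MM u f t ≤ ∫ x, f x * hc (u x - t) := by
  refine integral_mono (K.int_hv K.lb t) (K.int_hc K.lb t) fun x => ?_
  refine mul_le_mul_of_nonneg_left ?_ (K.fnn x)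
  unfold hv hc
  split_ifs <;> linarith

lemma Core.Ph_step (K : Core u g f T Cf) {t1 t2 : ℝ} (h12 : t1 < t2)
    (hT : ∀ t ∈ T, ¬ (t1 < t ∧ t < t2)) : Ph u g f t2 ≤ Ph u g f t1 := by
  have hd : 0 < t2 - t1 := by linarith
  set d := min (t2 - t1) 1 with hdd
  have hd0 : 0 < d := lt_min hd one_pos
  have hd1 : d ≤ t2 - t1 := min_le_left _ _
  have hd2 : d ≤ 1 := min_le_right _ _
  have hr : Tendsto (fun n => t1 + d / 3 * ee n) atTop (𝓝 t1) := by
    simpa using (tendsto_ee.const_mul (d / 3)).const_add t1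
  have hl : Tendsto (fun n => t2 - d / 3 * ee n) atTop (𝓝 t2) := by
    simpa using (tendsto_ee.const_mul (d / 3)).const_sub t2
  have hp : ∀ n, 0 < d / 3 * ee n := fun n => mul_pos (by linarith) (ee_pos n)
  have hq : ∀ n, d / 3 * ee n ≤ d / 3 := fun n => mul_le_of_le_one_right (by linarith) (ee_le_one n)
  have h1 : Tendsto (fun n => Ph u g f (t1 + d / 3 * ee n)) atTop (𝓝 (Ph u g f t1)) :=
    (((K.lim_right K.lb (fun n => by linarith [hp n]) hr).pow 2).const_mul _).add
      ((K.lim_right (K.lb.mul K.lbxg) (fun n => by linarith [hp n]) hr).const_mul _)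
  have h2 := K.lim_Ph_left (fun n => by linarith [hp n]) (fun n => by linarith [hq n]) hl
  have h3 := le_of_tendsto_of_tendsto h2 h1 (Eventually.of_forall fun n =>
    K.Ph_gap (a := t1) (b := t2) (by linarith [hp n]) (by linarith [hq n]) (by linarith [hp n]) hT)
  have h4 := K.M_le_left t2
  have h5 := K.MM_nonneg t2
  nlinarith

lemma Core.Ph_anti (K : Core u g f T Cf) : ∀ t1 t2 : ℝ, t1 ≤ t2 → Ph u g f t2 ≤ Ph u g f t1 := by
  have key : ∀ N : ℕ, ∀ t1 t2 : ℝ, t1 < t2 → (T ∩ Ioo t1 t2).ncard ≤ N → Ph u g f t2 ≤ Ph u g f t1 := by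
    intro N
    induction N with
    | zero =>
      intro t1 t2 h12 hN
      refine K.Ph_step h12 fun t ht h => ?_
      have : (T ∩ Ioo t1 t2) = ∅ := (Set.ncard_eq_zero (K.fin.inter_of_left _)).1 (by omega)
      have h2 : t ∈ T ∩ Ioo t1 t2 := ⟨ht, h⟩
      rw [this] at h2; exact h2
    | succ N ih =>
      intro t1 t2 h12 hN
      by_cases hT : ∀ t ∈ T, ¬ (t1 < t ∧ t < t2)
      · exact K.Ph_step h12 hT
      · push Not at hT
        obtain ⟨t, ht, h1, h2⟩ := hT
        have hfin := K.fin.inter_of_left (Ioo t1 t2)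
        have ha : (T ∩ Ioo t1 t).ncard < (T ∩ Ioo t1 t2).ncard := by
          refine Set.ncard_lt_ncard ⟨fun s hs => ⟨hs.1, hs.2.1, hs.2.2.trans h2⟩, fun hsub => ?_⟩ hfin
          exact lt_irrefl t (hsub ⟨ht, h1, h2⟩).2.2
        have hb : (T ∩ Ioo t t2).ncard < (T ∩ Ioo t1 t2).ncard := by
          refine Set.ncard_lt_ncard ⟨fun s hs => ⟨hs.1, h1.trans hs.2.1, hs.2.2⟩, fun hsub => ?_⟩ hfin
          exact lt_irrefl t (hsub ⟨ht, h1, h2⟩).2.1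
        exact (ih t t2 h2 (by omega)).trans (ih t1 t h1 (by omega))
  intro t1 t2 h12
  rcases h12.eq_or_lt with h | h
  · rw [h]
  · exact key _ t1 t2 h le_rfl

lemma Core.Ph_nonneg (K : Core u g f T Cf) (t : ℝ) : 0 ≤ Ph u g f t := by
  obtain ⟨U, hU⟩ := K.bddAbove
  have h := K.Ph_anti t (max t U) (le_max_left _ _)
  have h0 : ∀ F, MM u F (max t U) = 0 := by
    intro F
    unfold MM
    have : ∀ x, F x * hv (u x - max t U) = 0 := fun x => by
      rw [hv_neg (by linarith [hU x, le_max_right t U])]; simp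
    simp [this]
  unfold Ph at h ⊢
  rw [h0, h0] at h
  simpa using h

/-- hypothesis at infinity -/
def Core.Vanish (u : ℂ → ℝ) (g : ℂ → ℂ) (f : ℂ → ℝ) : Prop :=
  ∀ ε > 0, ∀ t : ℝ, ∃ τ ≤ t, Ph u g f τ ≤ ε

lemma Core.Ph_zero (K : Core u g f T Cf) (hV : Core.Vanish u g f) (t : ℝ) : Ph u g f t = 0 := by
  refine le_antisymm (le_of_forall_pos_le_add fun ε hε => ?_) (K.Ph_nonneg t)
  obtain ⟨τ, h1, h2⟩ := hV ε hε t
  linarith [K.Ph_anti τ t h1]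

lemma Core.M_left (K : Core u g f T Cf) (hV : Core.Vanish u g f) (t : ℝ) :
    ∫ x, f x * hc (u x - t) = MM u f t := by
  have hl : Tendsto (fun n => t - ee n) atTop (𝓝 t) := by simpa using tendsto_ee.const_sub t
  have h2 := K.lim_Ph_left (fun n => by linarith [ee_pos n]) (fun n => by linarith [ee_le_one n]) hl
  simp only [K.Ph_zero hV] at h2
  have h3 := tendsto_nhds_unique h2 tendsto_const_nhds
  have h4 := K.M_le_left t
  have h5 := K.MM_nonneg t
  nlinarith

lemma Core.ae_level (K : Core u g f T Cf) (hV : Core.Vanish u g f) (t : ℝ) :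
    ∀ᵐ x, u x = t → f x = 0 := by
  have h1 := K.M_left hV t
  have h2 : ∫ x, (f x * hc (u x - t) - f x * hv (u x - t)) = 0 := by
    rw [integral_sub (K.int_hc K.lb t) (K.int_hv K.lb t), h1]; exact sub_self _
  have h3 : Integrable fun x => f x * hc (u x - t) - f x * hv (u x - t) :=
    (K.int_hc K.lb t).sub (K.int_hv K.lb t)
  rw [integral_eq_zero_iff_of_nonneg (fun x => ?_) h3] at h2
  · filter_upwards [h2] with x hx hxt
    simpa [hc, hv, hxt] using hx
  · rw [Pi.zero_apply, ← mul_sub]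
    refine mul_nonneg (K.fnn x) ?_
    unfold hv hc
    split_ifs <;> linarith

end RotPatch

namespace RotPatch
open Topology

variable {u : ℂ → ℝ} {g : ℂ → ℂ} {f : ℂ → ℝ} {T : Set ℝ} {Cf : ℝ} {h : ℝ}

lemma prof_prim (hh : 0 < h) : Prof (fun s => ∫ r in (0:ℝ)..s, bet h r) (bet h) := by
  refine ⟨fun s => ?_, continuous_bet h, fun s hs => ?_, fun s hs => bet_zero hh hs⟩
  · exact intervalIntegral.integral_hasDerivAt_right ((continuous_bet h).intervalIntegrable _ _)
      ((continuous_bet h).stronglyMeasurableAtFilter _ _) (continuous_bet h).continuousAt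
  · rw [intervalIntegral.integral_symm, intervalIntegral.integral_of_le hs,
      setIntegral_eq_zero_of_forall_eq_zero (fun r hr => bet_zero hh hr.2), neg_zero]

lemma Core.lbl (e c : ℂ) : LB (fun x => dot e (x - c)) := lb_of_cont (by fun_prop)

lemma Core.X_eq (K : Core u g f T Cf) (hh : 0 < h) (t : ℝ) (e : ℂ) :
    ∫ x, (f x * dot e (x - 0)) * bet h (u x - t) = ∫ x, (‖g x‖ ^ 2 * dot e (x - 0)) * bb h (u x - t) := by
  have h1 := (K.prof (prof_bet hh) t).mul (isC1_dot e 0)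
  have h2 := K.weak _ _ h1
  have h3 := int_dot_const (K.prof (prof_prim hh) t) e
  have h4 := (K.prof (prof_prim hh) t).integrable'
  have hg := K.c1.2
  have h6 : Integrable fun x => dot e (bet h (u x - t) • g x) := by
    have hu := K.c1.continuous
    refine (h4.norm.const_mul ‖e‖).mono' (Continuous.aestronglyMeasurable (by fun_prop)) (Eventually.of_forall fun x => ?_)
    exact abs_dot_le _ _
  have h5 := K.int1 (K.lbg.mul (Core.lbl e 0)) (continuous_bb h) (fun s hs => bb_zero hh hs) t
  have h7 : ∀ x, dot (g x) (bet h (u x - t) • e + dot e (x - 0) • bb h (u x - t) • g x)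
    = dot e (bet h (u x - t) • g x) + (‖g x‖ ^ 2 * dot e (x - 0)) * bb h (u x - t) := by
    intro x
    rw [dot_add_right, dot_smul_right, dot_smul_right, dot_smul_right, dot_smul_right, dot_self,
      dot_comm (g x) e]; ring
  simp only [h7] at h2
  rw [integral_add h6 h5, h3, zero_add] at h2
  rw [h2]
  congr 1; ext x; ring

lemma amgm (a b : ℂ) {lam : ℝ} (hl : 0 < lam) :
    |‖a‖ ^ 2 - ‖b‖ ^ 2| ≤ lam * ‖a - b‖ ^ 2 + (2 * lam)⁻¹ * (‖a‖ ^ 2 + ‖b‖ ^ 2) := by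
  have h1 := abs_norm_sub_norm_le a b
  have h2 : |‖a‖ ^ 2 - ‖b‖ ^ 2| = |‖a‖ - ‖b‖| * (‖a‖ + ‖b‖) := by
    rw [← abs_of_nonneg (by positivity : 0 ≤ ‖a‖ + ‖b‖), ← abs_mul]
    congr 1
    ring
  rw [h2]
  set P := ‖a - b‖
  have h3 : |‖a‖ - ‖b‖| * (‖a‖ + ‖b‖) ≤ P * (‖a‖ + ‖b‖) := mul_le_mul_of_nonneg_right h1 (by positivity)
  refine h3.trans ?_
  have h4 : (‖a‖ + ‖b‖) ^ 2 ≤ 2 * (‖a‖ ^ 2 + ‖b‖ ^ 2) := by nlinarith [sq_nonneg (‖a‖ - ‖b‖)]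
  have h5 : P * (‖a‖ + ‖b‖) ≤ lam * P ^ 2 + (2 * lam)⁻¹ * ((‖a‖ + ‖b‖) ^ 2 / 2) := by
    have : lam * P ^ 2 + (2 * lam)⁻¹ * ((‖a‖ + ‖b‖) ^ 2 / 2) - P * (‖a‖ + ‖b‖)
      = lam * (P - (2 * lam)⁻¹ * (‖a‖ + ‖b‖)) ^ 2 := by field_simp; ring
    nlinarith [mul_nonneg hl.le (sq_nonneg (P - (2 * lam)⁻¹ * (‖a‖ + ‖b‖)))]
  refine h5.trans ?_
  have h6 : 0 ≤ (2 * lam)⁻¹ := by positivity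
  have := mul_le_mul_of_nonneg_left h4 h6
  linarith

lemma Core.V_le (K : Core u g f T Cf) (hh : 0 < h) (t : ℝ) (e : ℂ) {L lam : ℝ} (hl : 0 < lam)
    (hL : ∀ x, t < u x → |dot e (x - 0)| ≤ L) (hL0 : 0 ≤ L) :
    |(∫ x, (f x * dot e (x - 0)) * bb h (u x - t)) * (∫ x, f x * bet h (u x - t))
      - (∫ x, (f x * dot e (x - 0)) * bet h (u x - t)) * (∫ x, f x * bb h (u x - t))|
    ≤ L * (lam * Def u g f h t + lam⁻¹ * ((∫ x, f x * bb h (u x - t)) * ∫ x, f x * bet h (u x - t))) := by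
  rw [K.X_eq hh t e, K.B_eq (prof_bet hh) t]
  have hl1 := Core.lbl e 0
  have i1 := K.int2 hh t (K.lb.mul hl1) K.lbg
  have i2 := K.int2 hh t (K.lbg.mul hl1) K.lb
  have i3 := K.int2 hh t K.lb K.lbg
  have i4 := K.int2 hh t K.lbg K.lb
  have i5 := K.intDef hh t
  rw [← int2_eq h t (fun x => f x * dot e (x - 0)) (fun x => ‖g x‖ ^ 2),
    ← int2_eq h t (fun x => ‖g x‖ ^ 2 * dot e (x - 0)) f, ← integral_sub i1 i2, ← Real.norm_eq_abs]
  have e1 := int2_eq (u := u) h t f (fun x => ‖g x‖ ^ 2)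
  have e2 := int2_eq (u := u) h t (fun x => ‖g x‖ ^ 2) f
  have i6 : Integrable (fun p : ℂ × ℂ => L * (lam * ((bb h (u p.1 - t) * bb h (u p.2 - t)) * ‖defv f g p.1 p.2‖ ^ 2)
      + (2 * lam)⁻¹ * ((bb h (u p.1 - t) * bb h (u p.2 - t)) * (f p.1 * ‖g p.2‖ ^ 2)
        + (bb h (u p.1 - t) * bb h (u p.2 - t)) * (‖g p.1‖ ^ 2 * f p.2)))) (volume.prod volume) :=
    ((i5.const_mul lam).add ((i3.add i4).const_mul _)).const_mul L
  refine (norm_integral_le_of_norm_le i6 (Eventually.of_forall fun p => ?_)).trans (le_of_eq ?_)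
  · set W := bb h (u p.1 - t) * bb h (u p.2 - t) with hW
    have hW0 : 0 ≤ W := mul_nonneg (bb_nonneg hh _) (bb_nonneg hh _)
    have h1 := amgm (√(f p.1) • g p.2) (√(f p.2) • RR (p.1 - p.2) (g p.1)) hl
    rw [K.norm1, K.norm2] at h1
    change |f p.1 * ‖g p.2‖ ^ 2 - f p.2 * ‖g p.1‖ ^ 2| ≤ lam * ‖defv f g p.1 p.2‖ ^ 2 + _ at h1
    have h2 : W * (f p.1 * dot e (p.1 - 0) * ‖g p.2‖ ^ 2) - W * (‖g p.1‖ ^ 2 * dot e (p.1 - 0) * f p.2)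
      = dot e (p.1 - 0) * (W * (f p.1 * ‖g p.2‖ ^ 2 - f p.2 * ‖g p.1‖ ^ 2)) := by ring
    rw [h2, Real.norm_eq_abs, abs_mul, abs_mul, abs_of_nonneg hW0]
    have h4 : W * |f p.1 * ‖g p.2‖ ^ 2 - f p.2 * ‖g p.1‖ ^ 2| ≤ lam * (W * ‖defv f g p.1 p.2‖ ^ 2)
      + (2 * lam)⁻¹ * (W * (f p.1 * ‖g p.2‖ ^ 2) + W * (‖g p.1‖ ^ 2 * f p.2)) := by
      have := mul_le_mul_of_nonneg_left h1 hW0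
      refine this.trans (le_of_eq (by ring))
    by_cases hx : t < u p.1
    · exact mul_le_mul (hL _ hx) h4 (mul_nonneg hW0 (abs_nonneg _)) hL0
    · have hW1 : W = 0 := by rw [hW, bb_zero hh (by linarith)]; simp
      simp [hW1]
  · rw [integral_const_mul, integral_add (i5.const_mul lam) ((i3.fun_add i4).const_mul _), integral_const_mul,
      integral_const_mul, integral_add i3 i4, e1, e2]
    unfold Def
    field_simp
    ring

lemma bet_le_hv (hh : 0 < h) (s : ℝ) : bet h s ≤ hv s := by
  by_cases hs : 0 < s
  · rw [hv_pos hs]; exact bet_le_one _ _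
  · rw [hv_neg (by linarith), bet_zero hh (by linarith)]

lemma Core.B_le (K : Core u g f T Cf) (hh : 0 < h) (t : ℝ) : ∫ x, f x * bet h (u x - t) ≤ MM u f t :=
  integral_mono (K.int1 K.lb (continuous_bet h) (fun _ hs => bet_zero hh hs) t) (K.int_hv K.lb t)
    fun x => mul_le_mul_of_nonneg_left (bet_le_hv hh _) (K.fnn x)

lemma Core.B_ge (K : Core u g f T Cf) (hh : 0 < h) (t : ℝ) : MM u f (t + h) ≤ ∫ x, f x * bet h (u x - t) := by
  refine integral_mono (K.int_hv K.lb _) (K.int1 K.lb (continuous_bet h) (fun _ hs => bet_zero hh hs) t)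
    fun x => mul_le_mul_of_nonneg_left ?_ (K.fnn x)
  by_cases hs : 0 < u x - (t + h)
  · rw [hv_pos hs, bet_one hh (by linarith)]
  · rw [hv_neg (by linarith)]; exact bet_nonneg _ _

lemma Core.A_nonneg (K : Core u g f T Cf) (hh : 0 < h) (t : ℝ) : 0 ≤ ∫ x, f x * bb h (u x - t) :=
  integral_nonneg fun x => mul_nonneg (K.fnn x) (bb_nonneg hh _)

lemma Core.bary_gap (K : Core u g f T Cf) (hV : Core.Vanish u g f) (e : ℂ) {a b s1 s2 : ℝ} (h1 : a < s1)
    (h12 : s1 ≤ s2) (h2 : s2 < b) (hT : ∀ t ∈ T, ¬ (a < t ∧ t < b)) (hM : 0 < MM u f s2) :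
    MM u (fun x => f x * dot e (x - 0)) s1 / MM u f s1 = MM u (fun x => f x * dot e (x - 0)) s2 / MM u f s2 := by
  have hM1 : 0 < MM u f s1 := hM.trans_le (K.MM_anti h12)
  obtain ⟨R, hR⟩ := K.proper s1
  set L := ‖e‖ * |R| with hLdef
  have hL0 : 0 ≤ L := by positivity
  have hL : ∀ x, s1 < u x → |dot e (x - 0)| ≤ L := by
    intro x hx
    rw [sub_zero]
    refine (abs_dot_le _ _).trans (mul_le_mul_of_nonneg_left ?_ (norm_nonneg _))
    by_contra hc
    have := hR x (by linarith [le_abs_self R])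
    linarith
  set m := MM u f s2 / 2 with hm
  have hm0 : 0 < m := by rw [hm]; linarith
  have hlF := K.lb.mul (Core.lbl e 0)
  set X : ℕ → ℝ → ℝ := fun n t => ∫ x, (f x * dot e (x - 0)) * bet (ee n) (u x - t) with hX
  set B : ℕ → ℝ → ℝ := fun n t => ∫ x, f x * bet (ee n) (u x - t) with hB
  have hBm : ∀ᶠ n in atTop, m ≤ MM u f (s2 + ee n) := by
    have := K.lim_right K.lb (t := s2) (s := fun n => s2 + ee n) (fun n => by linarith [ee_pos n])
      (by simpa using tendsto_ee.const_add s2)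
    exact (this.eventually_const_lt (show m < MM u f s2 by rw [hm]; linarith)).mono fun n hn => hn.le
  have main : ∀ lam : ℝ, 0 < lam → |MM u (fun x => f x * dot e (x - 0)) s2 / MM u f s2 -
      MM u (fun x => f x * dot e (x - 0)) s1 / MM u f s1| ≤
      L / m ^ 2 * (MM u f s1 * lam⁻¹ * (MM u f s1 - MM u f s2)) := by
    intro lam hlam
    have hev : ∀ᶠ n in atTop, |X n s2 / B n s2 - X n s1 / B n s1| ≤
        L / m ^ 2 * (2 * lam * (Phh u g f (ee n) s1 - Phh u g f (ee n) s2)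
          + MM u f s1 * lam⁻¹ * (B n s1 - B n s2)) := by
      filter_upwards [Core.ev_gap h2, hBm] with n hn hn2
      have hBpos : ∀ t ∈ Icc s1 s2, m ≤ B n t := fun t ht =>
        hn2.trans ((K.MM_anti (by linarith [ht.2])).trans (K.B_ge (ee_pos n) t))
      have dX : ∀ t, HasDerivAt (X n) (-∫ x, (f x * dot e (x - 0)) * bb (ee n) (u x - t)) t := fun t =>
        K.derT hlF (prof_bet (ee_pos n)) t
      have dB : ∀ t, HasDerivAt (B n) (-∫ x, f x * bb (ee n) (u x - t)) t := fun t =>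
        K.derT K.lb (prof_bet (ee_pos n)) t
      have dY : ∀ t ∈ Icc s1 s2, HasDerivAt (fun t => X n t / B n t)
          (((-∫ x, (f x * dot e (x - 0)) * bb (ee n) (u x - t)) * B n t
            - X n t * (-∫ x, f x * bb (ee n) (u x - t))) / B n t ^ 2) t := fun t ht =>
        (dX t).fun_div (dB t) (by linarith [hBpos t ht])
      have dZ : ∀ t ∈ Icc s1 s2, HasDerivAt (fun t => - (L / m ^ 2 * (2 * lam * Phh u g f (ee n) t + MM u f s1 * lam⁻¹ * B n t)))
          (- (L / m ^ 2 * (2 * lam * (-(1 / 2) * Def u g f (ee n) t)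
            + MM u f s1 * lam⁻¹ * (-∫ x, f x * bb (ee n) (u x - t))))) t := fun t ht =>
        ((((K.Phh_deriv (ee_pos n) (by linarith [ht.1]) (hn t ht.2) hT).const_mul (2 * lam)).fun_add
          ((dB t).const_mul _)).const_mul _).fun_neg
      have bound : ∀ t ∈ Icc s1 s2, |((-∫ x, (f x * dot e (x - 0)) * bb (ee n) (u x - t)) * B n t
            - X n t * (-∫ x, f x * bb (ee n) (u x - t))) / B n t ^ 2| ≤
          (- (L / m ^ 2 * (2 * lam * (-(1 / 2) * Def u g f (ee n) t)
            + MM u f s1 * lam⁻¹ * (-∫ x, f x * bb (ee n) (u x - t))))) := by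
        intro t ht
        have v := K.V_le (ee_pos n) t e hlam (fun x hx => hL x (by linarith [ht.1])) hL0
        have hD : 0 ≤ Def u g f (ee n) t := Def_nonneg (ee_pos n) t
        have hA := K.A_nonneg (ee_pos n) t
        have hBt := hBpos t ht
        have hB1 : B n t ≤ MM u f s1 := (K.B_le (ee_pos n) t).trans (K.MM_anti ht.1)
        change |_ * B n t - X n t * _| ≤ L * (lam * _ + lam⁻¹ * (_ * B n t)) at v
        set A := ∫ x, f x * bb (ee n) (u x - t)
        set Al := ∫ x, (f x * dot e (x - 0)) * bb (ee n) (u x - t)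
        have e1 : |(-Al * B n t - X n t * -A) / B n t ^ 2| = |Al * B n t - X n t * A| / B n t ^ 2 := by
          rw [abs_div, abs_of_nonneg (sq_nonneg (B n t)), ← abs_neg]; congr 2; ring
        rw [e1]
        have e2 : lam⁻¹ * (A * B n t) ≤ lam⁻¹ * (A * MM u f s1) := by gcongr
        have e3 : |Al * B n t - X n t * A| ≤ L * (lam * Def u g f (ee n) t + lam⁻¹ * (A * MM u f s1)) :=
          v.trans (by gcongr)
        have e4 : |Al * B n t - X n t * A| / B n t ^ 2 ≤ L * (lam * Def u g f (ee n) t + lam⁻¹ * (A * MM u f s1)) / m ^ 2 := by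
          gcongr
        refine e4.trans (le_of_eq ?_)
        ring
      have i1 := incr_le h12 dY dZ (fun t ht => (le_abs_self _).trans (bound t ht))
      have i2 := incr_le h12 (fun t ht => (dY t ht).fun_neg) dZ (fun t ht => (neg_le_abs _).trans (bound t ht))
      rw [abs_le]
      constructor <;> linarith
    have l1 : Tendsto (fun n => |X n s2 / B n s2 - X n s1 / B n s1|) atTop _ :=
      (((K.lim_bet hlF s2).div (K.lim_bet K.lb s2) hM.ne').sub
        ((K.lim_bet hlF s1).div (K.lim_bet K.lb s1) hM1.ne')).abs
    have l2 := ((((K.lim_Phh s1).sub (K.lim_Phh s2)).const_mul (2 * lam)).add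
      (((K.lim_bet K.lb s1).sub (K.lim_bet K.lb s2)).const_mul (MM u f s1 * lam⁻¹))).const_mul (L / m ^ 2)
    rw [K.Ph_zero hV, K.Ph_zero hV, sub_self, mul_zero, zero_add] at l2
    exact le_of_tendsto_of_tendsto l1 l2 hev
  have lim : Tendsto (fun lam : ℝ => L / m ^ 2 * (MM u f s1 * lam⁻¹ * (MM u f s1 - MM u f s2))) atTop
      (𝓝 (L / m ^ 2 * (MM u f s1 * 0 * (MM u f s1 - MM u f s2)))) :=
    ((tendsto_inv_atTop_zero.const_mul _).mul_const _).const_mul _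
  have := ge_of_tendsto lim ((eventually_gt_atTop 0).mono fun lam hlam => main lam hlam)
  rw [mul_zero, zero_mul, mul_zero] at this
  have h0 := abs_eq_zero.1 (le_antisymm this (abs_nonneg _))
  linarith

end RotPatch

namespace RotPatch
open Topology

variable {u : ℂ → ℝ} {g : ℂ → ℂ} {f : ℂ → ℝ} {T : Set ℝ} {Cf : ℝ} {h : ℝ}

lemma chain {T : Set ℝ} (hT : T.Finite) {P : ℝ → ℝ → Prop}
    (h0 : ∀ t1 t2, t1 < t2 → (∀ t ∈ T, ¬ (t1 < t ∧ t < t2)) → P t1 t2)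
    (htr : ∀ t1 t t2, t1 < t → t < t2 → P t1 t → P t t2 → P t1 t2) : ∀ t1 t2, t1 < t2 → P t1 t2 := by
  have key : ∀ N : ℕ, ∀ t1 t2 : ℝ, t1 < t2 → (T ∩ Ioo t1 t2).ncard ≤ N → P t1 t2 := by
    intro N
    induction N with
    | zero =>
      intro t1 t2 h12 hN
      refine h0 _ _ h12 fun t ht h => ?_
      have : (T ∩ Ioo t1 t2) = ∅ := (Set.ncard_eq_zero (hT.inter_of_left _)).1 (by omega)
      have h2 : t ∈ T ∩ Ioo t1 t2 := ⟨ht, h⟩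
      rw [this] at h2; exact h2
    | succ N ih =>
      intro t1 t2 h12 hN
      by_cases hT' : ∀ t ∈ T, ¬ (t1 < t ∧ t < t2)
      · exact h0 _ _ h12 hT'
      · push Not at hT'
        obtain ⟨t, ht, h1, h2⟩ := hT'
        have hfin := hT.inter_of_left (Ioo t1 t2)
        have ha : (T ∩ Ioo t1 t).ncard < (T ∩ Ioo t1 t2).ncard := by
          refine Set.ncard_lt_ncard ⟨fun s hs => ⟨hs.1, hs.2.1, hs.2.2.trans h2⟩, fun hsub => ?_⟩ hfin
          exact lt_irrefl t (hsub ⟨ht, h1, h2⟩).2.2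
        have hb : (T ∩ Ioo t t2).ncard < (T ∩ Ioo t1 t2).ncard := by
          refine Set.ncard_lt_ncard ⟨fun s hs => ⟨hs.1, h1.trans hs.2.1, hs.2.2⟩, fun hsub => ?_⟩ hfin
          exact lt_irrefl t (hsub ⟨ht, h1, h2⟩).2.1
        exact htr t1 t t2 h1 h2 (ih t1 t h1 (by omega)) (ih t t2 h2 (by omega))
  exact fun t1 t2 h => key _ t1 t2 h le_rfl

lemma Core.left_eq (K : Core u g f T Cf) (hV : Core.Vanish u g f) (G : ℂ → ℝ) (t : ℝ) :
    ∫ x, (f x * G x) * hc (u x - t) = MM u (fun x => f x * G x) t := by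
  refine integral_congr_ae ?_
  filter_upwards [K.ae_level hV t] with x hx
  by_cases h : u x = t
  · rw [hx h]; simp
  · congr 1
    unfold hc hv
    rcases lt_or_gt_of_ne h with h | h
    · rw [if_neg (by linarith), if_neg (by linarith)]
    · rw [if_pos (by linarith), if_pos (by linarith)]

lemma Core.bary_step (K : Core u g f T Cf) (hV : Core.Vanish u g f) (e : ℂ) {t1 t2 : ℝ} (h12 : t1 < t2)
    (hT : ∀ t ∈ T, ¬ (t1 < t ∧ t < t2)) (hM : 0 < MM u f t2) :
    MM u (fun x => f x * dot e (x - 0)) t1 / MM u f t1 = MM u (fun x => f x * dot e (x - 0)) t2 / MM u f t2 := by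
  have hM1 : 0 < MM u f t1 := hM.trans_le (K.MM_anti h12.le)
  have hd : 0 < t2 - t1 := by linarith
  set d := min (t2 - t1) 1 with hdd
  have hd0 : 0 < d := lt_min hd one_pos
  have hd1 : d ≤ t2 - t1 := min_le_left _ _
  have hd2 : d ≤ 1 := min_le_right _ _
  have hr : Tendsto (fun n => t1 + d / 3 * ee n) atTop (𝓝 t1) := by
    simpa using (tendsto_ee.const_mul (d / 3)).const_add t1
  have hl : Tendsto (fun n => t2 - d / 3 * ee n) atTop (𝓝 t2) := by
    simpa using (tendsto_ee.const_mul (d / 3)).const_sub t2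
  have hp : ∀ n, 0 < d / 3 * ee n := fun n => mul_pos (by linarith) (ee_pos n)
  have hq : ∀ n, d / 3 * ee n ≤ d / 3 := fun n => mul_le_of_le_one_right (by linarith) (ee_le_one n)
  have hlF := K.lb.mul (Core.lbl e 0)
  have h1 := (K.lim_right hlF (fun n => by linarith [hp n]) hr).div
    (K.lim_right K.lb (fun n => by linarith [hp n]) hr) hM1.ne'
  have h2 := K.lim_left hlF (fun n => by linarith [hp n]) (fun n => by linarith [hq n]) hl
  have h3 := K.lim_left K.lb (fun n => by linarith [hp n]) (fun n => by linarith [hq n]) hl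
  rw [K.left_eq hV] at h2
  rw [K.M_left hV] at h3
  have h4 := h2.div h3 hM.ne'
  refine tendsto_nhds_unique h1 (h4.congr fun n => ?_)
  exact (K.bary_gap hV e (a := t1) (b := t2) (by linarith [hp n]) (by linarith [hq n]) (by linarith [hp n]) hT
    (hM.trans_le (K.MM_anti (by linarith [hp n])))).symm

lemma Core.bary_all (K : Core u g f T Cf) (hV : Core.Vanish u g f) (e : ℂ) : ∀ t1 t2 : ℝ, t1 < t2 →
    (0 < MM u f t2 →
    MM u (fun x => f x * dot e (x - 0)) t1 / MM u f t1 = MM u (fun x => f x * dot e (x - 0)) t2 / MM u f t2) := by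
  refine chain K.fin (fun t1 t2 h12 hT hM => K.bary_step hV e h12 hT hM) ?_
  intro t1 t t2 h1 h2 P1 P2 hM
  rw [P1 (hM.trans_le (K.MM_anti h2.le)), P2 hM]

lemma Core.MM_zero (K : Core u g f T Cf) {t : ℝ} (hM : MM u f t = 0) (G : ℂ → ℝ) :
    MM u (fun x => f x * G x) t = 0 := by
  have := (integral_eq_zero_iff_of_nonneg (fun x => mul_nonneg (K.fnn x) (hv_nonneg _)) (K.int_hv K.lb t)).1 hM
  refine integral_eq_zero_of_ae ?_
  filter_upwards [this] with x hx
  simp only [Pi.zero_apply] at hx ⊢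
  rw [mul_right_comm, hx, zero_mul]

lemma Core.bary (K : Core u g f T Cf) (hV : Core.Vanish u g f) :
    ∃ c : ℂ, ∀ e t, MM u (fun x => f x * dot e (x - c)) t = 0 := by
  have hsub : ∀ c e t, MM u (fun x => f x * dot e (x - c)) t =
      MM u (fun x => f x * dot e (x - 0)) t - dot e c * MM u f t := by
    intro c e t
    unfold MM
    rw [← integral_const_mul, ← integral_sub (K.int_hv (K.lb.mul (Core.lbl e 0)) t)
      ((K.int_hv K.lb t).const_mul _)]
    congr 1; ext x
    simp only [sub_zero, dot_sub_right]; ring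
  by_cases hz : ∃ t0, 0 < MM u f t0
  · obtain ⟨t0, ht0⟩ := hz
    set q : ℂ → ℝ := fun e => MM u (fun x => f x * dot e (x - 0)) t0 / MM u f t0 with hq
    have hqe : ∀ e, q e = dot e ⟨q 1, q Complex.I⟩ := by
      intro e
      simp only [hq]
      have hd : ∀ p q : ℝ, dot e ⟨p, q⟩ = e.re * p + e.im * q := fun p q => rfl
      rw [hd, mul_div_assoc', mul_div_assoc', ← add_div]
      congr 1
      unfold MM
      rw [← integral_const_mul, ← integral_const_mul, ← integral_add
        ((K.int_hv (K.lb.mul (Core.lbl 1 0)) t0).const_mul _)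
        ((K.int_hv (K.lb.mul (Core.lbl Complex.I 0)) t0).const_mul _)]
      congr 1; ext x
      simp [dot]; ring
    refine ⟨⟨q 1, q Complex.I⟩, fun e t => ?_⟩
    rw [hsub, ← hqe]
    rcases (K.MM_nonneg t).eq_or_lt with h0 | h0
    · rw [← h0, K.MM_zero h0.symm]; simp
    · have : MM u (fun x => f x * dot e (x - 0)) t / MM u f t = q e := by
        rcases lt_trichotomy t t0 with h1 | h1 | h1
        · exact K.bary_all hV e t t0 h1 ht0
        · rw [h1]
        · exact (K.bary_all hV e t0 t h1 h0).symm
      rw [← this]; field_simp; ring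
  · push Not at hz
    refine ⟨0, fun e t => K.MM_zero (le_antisymm (hz t) (K.MM_nonneg t)) _⟩

lemma int_bb (hh : 0 < h) (v : ℝ) : ∫ s, bb h s * hv (v - s) = bet h v := by
  have h1 : ∀ s, bb h s * hv (v - s) = (Iio v).indicator (bb h) s := by
    intro s
    by_cases hs : s < v
    · rw [indicator_of_mem (by exact hs), hv_pos (by linarith), mul_one]
    · rw [indicator_of_notMem (by exact hs), hv_neg (by linarith), mul_zero]
  simp only [h1]
  rw [integral_indicator measurableSet_Iio, ← integral_Iic_eq_integral_Iio]
  have hsupp : HasCompactSupport (bb h) := by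
    refine HasCompactSupport.intro (isCompact_Icc (a := 0) (b := h)) fun x hx => ?_
    by_cases h2 : x ≤ 0
    · exact bb_zero hh h2
    · refine bb_one hh ?_
      by_contra h3
      exact hx ⟨by linarith, by linarith⟩
  have hi : Integrable (bb h) := (continuous_bb h).integrable_of_hasCompactSupport hsupp
  have := integral_Iic_of_hasDerivAt_of_tendsto (f := bet h) (f' := bb h) (a := v) (m := 0)
    ((continuous_bet h).continuousWithinAt) (fun x _ => bet_deriv h x) hi.integrableOn
    (tendsto_const_nhds.congr' (by
      filter_upwards [eventually_le_atBot (0:ℝ)] with s hs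
      rw [bet_zero hh hs]))
  rw [this, sub_zero]

lemma Core.layer (K : Core u g f T Cf) (hh : 0 < h) {F : ℂ → ℝ} (hF : LB F) (h0 : ∀ t, MM u F t = 0) (t : ℝ) :
    ∫ x, F x * bet h (u x - t) = 0 := by
  have hu := K.c1.continuous.measurable
  have hbm := (continuous_bb h).measurable
  have hFm := hF.1
  have hsupp : HasCompactSupport (bb h) := by
    refine HasCompactSupport.intro (isCompact_Icc (a := 0) (b := h)) fun x hx => ?_
    by_cases h2 : x ≤ 0
    · exact bb_zero hh h2
    · refine bb_one hh ?_
      by_contra h3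
      exact hx ⟨by linarith, by linarith⟩
  have hi : Integrable (bb h) := (continuous_bb h).integrable_of_hasCompactSupport hsupp
  have h1 : ∀ x, F x * bet h (u x - t) = ∫ s, F x * (bb h s * hv (u x - t - s)) := by
    intro x; rw [integral_const_mul, int_bb hh]
  simp only [h1]
  rw [integral_integral_swap]
  · have : ∀ s, ∫ x, F x * (bb h s * hv (u x - t - s)) = 0 := by
      intro s
      have h2 := h0 (t + s)
      unfold MM at h2
      rw [← mul_zero (bb h s), ← h2, ← integral_const_mul]
      congr 1; ext x; rw [sub_sub]; ring
    simp [this]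
  · have h3 := ((K.int_hv hF t).norm.mul_prod hi)
    refine h3.mono' ?_ (Eventually.of_forall fun p => ?_)
    · refine Measurable.aestronglyMeasurable ?_
      simp only [Function.uncurry_def]
      fun_prop
    · simp only [Function.uncurry]
      rw [norm_mul, norm_mul, norm_mul, Real.norm_of_nonneg (bb_nonneg hh p.2), Real.norm_of_nonneg (hv_nonneg _),
        Real.norm_of_nonneg (hv_nonneg _)]
      have hb := bb_nonneg hh p.2
      by_cases h4 : 0 < p.2
      · have h5 : hv (u p.1 - t - p.2) ≤ hv (u p.1 - t) := by
          unfold hv; split_ifs <;> linarith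
        have := mul_le_mul_of_nonneg_left h5 (mul_nonneg (norm_nonneg (F p.1)) hb)
        linarith
      · rw [bb_zero hh (by linarith)]; simp

lemma Core.layer' (K : Core u g f T Cf) (hh : 0 < h) {F : ℂ → ℝ} (hF : LB F) (h0 : ∀ t, MM u F t = 0) (t : ℝ) :
    ∫ x, F x * bb h (u x - t) = 0 := by
  have h1 := K.derT hF (prof_bet hh) t
  have h2 : (fun t => ∫ x, F x * bet h (u x - t)) = fun _ => 0 := funext fun t => K.layer hh hF h0 t
  rw [h2] at h1
  have := h1.unique (hasDerivAt_const t 0)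
  linarith

end RotPatch

namespace RotPatch
open Topology

variable {u : ℂ → ℝ} {g : ℂ → ℂ} {f : ℂ → ℝ} {T : Set ℝ} {Cf : ℝ} {h : ℝ}

lemma wedge_eq_dot (a b : ℂ) : wedge a b = dot ⟨b.im, -b.re⟩ a := by simp [wedge, dot]; ring
lemma wedge_eq_dot' (a b : ℂ) : wedge a b = dot ⟨-a.im, a.re⟩ b := by simp [wedge, dot]; ring

lemma Core.ang_inner (K : Core u g f T Cf) (hh : 0 < h) (t : ℝ) (c : ℂ) {ψ : ℂ → ℝ}
    (hψ : IsC1c ψ (fun x => (√(f x) * bb h (u x - t)) • g x))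
    (hc0 : ∀ e, ∫ x, (f x * dot e (x - c)) * bb h (u x - t) = 0) (x : ℂ) :
    ∫ y, bb h (u y - t) * (√(f y) * wedge (x - y) (√(f y) • g x - √(f x) • g y))
      = (∫ y, f y * bb h (u y - t)) * wedge (x - c) (g x) := by
  set ψ' : ℂ → ℂ := fun x => (√(f x) * bb h (u x - t)) • g x with hψ'
  have hψi := hψ.integrable'
  have hψc := hψ.1.2
  obtain ⟨R, hR0, hR⟩ := hψ.bound
  have h1 : ∀ y, bb h (u y - t) * (√(f y) * wedge (x - y) (√(f y) • g x - √(f x) • g y))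
      = ((wedge (x - c) (g x)) * (f y * bb h (u y - t))
        - (f y * dot ⟨(g x).im, -(g x).re⟩ (y - c)) * bb h (u y - t))
        - √(f x) * (dot ⟨-x.im, x.re⟩ (ψ' y) - wedge y (ψ' y)) := by
    intro y
    rw [← wedge_eq_dot, ← wedge_eq_dot']
    simp only [hψ']
    rw [wedge_sub_right, wedge_smul_right, wedge_smul_right, wedge_smul_right, wedge_smul_right]
    have := Real.mul_self_sqrt (K.fnn y)
    have h2 : wedge (x - y) (g x) = wedge (x - c) (g x) - wedge (y - c) (g x) := by
      rw [← wedge_sub_left]; congr 1; ring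
    rw [h2, wedge_sub_left x y (g y)]
    linear_combination (bb h (u y - t) * (wedge (x - c) (g x) - wedge (y - c) (g x))) * this
  simp only [h1]
  have i1 := (K.int1 K.lb (continuous_bb h) (fun s hs => bb_zero hh hs) t).const_mul (wedge (x - c) (g x))
  have i2 := K.int1 (K.lb.mul (Core.lbl ⟨(g x).im, -(g x).re⟩ c)) (continuous_bb h) (fun s hs => bb_zero hh hs) t
  have i3 : Integrable fun y => dot ⟨-x.im, x.re⟩ (ψ' y) :=
    integrable_of_cont (by fun_prop) (R := R) fun y hy => by rw [(hR y hy).2]; simp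
  have i4 : Integrable fun y => wedge y (ψ' y) :=
    integrable_of_cont (by fun_prop) (R := R) fun y hy => by rw [(hR y hy).2]; simp [wedge]
  have i12 : Integrable fun y => ((wedge (x - c) (g x)) * (f y * bb h (u y - t))
        - (f y * dot ⟨(g x).im, -(g x).re⟩ (y - c)) * bb h (u y - t)) := i1.sub i2
  have i34 : Integrable fun y => √(f x) * (dot ⟨-x.im, x.re⟩ (ψ' y) - wedge y (ψ' y)) := (i3.sub i4).const_mul _
  rw [integral_sub i12 i34, integral_sub i1 i2, integral_const_mul, integral_const_mul, integral_sub i3 i4,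
    hc0, int_dot_const hψ, int_wedge_id hψ]
  ring

lemma Core.ang_ineq (K : Core u g f T Cf) (hh : 0 < h) (t : ℝ) (c : ℂ) {ψ : ℂ → ℝ}
    (hψ : IsC1c ψ (fun x => (√(f x) * bb h (u x - t)) • g x))
    (hc0 : ∀ e, ∫ x, (f x * dot e (x - c)) * bb h (u x - t) = 0) {L : ℝ}
    (hL : ∀ x, t < u x → ‖x‖ ≤ L) :
    (∫ y, f y * bb h (u y - t)) * (∫ x, wedge (x - c) (g x) ^ 2 * bb h (u x - t)) ≤ 4 * L ^ 2 * Def u g f h t := by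
  have hg := K.c1.2
  have hgm := hg.measurable
  have hu := K.c1.continuous.measurable
  have hbm := (continuous_bb h).measurable
  have hfm := K.fm
  have lw : LB (fun x => wedge (x - c) (g x) ^ 2) := lb_of_cont (by fun_prop)
  have i1 := K.int2 hh t lw K.lb
  have i2 := K.intDef hh t
  have i3 : Integrable (fun p : ℂ × ℂ => (bb h (u p.1 - t) * bb h (u p.2 - t)) * (wedge (p.1 - c) (g p.1) ^ 2 * f p.2)
      + 4 * L ^ 2 * ((bb h (u p.1 - t) * bb h (u p.2 - t)) * ‖defv f g p.1 p.2‖ ^ 2)) (volume.prod volume) :=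
    i1.add (i2.const_mul _)
  set J : ℂ × ℂ → ℝ := fun p => (2 * (bb h (u p.1 - t) * wedge (p.1 - c) (g p.1))) *
    (bb h (u p.2 - t) * (√(f p.2) * wedge (p.1 - p.2) (√(f p.2) • g p.1 - √(f p.1) • g p.2))) with hJ
  have bound : ∀ p, ‖J p‖ ≤ (bb h (u p.1 - t) * bb h (u p.2 - t)) * (wedge (p.1 - c) (g p.1) ^ 2 * f p.2)
      + 4 * L ^ 2 * ((bb h (u p.1 - t) * bb h (u p.2 - t)) * ‖defv f g p.1 p.2‖ ^ 2) := by
    intro p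
    set W := bb h (u p.1 - t) * bb h (u p.2 - t) with hW
    have hW0 : 0 ≤ W := mul_nonneg (bb_nonneg hh _) (bb_nonneg hh _)
    set w := wedge (p.1 - c) (g p.1)
    set q := wedge (p.1 - p.2) (√(f p.2) • g p.1 - √(f p.1) • g p.2) with hq
    have hqe : |q| = |wedge (p.1 - p.2) (defv f g p.1 p.2)| := by
      rw [hq, defv, wedge_sub_right, wedge_sub_right, wedge_smul_right, wedge_smul_right, wedge_smul_right,
        wedge_RR, abs_sub_comm]
    have hJW : J p = W * (2 * (√(f p.2) * w) * q) := by simp only [hJ, hW]; ring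
    rw [hJW, Real.norm_eq_abs, abs_mul, abs_of_nonneg hW0]
    by_cases h1 : t < u p.1
    · by_cases h2 : t < u p.2
      · have h3 : |q| ≤ 2 * L * ‖defv f g p.1 p.2‖ := by
          rw [hqe]
          refine (abs_wedge_le _ _).trans (mul_le_mul_of_nonneg_right ?_ (norm_nonneg _))
          linarith [norm_sub_le p.1 p.2, hL _ h1, hL _ h2]
        have h4 : q ^ 2 ≤ (2 * L * ‖defv f g p.1 p.2‖) ^ 2 := by
          rw [← sq_abs]; exact pow_le_pow_left₀ (abs_nonneg _) h3 2
        have h5 : |2 * (√(f p.2) * w) * q| ≤ (√(f p.2) * w) ^ 2 + q ^ 2 := by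
          rw [abs_le]; constructor <;> nlinarith [sq_nonneg (√(f p.2) * w + q), sq_nonneg (√(f p.2) * w - q)]
        have h6 : (√(f p.2) * w) ^ 2 = w ^ 2 * f p.2 := by
          rw [mul_pow, Real.sq_sqrt (K.fnn _)]; ring
        rw [h6] at h5
        have := mul_le_mul_of_nonneg_left (h5.trans (add_le_add le_rfl h4)) hW0
        refine this.trans (le_of_eq (by ring))
      · have : W = 0 := by rw [hW, bb_zero hh (show u p.2 - t ≤ 0 by linarith)]; simp
        simp [this]
    · have : W = 0 := by rw [hW, bb_zero hh (show u p.1 - t ≤ 0 by linarith)]; simp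
      simp [this]
  have iJ : Integrable J (volume.prod volume) := by
    refine i3.mono' ?_ (Eventually.of_forall bound)
    exact Measurable.aestronglyMeasurable (by fun_prop)
  have e1 : ∫ p, J p ∂(volume.prod volume) = 2 * ((∫ y, f y * bb h (u y - t)) *
      (∫ x, wedge (x - c) (g x) ^ 2 * bb h (u x - t))) := by
    rw [integral_prod _ iJ]
    simp only [hJ]
    simp only [integral_const_mul, K.ang_inner hh t c hψ hc0]
    rw [← integral_const_mul, ← integral_const_mul]
    congr 1; ext x; ring
  have e2 := integral_mono iJ i3 fun p => (le_abs_self _).trans (bound p)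
  rw [e1, integral_add i1 (i2.const_mul _), integral_const_mul,
    int2_eq h t (fun x => wedge (x - c) (g x) ^ 2) f] at e2
  unfold Def
  linarith

lemma Core.ang (K : Core u g f T Cf) (hV : Core.Vanish u g f) {c : ℂ}
    (hc : ∀ e t, MM u (fun x => f x * dot e (x - c)) t = 0) {a b t3 : ℝ} (h3b : t3 ≤ b)
    (hT : ∀ t ∈ T, ¬ (a < t ∧ t < b)) (hκ : 0 < ∫ x in {x | t3 < u x ∧ u x < b}, f x)
    {x : ℂ} (hx1 : a < u x) (hx2 : u x < t3) : wedge (x - c) (g x) = 0 := by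
  obtain ⟨s1, h1, h1'⟩ := exists_between hx1
  obtain ⟨s2, h2, h2'⟩ := exists_between hx2
  have hg := K.c1.2
  have hu := K.c1.continuous
  set κ := ∫ x in {x | t3 < u x ∧ u x < b}, f x
  have lw : LB (fun x => wedge (x - c) (g x) ^ 2) := lb_of_cont (by fun_prop)
  obtain ⟨R, hR⟩ := K.proper s1
  have hL : ∀ x, s1 < u x → ‖x‖ ≤ R := by
    intro x hx
    by_contra hcon
    have := hR x (by linarith)
    linarith
  set C := 4 * R ^ 2 * MM u f s1 / (4 * Real.pi * κ) with hC
  have hpk : 0 < 4 * Real.pi * κ := by have := Real.pi_pos; positivity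
  have hev : ∀ᶠ n in atTop, (∫ x, wedge (x - c) (g x) ^ 2 * bet (ee n) (u x - s1))
      - (∫ x, wedge (x - c) (g x) ^ 2 * bet (ee n) (u x - s2))
      ≤ 2 * C * (Phh u g f (ee n) s1 - Phh u g f (ee n) s2) := by
    filter_upwards [Core.ev_gap h2'] with n hn
    have dY : ∀ t ∈ Icc s1 s2, HasDerivAt (fun t => -∫ x, wedge (x - c) (g x) ^ 2 * bet (ee n) (u x - t))
        (- -∫ x, wedge (x - c) (g x) ^ 2 * bb (ee n) (u x - t)) t := fun t _ =>
      (K.derT lw (prof_bet (ee_pos n)) t).fun_neg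
    have dZ : ∀ t ∈ Icc s1 s2, HasDerivAt (fun t => (-2 * C) * Phh u g f (ee n) t)
        ((-2 * C) * (-(1 / 2) * Def u g f (ee n) t)) t := fun t ht =>
      (K.Phh_deriv (ee_pos n) (by linarith [ht.1]) (by linarith [hn t ht.2]) hT).const_mul _
    have := incr_le (h1'.trans h2).le dY dZ ?_
    · linarith
    · intro t ht
      obtain ⟨ψ, hψ, -, -⟩ := K.psi (ee_pos n) (show a < t by linarith [ht.1]) (show t + ee n ≤ b by linarith [hn t ht.2]) hT
      have j1 := K.ang_ineq (ee_pos n) t c hψ (fun e => K.layer' (ee_pos n) (K.lb.mul (Core.lbl e c)) (hc e) t)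
        (L := R) (fun x hx => hL x (by linarith [ht.1]))
      have j2 := K.AB_ge (ee_pos n) (show a < t by linarith [ht.1]) (show t + ee n ≤ b by linarith [hn t ht.2]) hT (hn t ht.2)
      have j3 : ∫ x, f x * bet (ee n) (u x - t) ≤ MM u f s1 := (K.B_le (ee_pos n) t).trans (K.MM_anti ht.1)
      have hA := K.A_nonneg (ee_pos n) t
      have hD : 0 ≤ Def u g f (ee n) t := Def_nonneg (ee_pos n) t
      have hM := K.MM_nonneg s1
      have hW : 0 ≤ ∫ x, wedge (x - c) (g x) ^ 2 * bb (ee n) (u x - t) :=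
        integral_nonneg fun x => mul_nonneg (sq_nonneg _) (bb_nonneg (ee_pos n) _)
      set A := ∫ x, f x * bb (ee n) (u x - t)
      set W := ∫ x, wedge (x - c) (g x) ^ 2 * bb (ee n) (u x - t)
      have j4 : 4 * Real.pi * κ ≤ A * MM u f s1 := j2.trans (mul_le_mul_of_nonneg_left j3 hA)
      have j5 : 4 * Real.pi * κ * W ≤ MM u f s1 * (4 * R ^ 2 * Def u g f (ee n) t) := by
        calc _ ≤ A * MM u f s1 * W := mul_le_mul_of_nonneg_right j4 hW
          _ = MM u f s1 * (A * W) := by ring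
          _ ≤ _ := mul_le_mul_of_nonneg_left j1 hM
      have j6 : W ≤ C * Def u g f (ee n) t := by
        rw [hC, div_mul_eq_mul_div, le_div_iff₀ hpk]; linarith
      rw [neg_neg]; linarith
  have l1 := le_of_tendsto_of_tendsto ((K.lim_bet lw s1).sub (K.lim_bet lw s2))
    (((K.lim_Phh s1).sub (K.lim_Phh s2)).const_mul (2 * C)) hev
  rw [K.Ph_zero hV, K.Ph_zero hV, sub_self, mul_zero] at l1
  have hnn : ∀ x, 0 ≤ wedge (x - c) (g x) ^ 2 * hv (u x - s1) - wedge (x - c) (g x) ^ 2 * hv (u x - s2) := by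
    intro x
    rw [← mul_sub]
    refine mul_nonneg (sq_nonneg _) ?_
    unfold hv; split_ifs <;> linarith
  have hi : Integrable fun x => wedge (x - c) (g x) ^ 2 * hv (u x - s1) - wedge (x - c) (g x) ^ 2 * hv (u x - s2) :=
    (K.int_hv lw s1).sub (K.int_hv lw s2)
  have h0 : ∫ x, (wedge (x - c) (g x) ^ 2 * hv (u x - s1) - wedge (x - c) (g x) ^ 2 * hv (u x - s2)) = 0 := by
    refine le_antisymm ?_ (integral_nonneg hnn)
    rw [integral_sub (K.int_hv lw s1) (K.int_hv lw s2)]; exact l1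
  rw [integral_eq_zero_iff_of_nonneg hnn hi] at h0
  have hopen : IsOpen {x | s1 < u x ∧ u x < s2} :=
    (isOpen_lt continuous_const hu).inter (isOpen_lt hu continuous_const)
  have hae : (fun x => wedge (x - c) (g x)) =ᵐ[volume.restrict {x | s1 < u x ∧ u x < s2}] fun _ => (0:ℝ) := by
    rw [Filter.EventuallyEq, ae_restrict_iff' hopen.measurableSet]
    filter_upwards [h0] with y hy hy2
    rw [hv_pos (by linarith [hy2.1]), hv_neg (by linarith [hy2.2])] at hy
    simpa using hy
  exact Measure.eqOn_open_of_ae_eq hae hopen (Continuous.continuousOn (by fun_prop)) continuousOn_const ⟨h1', h2⟩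

end RotPatch

namespace RotPatch
open Topology

variable {u : ℂ → ℝ} {g : ℂ → ℂ} {f : ℂ → ℝ} {T : Set ℝ} {Cf : ℝ}

/-- rotation about `c` -/
def rot (c : ℂ) (θ : ℝ) (x : ℂ) : ℂ := c + Complex.exp (θ * Complex.I) * (x - c)

lemma continuous_rot (c : ℂ) (θ : ℝ) : Continuous (rot c θ) := by unfold rot; fun_prop
lemma continuous_rot' (c x : ℂ) : Continuous fun θ => rot c θ x := by unfold rot; fun_prop
lemma rot_zero (c x : ℂ) : rot c 0 x = x := by simp [rot]

lemma exists_rot {c x y : ℂ} (h : ‖x - c‖ = ‖y - c‖) : ∃ θ, x = rot c θ y := by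
  by_cases hy : y - c = 0
  · refine ⟨0, ?_⟩
    rw [hy, norm_zero, norm_eq_zero] at h
    rw [rot_zero, sub_eq_zero.1 h, sub_eq_zero.1 hy]
  · refine ⟨((x - c) / (y - c)).arg, ?_⟩
    have h1 : ‖(x - c) / (y - c)‖ = 1 := by rw [norm_div, h, div_self (norm_ne_zero_iff.2 hy)]
    have h2 := Complex.norm_mul_exp_arg_mul_I ((x - c) / (y - c))
    rw [h1] at h2
    unfold rot
    rw [Complex.ofReal_one, one_mul] at h2
    rw [h2, div_mul_cancel₀ _ hy]; ring

lemma deriv_rot (h : IsC1 u g) (c x : ℂ) (θ : ℝ) :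
    HasDerivAt (fun θ => u (rot c θ x)) (wedge (rot c θ x - c) (g (rot c θ x))) θ := by
  have h1 : HasDerivAt (fun θ : ℝ => rot c θ x) (Complex.I * (rot c θ x - c)) θ := by
    have h2 : HasDerivAt (fun θ : ℝ => (θ : ℂ) * Complex.I) (1 * Complex.I) θ :=
      (Complex.ofRealCLM.hasDerivAt (x := θ)).mul_const _
    have h3 := (h2.cexp.mul_const (x - c)).const_add c
    exact h3.congr_deriv (by simp only [rot]; ring)
  have h4 := (h.1 (rot c θ x)).comp_hasDerivAt θ h1
  refine h4.congr_deriv ?_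
  rw [dL_apply]
  simp [dot, wedge]; ring

lemma Core.circ (K : Core u g f T Cf) {c : ℂ} {a b : ℝ} (hw : ∀ x, a < u x → u x < b → wedge (x - c) (g x) = 0)
    (hT : ∀ t ∈ T, ¬ (a < t ∧ t < b)) {x : ℂ} (h1 : a < u x) (h2 : u x < b) (θ : ℝ) :
    u (rot c θ x) = u x ∧ f (rot c θ x) = f x := by
  have hu := K.c1.continuous
  have kc : Continuous fun θ => u (rot c θ x) := hu.comp (continuous_rot' c x)
  have hS : IsClopen {θ : ℝ | u (rot c θ x) = u x} := by
    refine ⟨isClosed_eq kc continuous_const, isOpen_iff_mem_nhds.2 fun s hs => ?_⟩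
    rw [mem_ofPred_eq] at hs
    have : ∀ᶠ y in 𝓝 s, u (rot c y x) ∈ Ioo a b :=
      kc.continuousAt.eventually (isOpen_Ioo.mem_nhds (show u (rot c s x) ∈ Ioo a b by rw [hs]; exact ⟨h1, h2⟩))
    obtain ⟨ε, hε, hb⟩ := Metric.eventually_nhds_iff_ball.1 this
    filter_upwards [ball_mem_nhds s hε] with y hy
    rw [← hs]
    refine isOpen_ball.is_const_of_deriv_eq_zero (convex_ball s ε).isPreconnected
      (f := fun θ => u (rot c θ x)) (fun z _ => (deriv_rot K.c1 c x z).differentiableAt.differentiableWithinAt) (fun z hz => ?_) hy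
      (mem_ball_self hε)
    rw [(deriv_rot K.c1 c x z).deriv, hw _ (hb z hz).1 (hb z hz).2]; rfl
  have hS1 := hS.eq_univ ⟨0, by simp [rot_zero]⟩
  have hall : ∀ θ, u (rot c θ x) = u x := fun θ => (hS1 ▸ mem_univ θ : θ ∈ {θ : ℝ | u (rot c θ x) = u x})
  refine ⟨hall θ, ?_⟩
  have hl : IsLocallyConstant fun θ => f (rot c θ x) := by
    rw [IsLocallyConstant.iff_eventually_eq]
    intro s
    exact (continuous_rot' c x).continuousAt.eventually (K.loc (rot c s x) (by
      rw [hall]; exact fun h => hT _ h ⟨h1, h2⟩))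
  rw [hl.apply_eq_of_preconnectedSpace θ 0, rot_zero]

lemma Core.str (K : Core u g f T Cf) (hV : Core.Vanish u g f) {c : ℂ}
    (hc : ∀ e t, MM u (fun x => f x * dot e (x - c)) t = 0) {a b : ℝ} 
    (hT : ∀ t ∈ T, ¬ (a < t ∧ t < b)) {x y : ℂ} (h1 : a < u x) (h2 : u x < u y) (h3 : u y < b) (hy : 0 < f y)
    (θ : ℝ) : u (rot c θ x) = u x ∧ f (rot c θ x) = f x := by
  have hu := K.c1.continuous
  obtain ⟨t3, h4, h5⟩ := exists_between h2
  refine K.circ (a := a) (b := t3) (fun z hz1 hz2 => ?_) (fun t ht hh => hT t ht ⟨hh.1, by linarith⟩) h1 h4 θ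
  refine K.ang hV hc (by linarith) hT ?_ hz1 hz2
  have hm : MeasurableSet {x | t3 < u x ∧ u x < b} :=
    ((isOpen_lt continuous_const hu).inter (isOpen_lt hu continuous_const)).measurableSet
  have hi : IntegrableOn f {x | t3 < u x ∧ u x < b} := by
    refine (K.int_hv K.lb t3).integrableOn.congr_fun (fun z hz => ?_) hm
    simp [hv_pos (sub_pos.2 hz.1)]
  rw [setIntegral_pos_iff_support_of_nonneg_ae (Eventually.of_forall fun z => K.fnn z) hi]
  have hev : ∀ᶠ z in 𝓝 y, z ∈ Function.support f ∩ {x | t3 < u x ∧ u x < b} := by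
    filter_upwards [K.loc y (fun h => hT _ h ⟨by linarith, h3⟩),
      hu.continuousAt.eventually (lt_mem_nhds h5), hu.continuousAt.eventually (gt_mem_nhds h3)] with z ha hb hc
    exact ⟨by rw [Function.mem_support, ha]; exact hy.ne', hb, hc⟩
  exact Measure.measure_pos_of_mem_nhds _ hev

lemma Core.freq (K : Core u g f T Cf) {x : ℂ} (hx : u x ∉ T) (hf : 0 < f x) : ∃ᶠ y in 𝓝 x, u y ≠ u x := by
  intro hcon
  simp only [not_not] at hcon
  have hg : ∀ᶠ y in 𝓝 x, g y = 0 := by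
    filter_upwards [hcon.eventually_nhds] with y hy
    refine dL_eq_zero ((K.c1.1 y).unique ?_)
    exact (hasFDerivAt_const (u x) y).congr_of_eventuallyEq hy
  obtain ⟨ε, hε, hb⟩ := Metric.eventually_nhds_iff_ball.1 (hg.and (K.loc x hx))
  have ha : IsC1 (fun y => (ε / 2) ^ 2 + -(‖-x + y‖ ^ 2)) (fun y => 0 + (-1 : ℝ) • ((2 : ℝ) • (-x + y))) :=
    (isC1_const _).add ((isC1_normSq.shift (-x)).comp (γ := fun s => -s) (γ' := fun _ => -1)
      (fun s => (hasDerivAt_id s).neg) continuous_const)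
  have h2 := ha.comp hasDerivAt_maxsq (by fun_prop)
  set φ : ℂ → ℝ := fun y => (max ((ε / 2) ^ 2 + -(‖-x + y‖ ^ 2)) 0) ^ 2 with hφ
  have hz : ∀ y, y ∉ ball x ε → max ((ε / 2) ^ 2 + -(‖-x + y‖ ^ 2)) 0 = 0 := by
    intro y hy
    rw [mem_ball, not_lt, dist_eq_norm, ← neg_add_eq_sub] at hy
    refine max_eq_right ?_
    nlinarith
  have hc1 : IsC1c φ _ := ⟨h2, ‖x‖ + ε, fun y hy => by
    have : y ∉ ball x ε := by
      rw [mem_ball, not_lt, dist_eq_norm]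
      linarith [norm_sub_norm_le y x]
    simp only [hφ, hz y this]; norm_num⟩
  have h3 := K.weak _ _ hc1
  have h4 : ∀ y, f y * φ y = f x * φ y := by
    intro y
    by_cases hy : y ∈ ball x ε
    · rw [(hb y hy).2]
    · simp [hφ, hz y hy]
  rw [integral_congr_ae (Eventually.of_forall h4), integral_const_mul,
    integral_eq_zero_of_ae (Eventually.of_forall fun y => ?_)] at h3
  · have h5 : 0 < ∫ y, φ y := by
      refine hc1.1.continuous.integral_pos_of_hasCompactSupport_nonneg_nonzero ?_ (fun y => sq_nonneg _) (x := x) ?_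
      · refine HasCompactSupport.intro (isCompact_closedBall x ε) fun y hy => ?_
        simp only [hφ]
        rw [hz y fun h => hy (ball_subset_closedBall h)]; norm_num
      · simp only [hφ, neg_add_cancel, norm_zero]
        have : (0:ℝ) < (ε / 2) ^ 2 := by positivity
        rw [max_eq_left (by simpa using this.le)]
        simpa using hε.ne'
    nlinarith
  · by_cases hy : y ∈ ball x ε
    · simp [(hb y hy).1]
    · simp [hz y hy]

lemma Core.rotinv (K : Core u g f T Cf) (hV : Core.Vanish u g f) {c : ℂ}
    (hc : ∀ e t, MM u (fun x => f x * dot e (x - c)) t = 0) {x : ℂ} (hx : u x ∉ T) (hf : 0 < f x) (θ : ℝ) :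
    f (rot c θ x) = f x := by
  have hu := K.c1.continuous
  obtain ⟨ε, hε, hb⟩ := Metric.isOpen_iff.1 K.fin.isClosed.isOpen_compl (u x) hx
  have hT : ∀ t ∈ T, ¬ (u x - ε < t ∧ t < u x + ε) := fun t ht hh =>
    hb (by rw [mem_ball, Real.dist_eq, abs_lt]; constructor <;> linarith [hh.1, hh.2]) ht
  have hnear : ∀ᶠ y in 𝓝 x, f y = f x ∧ u x - ε < u y ∧ u y < u x + ε := by
    filter_upwards [K.loc x hx, hu.continuousAt.eventually (lt_mem_nhds (show u x - ε < u x by linarith)),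
      hu.continuousAt.eventually (gt_mem_nhds (show u x < u x + ε by linarith))] with y h1 h2 h3
    exact ⟨h1, h2, h3⟩
  by_cases hup : ∃ y, u x < u y ∧ u y < u x + ε ∧ 0 < f y
  · obtain ⟨y, h1, h2, h3⟩ := hup
    exact (K.str hV hc hT (by linarith) h1 h2 h3 θ).2
  push Not at hup
  have hfr : ∃ᶠ y in 𝓝 x, f y = f x ∧ u (rot c θ y) = u y ∧ f (rot c θ y) = f x := by
    refine ((K.freq hx hf).and_eventually hnear).mono fun y hy => ?_
    obtain ⟨h1, h2, h3, h4⟩ := hy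
    rcases lt_or_gt_of_ne h1 with h5 | h5
    · have := K.str hV hc hT h3 h5 (by linarith) hf θ
      exact ⟨h2, this.1, this.2.trans h2⟩
    · have := hup y h5 h4
      linarith
  have hux : u (rot c θ x) = u x := by
    have hcl : IsClosed {y | u (rot c θ y) = u y} := isClosed_eq (hu.comp (continuous_rot c θ)) hu
    exact hcl.mem_of_frequently_of_tendsto (hfr.mono fun y hy => hy.2.1) tendsto_id
  have hl := (continuous_rot c θ).continuousAt.eventually (K.loc (rot c θ x) (by rw [hux]; exact hx))
  obtain ⟨y, h1, h2⟩ := (hfr.and_eventually hl).exists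
  rw [← h2, h1.2.2]

theorem Core.radial (K : Core u g f T Cf) (hV : Core.Vanish u g f) {c : ℂ}
    (hc : ∀ e t, MM u (fun x => f x * dot e (x - c)) t = 0) : ∃ G : ℝ → ℝ, f =ᵐ[volume] fun x => G ‖x - c‖ := by
  classical
  refine ⟨fun r => if h : ∃ x, ‖x - c‖ = r ∧ u x ∉ T ∧ 0 < f x then f h.choose else 0, ?_⟩
  have h1 : ∀ᵐ x, ∀ t ∈ T, u x = t → f x = 0 := (ae_ball_iff K.fin.countable).2 fun t _ => K.ae_level hV t
  filter_upwards [h1] with x hx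
  by_cases h : ∃ y, ‖y - c‖ = ‖x - c‖ ∧ u y ∉ T ∧ 0 < f y
  · rw [dif_pos h]
    obtain ⟨h2, h3, h4⟩ := h.choose_spec
    obtain ⟨θ, hθ⟩ := exists_rot h2.symm
    conv_lhs => rw [hθ]
    exact K.rotinv hV hc h3 h4 θ
  · rw [dif_neg h]
    push Not at h
    by_cases h2 : u x ∈ T
    · exact hx _ h2 rfl
    · exact le_antisymm (h x rfl h2) (K.fnn x)

end RotPatch

namespace RotPatch
open Topology

variable {ω : ℂ → ℝ} {C R : ℝ}

lemma inv_two_pi_le : 1 / (2 * Real.pi) ≤ 1 / 2 := by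
  have := Real.pi_gt_three
  gcongr; linarith

lemma inv_two_pi_pos : 0 < 1 / (2 * Real.pi) := by positivity

lemma log_far {x y : ℂ} {R : ℝ} (hR : 0 < R) (hx : 2 * R ≤ ‖x‖) (hy : ‖y‖ < R) :
    |Real.log ‖x - y‖ - Real.log ‖x‖| ≤ 1 := by
  have h1 : ‖x‖ / 2 ≤ ‖x - y‖ := by linarith [norm_sub_norm_le x y]
  have h2 : ‖x - y‖ ≤ 2 * ‖x‖ := by linarith [norm_sub_le x y]
  have h0 : 0 < ‖x‖ := by linarith
  have h3 := Real.log_le_log (by linarith) h1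
  have h4 := Real.log_le_log (by linarith) h2
  rw [Real.log_div h0.ne' (by norm_num)] at h3
  rw [Real.log_mul (by norm_num) h0.ne'] at h4
  have := Real.log_two_lt_d9
  rw [abs_le]; constructor <;> linarith

lemma Vort.pot_far (h : Vort ω C R) {x : ℂ} (hx : 2 * R ≤ ‖x‖) :
    |pot ω x + (∫ y, ω y) / (2 * Real.pi) * Real.log ‖x‖| ≤ ∫ y, |ω y| := by
  have hm := h.meas
  set F : ℂ → ℝ := fun y => (-(1 / (2 * Real.pi)) * (Real.log ‖x - y‖ - Real.log ‖x‖)) * ω y with hF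
  have hb : ∀ y, ‖F y‖ ≤ |ω y| := by
    intro y
    by_cases hy : R ≤ ‖y‖
    · simp [hF, h.supp y hy]
    · have h1 := log_far h.R0 hx (not_le.1 hy)
      rw [hF, norm_mul, norm_mul, Real.norm_eq_abs, Real.norm_eq_abs, Real.norm_eq_abs, abs_neg,
        abs_of_pos inv_two_pi_pos]
      have h2 := inv_two_pi_le
      have h3 : 1 / (2 * Real.pi) * |Real.log ‖x - y‖ - Real.log ‖x‖| ≤ 1 := by
        have := inv_two_pi_pos
        nlinarith [abs_nonneg (Real.log ‖x - y‖ - Real.log ‖x‖)]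
      nlinarith [abs_nonneg (ω y)]
  have hi : Integrable F := h.integrable.abs.mono' (Measurable.aestronglyMeasurable (by fun_prop))
    (Eventually.of_forall hb)
  have e : pot ω x = ∫ y, (F y + (-(1 / (2 * Real.pi)) * Real.log ‖x‖) * ω y) := by
    unfold pot
    congr 1; ext y; simp only [hF]; ring
  rw [e, integral_add hi (h.integrable.const_mul _), integral_const_mul]
  have e2 : (∫ y, F y) + -(1 / (2 * Real.pi)) * Real.log ‖x‖ * (∫ y, ω y)
      + (∫ y, ω y) / (2 * Real.pi) * Real.log ‖x‖ = ∫ y, F y := by ring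
  rw [e2, ← Real.norm_eq_abs]
  exact norm_integral_le_of_norm_le h.integrable.abs (Eventually.of_forall hb)

lemma dot_kk_far {x y : ℂ} {R : ℝ} (hR : 0 < R) (hx : 2 * R ≤ ‖x‖) (hy : ‖y‖ < R) :
    |dot x (kk (x - y)) - 1| ≤ 2 * R / ‖x‖ := by
  have h1 : ‖x‖ / 2 ≤ ‖x - y‖ := by linarith [norm_sub_norm_le x y]
  have h0 : 0 < ‖x‖ := by linarith
  have hp : 0 < ‖x - y‖ := by linarith
  have e : dot x (kk (x - y)) - 1 = dot y (kk (x - y)) := by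
    have : dot (x - y) (kk (x - y)) = 1 := by
      rw [kk, dot_smul_right, dot_self, inv_mul_cancel₀ (by positivity)]
    rw [dot_sub_left] at this; linarith
  rw [e]
  refine (abs_dot_le _ _).trans ?_
  rw [norm_kk, ← div_eq_mul_inv, div_le_div_iff₀ hp h0]
  nlinarith

lemma Vort.dot_gp (h : Vort ω C R) (x e : ℂ) :
    dot e (gp ω x) = ∫ y, -(1 / (2 * Real.pi)) * ω y * dot e (kk (x - y)) := by
  have := (dL e).integral_comp_comm (h.integrable_gp x)
  rw [gp, ← dL_apply, ← this]
  congr 1; ext y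
  rw [dL_apply, dot_smul_right]

lemma Vort.int_dot_gp (h : Vort ω C R) (x e : ℂ) :
    Integrable fun y => -(1 / (2 * Real.pi)) * ω y * dot e (kk (x - y)) := by
  refine ((dL e).integrable_comp (h.integrable_gp x)).congr (Eventually.of_forall fun y => ?_)
  simp only [dL_apply, dot_smul_right]

lemma Vort.gp_far (h : Vort ω C R) {x : ℂ} (hx : 2 * R ≤ ‖x‖) :
    |dot x (gp ω x) + (∫ y, ω y) / (2 * Real.pi)| ≤ R / ‖x‖ * ∫ y, |ω y| := by
  have h0 : 0 < ‖x‖ := by linarith [h.R0]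
  have hR := h.R0
  have e : dot x (gp ω x) + (∫ y, ω y) / (2 * Real.pi)
      = ∫ y, (-(1 / (2 * Real.pi)) * ω y * dot x (kk (x - y)) + 1 / (2 * Real.pi) * ω y) := by
    rw [integral_add (h.int_dot_gp x x) (h.integrable.const_mul _), integral_const_mul, ← h.dot_gp]; ring
  rw [e, ← integral_const_mul, ← Real.norm_eq_abs]
  refine norm_integral_le_of_norm_le (h.integrable.abs.const_mul _) (Eventually.of_forall fun y => ?_)
  by_cases hy : R ≤ ‖y‖
  · simp [h.supp y hy]
  · have h1 := dot_kk_far h.R0 hx (not_le.1 hy)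
    have e2 : -(1 / (2 * Real.pi)) * ω y * dot x (kk (x - y)) + 1 / (2 * Real.pi) * ω y
      = -((1 / (2 * Real.pi)) * (dot x (kk (x - y)) - 1)) * ω y := by ring
    rw [e2, norm_mul, norm_neg, norm_mul, Real.norm_eq_abs, Real.norm_eq_abs, Real.norm_eq_abs,
      abs_of_pos inv_two_pi_pos]
    refine mul_le_mul_of_nonneg_right ?_ (abs_nonneg _)
    have h2 := inv_two_pi_le
    calc 1 / (2 * Real.pi) * |dot x (kk (x - y)) - 1| ≤ 1 / 2 * (2 * R / ‖x‖) := by gcongr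
      _ = R / ‖x‖ := by ring

lemma Vort.sym (h : Vort ω C R) : ∫ x, ω x * dot x (gp ω x) = - (∫ x, ω x) ^ 2 / (4 * Real.pi) := by
  have hm := h.meas
  have hC := h.C0
  have hR := h.R0
  set H : ℂ × ℂ → ℝ := fun p => ω p.1 * (-(1 / (2 * Real.pi)) * ω p.2 * dot p.1 (kk (p.1 - p.2))) with hH
  have hi : Integrable H (volume.prod volume) := by
    refine integrable_sing_prod (Measurable.aestronglyMeasurable (by fun_prop)) (C := C * (C * R)) (R := R)
      (fun p => ?_) (fun p hp => by simp [hH, h.supp _ hp]) (fun p hp => by simp [hH, h.supp _ hp])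
    by_cases hp : R ≤ ‖p.1‖
    · simp only [hH, h.supp _ hp, zero_mul, norm_zero]; positivity
    have h1 := abs_dot_le p.1 (kk (p.1 - p.2))
    rw [norm_kk] at h1
    rw [hH, norm_mul, norm_mul, norm_mul, norm_neg, Real.norm_eq_abs, Real.norm_eq_abs, Real.norm_eq_abs,
      Real.norm_eq_abs, abs_of_pos inv_two_pi_pos]
    have h2 := inv_two_pi_le
    have h3 := inv_two_pi_pos
    calc |ω p.1| * (1 / (2 * Real.pi) * |ω p.2| * |dot p.1 (kk (p.1 - p.2))|)
        ≤ C * (1 * C * (R * (1 + ‖p.1 - p.2‖⁻¹))) := by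
          gcongr
          · exact h.bdd _
          · linarith
          · exact h.bdd _
          · refine h1.trans ?_
            gcongr
            · exact (not_le.1 hp).le
            · linarith
      _ = _ := by ring
  have e1 : ∫ x, ω x * dot x (gp ω x) = ∫ p, H p ∂(volume.prod volume) := by
    rw [integral_prod _ hi]
    congr 1; ext x
    rw [h.dot_gp, ← integral_const_mul]
  have e2 : ∫ p, H p ∂(volume.prod volume) = ∫ p, H p.swap ∂(volume.prod volume) :=
    (integral_prod_swap H).symm
  have hd : ∀ᵐ p ∂((volume : Measure ℂ).prod (volume : Measure ℂ)), p.1 ≠ p.2 := by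
    rw [Measure.ae_prod_iff_ae_ae (by exact (isClosed_eq continuous_fst continuous_snd).isOpen_compl.measurableSet)]
    refine Eventually.of_forall fun x => ?_
    simp [ae_iff, measure_singleton]
  have e3 : ∫ p, (H p + H p.swap) ∂((volume : Measure ℂ).prod volume)
      = ∫ p : ℂ × ℂ, -(1 / (2 * Real.pi)) * (ω p.1 * ω p.2) ∂((volume : Measure ℂ).prod volume) := by
    refine integral_congr_ae ?_
    filter_upwards [hd] with p hp
    have : dot (p.1 - p.2) (kk (p.1 - p.2)) = 1 := by
      rw [kk, dot_smul_right, dot_self, inv_mul_cancel₀ (by simpa [sub_eq_zero] using hp)]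
    simp only [hH, Prod.fst_swap, Prod.snd_swap]
    rw [kk_sub_comm p.2 p.1, dot_neg_right]
    rw [dot_sub_left] at this
    linear_combination -(1 / (2 * Real.pi)) * (ω p.1 * ω p.2) * this
  have hs : Integrable (fun p : ℂ × ℂ => H p.swap) (volume.prod volume) := hi.swap
  rw [integral_add hi hs, ← e2, integral_const_mul, integral_prod_mul] at e3
  rw [e1]
  field_simp at e3 ⊢
  linarith

lemma bathtub {E : Set ℂ} (hE : MeasurableSet E) {L : ℝ} (hL : ∀ x ∈ E, ‖x‖ ≤ L) :
    (∫ x, E.indicator 1 x) ^ 2 ≤ 2 * Real.pi * ∫ x, E.indicator 1 x * ‖x‖ ^ 2 := by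
  have hfin : volume E < ⊤ := (measure_mono (fun x hx => by simpa using hL x hx)).trans_lt
    (measure_closedBall_lt_top (x := (0:ℂ)) (r := L))
  set F : Set (ℂ × ℂ) := {p | p.1 ∈ E ∧ ‖p.2‖ ≤ ‖p.1‖} with hF
  have hFm : MeasurableSet F := (hE.preimage measurable_fst).inter
    (isClosed_le (f := fun p : ℂ × ℂ => ‖p.2‖) (g := fun p => ‖p.1‖) (by fun_prop) (by fun_prop)).measurableSet
  have h1 : (volume.prod volume) F = ∫⁻ x in E, ENNReal.ofReal (Real.pi * ‖x‖ ^ 2) := by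
    rw [Measure.prod_apply hFm, ← lintegral_indicator hE]
    congr 1; ext x
    by_cases hx : x ∈ E
    · rw [indicator_of_mem hx]
      have : Prod.mk x ⁻¹' F = closedBall (0:ℂ) ‖x‖ := by
        ext y; simp [hF, hx]
      rw [this, Complex.volume_closedBall, mul_comm, ENNReal.ofReal_mul Real.pi_pos.le, ENNReal.ofReal_pow (norm_nonneg _)]
      congr 1
      rw [← NNReal.coe_real_pi, ENNReal.ofReal_coe_nnreal]
    · rw [indicator_of_notMem hx]
      have : Prod.mk x ⁻¹' F = ∅ := by
        ext y; simp [hF, hx]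
      rw [this, measure_empty]
  have h2 : (volume.prod volume) (Prod.swap ⁻¹' F) = (volume.prod volume) F :=
    Measure.measurePreserving_swap.measure_preimage hFm.nullMeasurableSet
  have h3 : volume E * volume E ≤ 2 * ∫⁻ x in E, ENNReal.ofReal (Real.pi * ‖x‖ ^ 2) := by
    rw [← Measure.prod_prod, ← h1, two_mul]
    nth_rw 2 [← h2]
    refine (measure_mono ?_).trans (measure_union_le _ _)
    rintro ⟨x, y⟩ ⟨hx, hy⟩
    rcases le_total ‖y‖ ‖x‖ with h | h
    · exact Or.inl ⟨hx, h⟩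
    · exact Or.inr ⟨hy, h⟩
  have hi : IntegrableOn (fun x : ℂ => Real.pi * ‖x‖ ^ 2) E := by
    refine Measure.integrableOn_of_bounded (M := Real.pi * L ^ 2) hfin.ne (by fun_prop) ?_
    rw [ae_restrict_iff' hE]
    refine Eventually.of_forall fun x hx => ?_
    rw [Real.norm_of_nonneg (by positivity)]
    have := hL x hx
    gcongr
  rw [← ofReal_integral_eq_lintegral_ofReal hi (Eventually.of_forall fun x => by positivity)] at h3
  have h4 := ENNReal.toReal_mono (by finiteness) h3
  rw [ENNReal.toReal_mul, ENNReal.toReal_mul, ENNReal.toReal_ofReal (integral_nonneg fun x => by positivity),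
    integral_const_mul] at h4
  have e1 : ∫ x, E.indicator 1 x = (volume E).toReal := by
    rw [integral_indicator_one hE]; rfl
  have e2 : ∫ x, E.indicator 1 x * ‖x‖ ^ 2 = ∫ x in E, ‖x‖ ^ 2 := by
    rw [← integral_indicator hE]
    congr 1; ext x
    by_cases hx : x ∈ E <;> simp [hx]
  rw [e1, e2]
  simp only [ENNReal.toReal_ofNat] at h4
  linarith

end RotPatch

namespace RotPatch
open Topology

variable {ω : ℂ → ℝ} {C R Ω : ℝ}

def uu (ω : ℂ → ℝ) (Ω : ℝ) (x : ℂ) : ℝ := pot ω x + Ω / 2 * ‖x‖ ^ 2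
def gg (ω : ℂ → ℝ) (Ω : ℝ) (x : ℂ) : ℂ := gp ω x + Ω • x
def ff (ω : ℂ → ℝ) (Ω : ℝ) (x : ℂ) : ℝ := ω x - 2 * Ω

lemma Vort.isC1_uu (h : Vort ω C R) (Ω : ℝ) : IsC1 (uu ω Ω) (gg ω Ω) := by
  have h1 := h.isC1.add (isC1_normSq.comp (γ := fun s => Ω / 2 * s) (γ' := fun _ => Ω / 2)
    (fun s => by simpa using (hasDerivAt_id s).const_mul (Ω / 2)) continuous_const)
  have e : gg ω Ω = fun x => gp ω x + (Ω / 2) • ((2 : ℝ) • x) := by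
    ext1 x
    rw [smul_smul, gg]; congr 2; ring
  rw [e]
  exact h1

lemma Vort.abs_m (_h : Vort ω C R) : |∫ y, ω y| ≤ ∫ y, |ω y| := abs_integral_le_integral_abs

lemma Vort.pot_lin (h : Vort ω C R) {η : ℝ} (hη : 0 < η) : ∃ B, 0 ≤ B ∧ ∀ x, |pot ω x| ≤ η * ‖x‖ + B := by
  set N := ∫ y, |ω y| with hN
  have hN0 : 0 ≤ N := integral_nonneg fun _ => abs_nonneg _
  obtain ⟨B1, hB1⟩ := (isCompact_closedBall (0:ℂ) (max (2 * R) 1)).exists_bound_of_continuousOn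
    h.isC1.continuous.continuousOn
  set η' := η / (N + 1) with hη'
  have hp : 0 < η' := by positivity
  refine ⟨|B1| + N + N * |Real.log η'|, by positivity, fun x => ?_⟩
  by_cases hx : ‖x‖ ≤ max (2 * R) 1
  · have h1 := hB1 x (by simpa using hx)
    rw [Real.norm_eq_abs] at h1
    have h2 : 0 ≤ η * ‖x‖ := by positivity
    have h3 : 0 ≤ N * |Real.log η'| := by positivity
    linarith [le_abs_self B1]
  · push Not at hx
    have hx1 := (le_max_left _ _).trans hx.le
    have hx2 := (le_max_right _ _).trans hx.le
    have h1 := h.pot_far hx1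
    have h2 := h.abs_m
    have hl : 0 ≤ Real.log ‖x‖ := Real.log_nonneg hx2
    have h3 : Real.log ‖x‖ ≤ η' * ‖x‖ + |Real.log η'| := by
      have h4 := Real.log_le_sub_one_of_pos (show 0 < η' * ‖x‖ by positivity)
      rw [Real.log_mul hp.ne' (by positivity)] at h4
      linarith [neg_abs_le (Real.log η')]
    have h4 : |(∫ y, ω y) / (2 * Real.pi) * Real.log ‖x‖| ≤ N * Real.log ‖x‖ := by
      rw [abs_mul, abs_of_nonneg hl, div_eq_mul_one_div, abs_mul, abs_of_pos inv_two_pi_pos]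
      refine mul_le_mul_of_nonneg_right ?_ hl
      nlinarith [inv_two_pi_le, inv_two_pi_pos, abs_nonneg (∫ y, ω y)]
    have h5 : N * Real.log ‖x‖ ≤ N * (η' * ‖x‖ + |Real.log η'|) := mul_le_mul_of_nonneg_left h3 hN0
    have h6 : N * η' ≤ η := by
      rw [hη', ← mul_div_assoc, div_le_iff₀ (by positivity)]; nlinarith
    have h7 : N * η' * ‖x‖ ≤ η * ‖x‖ := mul_le_mul_of_nonneg_right h6 (norm_nonneg _)
    rw [abs_le] at h1 h4 ⊢
    constructor <;> nlinarith [abs_nonneg B1]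

lemma Vort.proper (h : Vort ω C R) (hΩ : Ω < 0 ∨ (Ω = 0 ∧ 0 < ∫ y, ω y)) :
    ∀ τ, ∃ L, ∀ x, L ≤ ‖x‖ → uu ω Ω x < τ := by
  intro τ
  rcases hΩ with hΩ | ⟨rfl, hm⟩
  · obtain ⟨B, hB, hb⟩ := h.pot_lin one_pos
    refine ⟨max 1 (2 * (2 + B + |τ|) / (-Ω)), fun x hx => ?_⟩
    have h1 := (le_max_left _ _).trans hx
    have h2 := (le_max_right _ _).trans hx
    rw [div_le_iff₀ (by linarith)] at h2
    have h3 := (abs_le.1 (hb x)).2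
    unfold uu
    nlinarith [neg_abs_le τ, abs_nonneg τ]
  · have h1 : Tendsto (fun r => (∫ y, ω y) / (2 * Real.pi) * Real.log r) atTop atTop :=
      Real.tendsto_log_atTop.const_mul_atTop (by positivity)
    obtain ⟨L, hL⟩ := eventually_atTop.1 (h1.eventually_gt_atTop ((∫ y, |ω y|) - τ))
    refine ⟨max L (2 * R), fun x hx => ?_⟩
    have h2 := hL _ ((le_max_left _ _).trans hx)
    have h3 := (abs_le.1 (h.pot_far ((le_max_right _ _).trans hx))).2
    simp only [uu, zero_div, zero_mul, add_zero]
    linarith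

lemma Vort.weak_uu (h : Vort ω C R) (Ω : ℝ) {φ φ'} (k : IsC1c φ φ') :
    ∫ x, dot (gg ω Ω x) (φ' x) = ∫ x, ff ω Ω x * φ x := by
  have hg := h.isC1.2
  obtain ⟨r, -, hr⟩ := k.bound
  have k2 := k.1.2
  have i1 : Integrable fun x => dot (gp ω x) (φ' x) :=
    integrable_of_cont (by fun_prop) (R := r) fun x hx => by simp [(hr x hx).2]
  have i2 : Integrable fun x => dot x (φ' x) :=
    integrable_of_cont (by fun_prop) (R := r) fun x hx => by simp [(hr x hx).2]
  have i3 : Integrable fun x => ω x * φ x := by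
    obtain ⟨D, -, hD⟩ := exists_bound_of_cont k.1.continuous (R := r) fun x hx => (hr x hx).1
    exact h.integrable.mul_bdd (c := D) k.1.continuous.aestronglyMeasurable (Eventually.of_forall hD)
  have e1 : ∫ x, dot (gg ω Ω x) (φ' x) = ∫ x, (dot (gp ω x) (φ' x) + Ω * dot x (φ' x)) := by
    congr 1; ext x; rw [gg, dot_add_left, dot_smul_left]
  have e2 : ∫ x, ff ω Ω x * φ x = ∫ x, (ω x * φ x + (-2 * Ω) * φ x) := by
    congr 1; ext x; rw [ff]; ring
  rw [e1, e2, integral_add i1 (i2.const_mul _), integral_add i3 (k.integrable.const_mul _), integral_const_mul,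
    integral_const_mul, h.weak k, int_dot_id k]
  ring

lemma Vort.core (h : Vort ω C R) (hΩ : Ω < 0 ∨ (Ω = 0 ∧ 0 < ∫ y, ω y)) (hnn : ∀ x, 2 * Ω ≤ ω x)
    {T : Set ℝ} (hT : T.Finite) (hloc : ∀ x, uu ω Ω x ∉ T → ∀ᶠ y in 𝓝 x, ω y = ω x) :
    Core (uu ω Ω) (gg ω Ω) (ff ω Ω) T (C + 2 * |Ω|) where
  c1 := h.isC1_uu Ω
  fm := by have := h.meas; unfold ff; fun_prop
  fb x := by
    have := h.bdd x
    unfold ff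
    refine (abs_sub _ _).trans ?_
    rw [abs_mul, abs_two]; linarith
  fnn x := by unfold ff; linarith [hnn x]
  weak φ φ' k := h.weak_uu Ω k
  proper := h.proper hΩ
  fin := hT
  loc x hx := by filter_upwards [hloc x hx] with y hy; simp [ff, hy]

lemma Vort.int_mul (h : Vort ω C R) {F : ℂ → ℝ} (hF : LB F) : Integrable fun x => ω x * F x := by
  obtain ⟨D, hD⟩ := hF.2 R
  have := h.meas
  have := hF.1
  have hC := h.C0
  refine integrable_of_bdd (Measurable.aestronglyMeasurable (by fun_prop)) (C := C * |D|) (R := R) (fun x => ?_)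
    (fun x hx => by simp [h.supp x hx])
  by_cases hx : R ≤ ‖x‖
  · simp only [h.supp x hx, zero_mul, norm_zero]; positivity
  · rw [norm_mul]
    exact mul_le_mul (h.bdd x) ((hD x (not_le.1 hx).le).trans (le_abs_self _)) (norm_nonneg _) hC

lemma Vort.Ph_bound (h : Vort ω C R) {T Cf} (K : Core (uu ω Ω) (gg ω Ω) (ff ω Ω) T Cf) {τ : ℝ}
    (hτ : ∀ x, ‖x‖ ≤ R → τ < uu ω Ω x) :
    Ph (uu ω Ω) (gg ω Ω) (ff ω Ω) τ ≤ 4 * Real.pi * |Ω| * |MM (uu ω Ω) (fun x => dot x (gp ω x)) τ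
      + MM (uu ω Ω) (fun _ => 1) τ * (∫ x, ω x) / (2 * Real.pi) - 1 / 2 * ∫ x, ω x * ‖x‖ ^ 2| := by
  have hg := h.isC1.2
  have hW : ∀ x, ω x * hv (uu ω Ω x - τ) = ω x := by
    intro x
    by_cases hx : R ≤ ‖x‖
    · simp [h.supp x hx]
    · rw [hv_pos (by linarith [hτ x (not_le.1 hx).le]), mul_one]
  have l1 : LB fun _ => (1:ℝ) := lb_of_cont continuous_const
  have l2 : LB fun x : ℂ => dot x (gp ω x) := lb_of_cont (by fun_prop)
  have l3 : LB fun x : ℂ => ‖x‖ ^ 2 := lb_of_cont (by fun_prop)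
  have j1 := K.int_hv l1 τ
  have j2 := K.int_hv l2 τ
  have j3 := K.int_hv l3 τ
  have k2 := h.int_mul l2
  have k3 := h.int_mul l3
  have e1 : MM (uu ω Ω) (ff ω Ω) τ = (∫ x, ω x) - 2 * Ω * MM (uu ω Ω) (fun _ => 1) τ := by
    unfold MM
    rw [← integral_const_mul, ← integral_sub h.integrable (j1.const_mul _)]
    congr 1; ext x
    rw [ff]; linear_combination hW x
  have e2 : MM (uu ω Ω) (fun x => ff ω Ω x * dot x (gg ω Ω x)) τ
      = (∫ x, ω x * dot x (gp ω x)) + Ω * (∫ x, ω x * ‖x‖ ^ 2)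
        + (-2 * Ω) * MM (uu ω Ω) (fun x => dot x (gp ω x)) τ
        + (-2 * Ω ^ 2) * MM (uu ω Ω) (fun x => ‖x‖ ^ 2) τ := by
    unfold MM
    beta_reduce
    rw [← integral_const_mul, ← integral_const_mul, ← integral_const_mul]
    rw [← integral_add k2 (k3.const_mul _), ← integral_add (k2.fun_add (k3.const_mul _)) (j2.const_mul _),
      ← integral_add ((k2.fun_add (k3.const_mul _)).fun_add (j2.const_mul _)) (j3.const_mul _)]
    congr 1; ext x
    rw [ff, gg, dot_add_right, dot_smul_right, dot_self]
    linear_combination (dot x (gp ω x) + Ω * ‖x‖ ^ 2) * hW x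
  have e3 := h.sym
  obtain ⟨L, hL⟩ := K.proper τ
  have hu := K.c1.continuous
  have hEm : MeasurableSet {x | τ < uu ω Ω x} := (isOpen_lt continuous_const hu).measurableSet
  have e4 := bathtub hEm (L := L) (fun x hx => by
    by_contra hcon
    exact lt_asymm hx (hL x (not_le.1 hcon).le))
  have hind : ∀ x, ({x | τ < uu ω Ω x}.indicator 1 x : ℝ) = hv (uu ω Ω x - τ) := by
    intro x
    by_cases hx : τ < uu ω Ω x
    · rw [indicator_of_mem (by exact hx), hv_pos (by linarith)]; rfl
    · rw [indicator_of_notMem (by exact hx), hv_neg (by linarith)]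
  have e5 : ∫ x, ({x | τ < uu ω Ω x}.indicator 1 x : ℝ) = MM (uu ω Ω) (fun _ => 1) τ := by
    unfold MM; congr 1; ext x; rw [hind, one_mul]
  have e6 : ∫ x, ({x | τ < uu ω Ω x}.indicator 1 x : ℝ) * ‖x‖ ^ 2 = MM (uu ω Ω) (fun x => ‖x‖ ^ 2) τ := by
    unfold MM; congr 1; ext x; rw [hind, mul_comm]
  rw [e5, e6] at e4
  set a := MM (uu ω Ω) (fun _ => 1) τ
  set S := MM (uu ω Ω) (fun x => ‖x‖ ^ 2) τ
  set Q := MM (uu ω Ω) (fun x => dot x (gp ω x)) τ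
  set I := ∫ x, ω x * ‖x‖ ^ 2
  set m := ∫ x, ω x
  set err := Q + a * m / (2 * Real.pi) - 1 / 2 * I with herr
  have e7 : Ph (uu ω Ω) (gg ω Ω) (ff ω Ω) τ = 2 * Ω ^ 2 * (a ^ 2 - 2 * Real.pi * S) - 4 * Real.pi * (Ω * err) := by
    unfold Ph
    rw [e1, e2, e3, herr]
    field_simp
    ring
  have e8 : -(Ω * err) ≤ |Ω| * |err| := by rw [← abs_mul]; exact neg_le_abs _
  rw [e7]
  have := Real.pi_pos
  nlinarith [sq_nonneg Ω]

lemma annulus {r s : ℝ} (hr : 0 ≤ r) (hs : r ≤ s) :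
    ∫ x, ((ball (0:ℂ) s \ ball 0 r).indicator 1 x : ℝ) = Real.pi * (s ^ 2 - r ^ 2) := by
  rw [integral_indicator_one (measurableSet_ball.diff measurableSet_ball)]
  rw [measureReal_sdiff (ball_subset_ball hs) measurableSet_ball]
  simp only [Measure.real, Complex.volume_ball, ENNReal.toReal_mul, ENNReal.toReal_pow, ENNReal.coe_toReal,
    ENNReal.toReal_ofReal hr, ENNReal.toReal_ofReal (hr.trans hs), NNReal.coe_real_pi]
  ring

lemma int_annulus (r s : ℝ) : Integrable fun x => ((ball (0:ℂ) s \ ball 0 r).indicator 1 x : ℝ) := by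
  refine (integrable_indicator_iff (measurableSet_ball.diff measurableSet_ball)).2 ?_
  exact (integrableOn_const (C := (1:ℝ)) measure_ball_lt_top.ne).mono_set sdiff_subset

end RotPatch

namespace RotPatch
open Topology

variable {ω : ℂ → ℝ} {C R Ω : ℝ}

lemma Vort.err_bound (h : Vort ω C R) {T Cf} (K : Core (uu ω Ω) (gg ω Ω) (ff ω Ω) T Cf) {τ r s : ℝ}
    (hr : 2 * R ≤ r) (hrs : r < s) (h1 : ∀ x, ‖x‖ ≤ r → τ < uu ω Ω x) (h2 : ∀ x, s ≤ ‖x‖ → uu ω Ω x ≤ τ) :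
    |MM (uu ω Ω) (fun x => dot x (gp ω x)) τ
      + MM (uu ω Ω) (fun _ => 1) τ * (∫ x, ω x) / (2 * Real.pi) - 1 / 2 * ∫ x, ω x * ‖x‖ ^ 2|
      ≤ R / r * (∫ y, |ω y|) * (Real.pi * (s ^ 2 - r ^ 2)) := by
  have hR := h.R0
  have hg := h.isC1.2
  have hr0 : 0 < r := by linarith
  set H := s ^ 2 - r ^ 2 with hH
  have hH0 : 0 < H := by rw [hH]; nlinarith
  set Γ : ℝ → ℝ := fun q => (max q 0) ^ 2 / (2 * H) - (max (q - H) 0) ^ 2 / (2 * H) with hΓ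
  set Γ' : ℝ → ℝ := fun q => (max q 0 - max (q - H) 0) / H with hΓ'
  have hd : ∀ q, HasDerivAt Γ (Γ' q) q := by
    intro q
    have d1 := (hasDerivAt_maxsq q).div_const (2 * H)
    have d2 := ((hasDerivAt_maxsq (q - H)).comp q ((hasDerivAt_id q).sub_const H)).div_const (2 * H)
    refine (d1.sub d2).congr_deriv ?_
    simp only [hΓ']; field_simp
  have hΓc : Continuous Γ' := by simp only [hΓ']; fun_prop
  have g0 : ∀ q, q ≤ 0 → Γ q = 0 ∧ Γ' q = 0 := by
    intro q hq
    simp only [hΓ, hΓ', max_eq_right hq, max_eq_right (show q - H ≤ 0 by linarith)]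
    simp
  have g1 : ∀ q, H ≤ q → Γ q = q - H / 2 ∧ Γ' q = 1 := by
    intro q hq
    simp only [hΓ, hΓ', max_eq_left (show 0 ≤ q by linarith), max_eq_left (show 0 ≤ q - H by linarith)]
    constructor <;> field_simp <;> ring
  have g2 : ∀ q, 0 ≤ Γ' q ∧ Γ' q ≤ 1 := by
    intro q
    rcases le_total q 0 with hq | hq
    · rw [(g0 q hq).2]; norm_num
    rcases le_total H q with hq2 | hq2
    · rw [(g1 q hq2).2]; norm_num
    simp only [hΓ', max_eq_left hq, max_eq_right (show q - H ≤ 0 by linarith), sub_zero]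
    exact ⟨by positivity, (div_le_one hH0).2 hq2⟩
  set χ : ℂ → ℝ := fun x => Γ' (s ^ 2 - ‖x‖ ^ 2) with hχ
  set φ : ℂ → ℝ := fun x => -(1 / 2) * Γ (s ^ 2 - ‖x‖ ^ 2) with hφ
  have hk : IsC1c φ (fun x => χ x • x) := by
    refine ⟨?_, s, fun x hx => ?_⟩
    · have := isC1_normSq.comp (γ := fun q => -(1 / 2) * Γ (s ^ 2 - q)) (γ' := fun q => 1 / 2 * Γ' (s ^ 2 - q))
        (fun q => by
          have := ((hd (s ^ 2 - q)).comp q ((hasDerivAt_id q).const_sub (s ^ 2))).const_mul (-(1/2))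
          exact this.congr_deriv (by ring)) (by fun_prop)
      convert this using 2 with x
      rw [smul_smul]; congr 1; simp only [hχ]; ring
    · simp only [hφ, (g0 (s ^ 2 - ‖x‖ ^ 2) (by nlinarith)).1, mul_zero]
  have hχc : Continuous χ := by simp only [hχ]; fun_prop
  have hχ0 : ∀ x, s ≤ ‖x‖ → χ x = 0 := fun x hx => (g0 _ (by nlinarith)).2
  have hχ1 : ∀ x, ‖x‖ ≤ r → χ x = 1 := fun x hx => (g1 _ (by
    have := norm_nonneg x
    rw [hH]; nlinarith)).2
  have hφ1 : ∀ x, ‖x‖ ≤ r → φ x = φ 0 + 1 / 2 * ‖x‖ ^ 2 := by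
    intro x hx
    have := norm_nonneg x
    simp only [hφ]
    rw [(g1 _ (show H ≤ s ^ 2 - ‖x‖ ^ 2 by rw [hH]; nlinarith)).1,
      (g1 _ (show H ≤ s ^ 2 - ‖(0:ℂ)‖ ^ 2 by rw [hH, norm_zero]; nlinarith)).1, norm_zero]
    ring
  have l1 : LB fun _ => (1:ℝ) := lb_of_cont continuous_const
  have l2 : LB fun x : ℂ => dot x (gp ω x) := lb_of_cont (by fun_prop)
  have l3 : LB fun x : ℂ => ‖x‖ ^ 2 := lb_of_cont (by fun_prop)
  have j1 := K.int_hv l1 τ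
  have j2 := K.int_hv l2 τ
  have k3 := h.int_mul l3
  have i1 : Integrable χ := integrable_of_cont hχc hχ0
  have i2 : Integrable fun x => χ x * dot x (gp ω x) :=
    integrable_of_cont (by fun_prop) (R := s) fun x hx => by rw [hχ0 x hx, zero_mul]
  -- the two identities
  have w1 : ∫ x, χ x * dot x (gp ω x) = φ 0 * (∫ x, ω x) + 1 / 2 * ∫ x, ω x * ‖x‖ ^ 2 := by
    have := h.weak hk
    have e1 : ∫ x, χ x * dot x (gp ω x) = ∫ x, dot (gp ω x) (χ x • x) := by
      congr 1; ext x; rw [dot_smul_right, dot_comm]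
    rw [e1, this, ← integral_const_mul, ← integral_const_mul,
      ← integral_add (h.integrable.const_mul _) (k3.const_mul _)]
    congr 1; ext x
    by_cases hx : R ≤ ‖x‖
    · simp [h.supp x hx]
    · rw [hφ1 x (by linarith)]; ring
  have w2 : ∫ x, χ x = - (2 * Real.pi) * φ 0 := by
    rw [← K_at hk 0]
    refine integral_congr_ae ?_
    have hx : ∀ᵐ y ∂(volume : Measure ℂ), y ≠ 0 := by simp [ae_iff, measure_singleton]
    filter_upwards [hx] with x hx
    rw [sub_zero, dot_smul_right, kk, dot_smul_left, dot_self, inv_mul_cancel₀ (by simpa using hx), mul_one]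
  have e : MM (uu ω Ω) (fun x => dot x (gp ω x)) τ
      + MM (uu ω Ω) (fun _ => 1) τ * (∫ x, ω x) / (2 * Real.pi) - 1 / 2 * (∫ x, ω x * ‖x‖ ^ 2)
      = ∫ x, ((dot x (gp ω x) * hv (uu ω Ω x - τ) + (∫ x, ω x) / (2 * Real.pi) * (1 * hv (uu ω Ω x - τ)))
        - (χ x * dot x (gp ω x) + (∫ x, ω x) / (2 * Real.pi) * χ x)) := by
    rw [integral_sub (j2.fun_add (j1.const_mul _)) (i2.fun_add (i1.const_mul _)), integral_add j2 (j1.const_mul _),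
      integral_add i2 (i1.const_mul _), integral_const_mul ((∫ x, ω x) / (2 * Real.pi)),
      integral_const_mul ((∫ x, ω x) / (2 * Real.pi)), w1, w2]
    unfold MM
    field_simp
    ring
  rw [e, ← annulus hr0.le hrs.le, ← integral_const_mul, ← Real.norm_eq_abs]
  refine norm_integral_le_of_norm_le ((int_annulus r s).const_mul _) (Eventually.of_forall fun x => ?_)
  have hN0 : 0 ≤ ∫ y, |ω y| := integral_nonneg fun _ => abs_nonneg _
  have e2 : (dot x (gp ω x) * hv (uu ω Ω x - τ) + (∫ x, ω x) / (2 * Real.pi) * (1 * hv (uu ω Ω x - τ)))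
        - (χ x * dot x (gp ω x) + (∫ x, ω x) / (2 * Real.pi) * χ x)
      = (hv (uu ω Ω x - τ) - χ x) * (dot x (gp ω x) + (∫ x, ω x) / (2 * Real.pi)) := by ring
  rw [e2]
  by_cases hx : ‖x‖ < r
  · rw [hv_pos (by linarith [h1 x hx.le]), hχ1 x hx.le, sub_self, zero_mul, norm_zero]
    exact mul_nonneg (by positivity) (indicator_nonneg (fun _ _ => zero_le_one) _)
  by_cases hx2 : s ≤ ‖x‖
  · rw [hv_neg (by linarith [h2 x hx2]), hχ0 x hx2, sub_self, zero_mul, norm_zero]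
    exact mul_nonneg (by positivity) (indicator_nonneg (fun _ _ => zero_le_one) _)
  push Not at hx hx2
  rw [indicator_of_mem (by simp [hx, hx2]), Pi.one_apply, mul_one, norm_mul, Real.norm_eq_abs, Real.norm_eq_abs]
  have a1 : |hv (uu ω Ω x - τ) - χ x| ≤ 1 := by
    have := g2 (s ^ 2 - ‖x‖ ^ 2)
    have b1 := hv_nonneg (uu ω Ω x - τ)
    have b2 := (abs_le.1 (hv_abs (uu ω Ω x - τ))).2
    rw [abs_le]; constructor <;> simp only [hχ] <;> linarith [this.1, this.2]
  have a2 := h.gp_far (hr.trans hx)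
  have a3 : R / ‖x‖ * (∫ y, |ω y|) ≤ R / r * ∫ y, |ω y| := by gcongr
  calc _ ≤ 1 * (R / r * ∫ y, |ω y|) := mul_le_mul a1 (a2.trans a3) (abs_nonneg _) zero_le_one
    _ = _ := one_mul _

lemma Vort.sandwich (h : Vort ω C R) (hΩ : Ω < 0) {δ : ℝ} (hδ : 0 < δ) (t : ℝ) :
    ∃ r0, ∀ r, r0 ≤ r → ∃ τ ≤ t, (∀ x, ‖x‖ ≤ r → τ < uu ω Ω x) ∧ (∀ x, r + δ ≤ ‖x‖ → uu ω Ω x ≤ τ) := by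
  obtain ⟨k, hk⟩ : ∃ k, k = -Ω := ⟨_, rfl⟩
  have hk0 : 0 < k := by linarith
  have hΩk : Ω = -k := by linarith
  obtain ⟨η, hη⟩ : ∃ η, η = k * δ / 6 := ⟨_, rfl⟩
  have hη0 : 0 < η := by rw [hη]; positivity
  obtain ⟨B, hB, hb⟩ := h.pot_lin hη0
  refine ⟨max 1 (max (B / η) (2 * |t| / k)), fun r hr => ?_⟩
  have r1 : 1 ≤ r := (le_max_left _ _).trans hr
  have r2 : B / η ≤ r := ((le_max_left _ _).trans (le_max_right _ _)).trans hr
  have r3 : 2 * |t| / k ≤ r := ((le_max_right _ _).trans (le_max_right _ _)).trans hr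
  rw [div_le_iff₀ hη0] at r2
  rw [div_le_iff₀ hk0] at r3
  refine ⟨-k / 2 * r ^ 2 - 3 * η * r, ?_, fun x hx => ?_, fun x hx => ?_⟩
  · have := neg_abs_le t
    have : 0 ≤ η * r := by positivity
    nlinarith
  · have h1 := (abs_le.1 (hb x)).1
    have hx0 := norm_nonneg x
    have h2 : η * ‖x‖ ≤ η * r := by gcongr
    have h3 : k / 2 * ‖x‖ ^ 2 ≤ k / 2 * r ^ 2 := by gcongr
    have h4 : 0 < η * r := by positivity
    unfold uu
    rw [hΩk]
    linarith
  · have h1 := (abs_le.1 (hb x)).2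
    obtain ⟨d, hd⟩ : ∃ d, d = ‖x‖ - (r + δ) := ⟨_, rfl⟩
    have hd0 : 0 ≤ d := by linarith
    have hx' : ‖x‖ = r + δ + d := by linarith
    unfold uu
    rw [hΩk]
    rw [hx'] at h1 ⊢
    have e1 : η * r = k * δ * r / 6 := by rw [hη]; ring
    have e2 : η * (r + δ + d) = k * δ * r / 6 + k * δ * δ / 6 + k * δ * d / 6 := by rw [hη]; ring
    have q1 : 0 ≤ k * δ * r := by positivity
    have q2 : 0 ≤ k * δ * δ := by positivity
    have q3 : 0 ≤ k * δ * d := by positivity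
    have q4 : 0 ≤ k * d * r := by positivity
    have q5 : 0 ≤ k * d * d := by positivity
    nlinarith

lemma Vort.vanish (h : Vort ω C R) (hΩ : Ω ≤ 0) {T Cf} (K : Core (uu ω Ω) (gg ω Ω) (ff ω Ω) T Cf) :
    Core.Vanish (uu ω Ω) (gg ω Ω) (ff ω Ω) := by
  intro ε hε t
  have hR := h.R0
  rcases hΩ.lt_or_eq with hΩ | rfl
  · set N := ∫ y, |ω y| with hN
    have hN0 : 0 ≤ N := integral_nonneg fun _ => abs_nonneg _
    set A := 4 * Real.pi * |Ω| * (R * N * (3 * Real.pi)) with hA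
    have hA0 : 0 ≤ A := by positivity
    obtain ⟨δ, hδ0, hδ1, hδ⟩ : ∃ δ, 0 < δ ∧ δ ≤ 1 ∧ A * δ ≤ ε := by
      refine ⟨min 1 (ε / (A + 1)), by positivity, min_le_left _ _, ?_⟩
      calc A * min 1 (ε / (A + 1)) ≤ A * (ε / (A + 1)) := by gcongr; exact min_le_right _ _
        _ ≤ ε := by rw [← mul_div_assoc, div_le_iff₀ (by positivity)]; nlinarith
    obtain ⟨r0, hr0⟩ := h.sandwich hΩ hδ0 t
    obtain ⟨τ, h1, h2, h3⟩ := hr0 (max r0 (max 1 (2 * R))) (le_max_left _ _)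
    set r := max r0 (max 1 (2 * R)) with hr
    have r1 : 1 ≤ r := (le_max_left _ _).trans (le_max_right _ _)
    have r2 : 2 * R ≤ r := (le_max_right _ _).trans (le_max_right _ _)
    refine ⟨τ, h1, (h.Ph_bound K fun x hx => h2 x (by linarith)).trans ?_⟩
    have h4 := h.err_bound K r2 (by linarith) h2 h3
    have h5 : R / r * N * (Real.pi * ((r + δ) ^ 2 - r ^ 2)) ≤ R * N * (3 * Real.pi) * δ := by
      have e : R / r * N * (Real.pi * ((r + δ) ^ 2 - r ^ 2)) = R * N * Real.pi * δ * (2 + δ / r) := by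
        field_simp; ring
      have e' : R * N * (3 * Real.pi) * δ = R * N * Real.pi * δ * 3 := by ring
      rw [e, e']
      have : δ / r ≤ 1 := by rw [div_le_one (by linarith)]; linarith
      gcongr; linarith
    refine le_trans ?_ hδ
    rw [hA, mul_assoc (4 * Real.pi * |Ω|)]
    exact mul_le_mul_of_nonneg_left (h4.trans h5) (by positivity)
  · obtain ⟨B, hB⟩ := (isCompact_closedBall (0:ℂ) R).exists_bound_of_continuousOn K.c1.continuous.continuousOn
    refine ⟨min t (-|B| - 1), min_le_left _ _, (h.Ph_bound K fun x hx => ?_).trans ?_⟩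
    · have h1 := (abs_le.1 (hB x (by simpa using hx))).1
      linarith [min_le_right t (-|B| - 1), le_abs_self B]
    · simpa using hε.le

lemma Vort.center (h : Vort ω C R) (hΩ : Ω < 0) {T Cf} (K : Core (uu ω Ω) (gg ω Ω) (ff ω Ω) T Cf) {c : ℂ}
    (hc : ∀ e t, MM (uu ω Ω) (fun x => ff ω Ω x * dot e (x - c)) t = 0) : c = 0 := by
  by_contra hcne
  have hn : 0 < ‖c‖ := by simpa using hcne
  obtain ⟨k, hk⟩ : ∃ k, k = -Ω := ⟨_, rfl⟩
  have hk0 : 0 < k := by linarith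
  have hΩk : Ω = -k := by linarith
  have hπ := Real.pi_pos
  set N := ∫ y, |ω y| with hN
  have hN0 : 0 ≤ N := integral_nonneg fun _ => abs_nonneg _
  have hmN := h.abs_m
  set D := ∫ x, ω x * dot c x with hD
  obtain ⟨δ, hδ0, hδ1, hδ⟩ : ∃ δ, 0 < δ ∧ δ ≤ 1 ∧ 12 * δ ≤ ‖c‖ :=
    ⟨min 1 (‖c‖ / 12), by positivity, min_le_left _ _, by linarith [min_le_right 1 (‖c‖ / 12)]⟩
  obtain ⟨r0, hr0⟩ := h.sandwich hΩ hδ0 0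
  set r := max r0 (max (max 1 R) ((|D| / ‖c‖ ^ 2 + N + 1) / (k * Real.pi))) with hr
  obtain ⟨τ, -, h2, h3⟩ := hr0 r (le_max_left _ _)
  have r1 : 1 ≤ r := (((le_max_left _ _).trans (le_max_left _ _)).trans (le_max_right _ _))
  have r2 : R ≤ r := (((le_max_right _ _).trans (le_max_left _ _)).trans (le_max_right _ _))
  have r3 : (|D| / ‖c‖ ^ 2 + N + 1) / (k * Real.pi) ≤ r := (le_max_right _ _).trans (le_max_right _ _)
  rw [div_le_iff₀ (by positivity)] at r3
  have hW : ∀ x, ω x * hv (uu ω Ω x - τ) = ω x := by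
    intro x
    by_cases hx : R ≤ ‖x‖
    · simp [h.supp x hx]
    · rw [hv_pos (by linarith [h2 x (by linarith)]), mul_one]
  have l1 : LB fun _ => (1:ℝ) := lb_of_cont continuous_const
  have l2 : LB fun x : ℂ => dot c x := lb_of_cont (by fun_prop)
  have j1 := K.int_hv l1 τ
  have j2 := K.int_hv l2 τ
  have k2 := h.int_mul l2
  set a := ∫ x, 1 * hv (uu ω Ω x - τ) with ha
  set X := ∫ x, dot c x * hv (uu ω Ω x - τ) with hX
  have e1 : D + 2 * k * X - ‖c‖ ^ 2 * ((∫ x, ω x) + 2 * k * a) = 0 := by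
    have e0 := hc c τ
    unfold MM at e0
    rw [← e0, hD, hX, ha, ← integral_const_mul (2 * k), ← integral_const_mul (2 * k),
      ← integral_add h.integrable (j1.const_mul _),
      ← integral_const_mul (‖c‖ ^ 2), ← integral_add k2 (j2.const_mul _),
      ← integral_sub (k2.fun_add (j2.const_mul _)) ((h.integrable.fun_add (j1.const_mul _)).const_mul _)]
    congr 1; ext x
    simp only [ff, dot_sub_right, dot_self]
    rw [hk]
    linear_combination (‖c‖ ^ 2 - dot c x) * hW x
  have e2 : Real.pi * r ^ 2 ≤ a := by
    have := annulus le_rfl (show 0 ≤ r by linarith)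
    have e : Real.pi * r ^ 2 = Real.pi * (r ^ 2 - 0 ^ 2) := by ring
    rw [e, ← this]
    refine integral_mono (int_annulus 0 r) j1 fun x => ?_
    beta_reduce
    rw [one_mul]
    by_cases hx : ‖x‖ < r
    · rw [hv_pos (by linarith [h2 x hx.le])]
      exact indicator_le_self' (fun _ _ => zero_le_one) _
    · rw [indicator_of_notMem (by simp; exact not_lt.1 hx)]
      exact hv_nonneg _
  have e3 : ∫ x, ((ball (0:ℂ) r).indicator 1 x : ℝ) * dot c x = 0 := by
    have := integral_neg_eq_self (fun x => ((ball (0:ℂ) r).indicator 1 x : ℝ) * dot c x) volume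
    have e : ∀ x, ((ball (0:ℂ) r).indicator 1 (-x) : ℝ) * dot c (-x)
        = -(((ball (0:ℂ) r).indicator 1 x : ℝ) * dot c x) := by
      intro x
      rw [dot_neg_right]
      by_cases hx : ‖x‖ < r
      · rw [indicator_of_mem (by simpa using hx), indicator_of_mem (by simpa using hx)]; simp
      · rw [indicator_of_notMem (by simpa using hx), indicator_of_notMem (by simpa using hx)]; simp
    simp only [e, integral_neg] at this
    linarith
  have j3 : Integrable fun x => ((ball (0:ℂ) r).indicator 1 x : ℝ) * dot c x := by
    refine integrable_of_bdd (C := ‖c‖ * r) (R := r) ?_ (fun x => ?_) (fun x hx => ?_)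
    · refine Measurable.aestronglyMeasurable ?_
      have : Measurable ((ball (0:ℂ) r).indicator (1 : ℂ → ℝ)) := measurable_one.indicator measurableSet_ball
      fun_prop
    · by_cases hx : ‖x‖ < r
      · rw [indicator_of_mem (by simpa using hx), Pi.one_apply, one_mul]
        refine (abs_dot_le _ _).trans (by gcongr)
      · rw [indicator_of_notMem (by simpa using hx), zero_mul, norm_zero]; positivity
    · rw [indicator_of_notMem (by simpa using hx), zero_mul]
  have e4 : |X| ≤ (‖c‖ * (r + δ)) * (Real.pi * ((r + δ) ^ 2 - r ^ 2)) := by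
    have e : X = ∫ x, (dot c x * hv (uu ω Ω x - τ) - ((ball (0:ℂ) r).indicator 1 x : ℝ) * dot c x) := by
      rw [integral_sub j2 j3, e3, sub_zero]
    rw [e, ← annulus (by linarith) (show r ≤ r + δ by linarith), ← integral_const_mul, ← Real.norm_eq_abs]
    refine norm_integral_le_of_norm_le ((int_annulus r (r + δ)).const_mul _) (Eventually.of_forall fun x => ?_)
    by_cases hx : ‖x‖ < r
    · rw [hv_pos (by linarith [h2 x hx.le]), indicator_of_mem (by simpa using hx), Pi.one_apply, mul_one, one_mul,
        sub_self, norm_zero]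
      exact mul_nonneg (by positivity) (indicator_nonneg (fun _ _ => zero_le_one) _)
    by_cases hx2 : r + δ ≤ ‖x‖
    · rw [hv_neg (by linarith [h3 x hx2]), indicator_of_notMem (by simpa using hx), mul_zero, zero_mul, sub_zero,
        norm_zero]
      exact mul_nonneg (by positivity) (indicator_nonneg (fun _ _ => zero_le_one) _)
    push Not at hx hx2
    rw [indicator_of_notMem (s := ball (0:ℂ) r) (by simpa using hx), zero_mul, sub_zero,
      indicator_of_mem (by simp [hx, hx2]), Pi.one_apply, mul_one, norm_mul]
    have b1 := hv_abs (uu ω Ω x - τ)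
    have b2 := abs_dot_le c x
    calc ‖dot c x‖ * ‖hv (uu ω Ω x - τ)‖ ≤ (‖c‖ * (r + δ)) * 1 := by
          refine mul_le_mul (b2.trans (by gcongr)) b1 (norm_nonneg _) (by positivity)
      _ = _ := mul_one _
  have e5 : (‖c‖ * (r + δ)) * (Real.pi * ((r + δ) ^ 2 - r ^ 2)) ≤ (‖c‖ * (2 * r)) * (Real.pi * (3 * r * δ)) := by
    have q1 : 0 ≤ Real.pi * ((r + δ) ^ 2 - r ^ 2) := mul_nonneg hπ.le (by nlinarith)
    refine mul_le_mul ?_ ?_ q1 (by positivity)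
    · exact mul_le_mul_of_nonneg_left (by linarith) hn.le
    · exact mul_le_mul_of_nonneg_left (by nlinarith) hπ.le
  have e6 : (‖c‖ * (2 * r)) * (Real.pi * (3 * r * δ)) ≤ 1 / 2 * ‖c‖ ^ 2 * Real.pi * r ^ 2 := by
    have : 0 ≤ ‖c‖ * Real.pi * r ^ 2 := by positivity
    nlinarith
  have e7 : k * X ≤ k * (1 / 2 * ‖c‖ ^ 2 * Real.pi * r ^ 2) :=
    mul_le_mul_of_nonneg_left ((le_abs_self X).trans (e4.trans (e5.trans e6))) hk0.le
  have e8 : k * (Real.pi * r ^ 2) ≤ k * a := mul_le_mul_of_nonneg_left e2 hk0.le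
  have e9 : |D| / ‖c‖ ^ 2 + N + 1 ≤ k * (Real.pi * r ^ 2) := by
    have : r ≤ r ^ 2 := by nlinarith
    have : r * (k * Real.pi) ≤ r ^ 2 * (k * Real.pi) := by gcongr
    linarith
  have e10 : ‖c‖ ^ 2 * (|D| / ‖c‖ ^ 2 + 1) = |D| + ‖c‖ ^ 2 := by field_simp
  have e11 : ‖c‖ ^ 2 * (|D| / ‖c‖ ^ 2 + 1) ≤ ‖c‖ ^ 2 * (k * (Real.pi * r ^ 2) + (∫ x, ω x)) := by
    gcongr ?_ * ?_
    linarith [neg_abs_le (∫ x, ω x)]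
  have e12 : ‖c‖ ^ 2 * (k * (Real.pi * r ^ 2)) ≤ ‖c‖ ^ 2 * (k * a) := by gcongr
  have : 0 < ‖c‖ ^ 2 := by positivity
  nlinarith [le_abs_self D]

end RotPatch

namespace RotPatch
open Topology
variable {ω : ℂ → ℝ} {C R Ω : ℝ}

lemma Vort.main_lower (h : Vort ω C R) (hnn : ∀ᵐ x, 2 * Ω ≤ ω x) {T : Set ℝ} (hT : T.Finite)
    (hloc : ∀ x, uu ω Ω x ∉ T → ∀ᶠ y in 𝓝 x, ω y = ω x) :
    ∃ (c : ℂ) (G : ℝ → ℝ), (ω =ᵐ[volume] fun x => G ‖x - c‖) ∧ (Ω ≠ 0 → c = 0) := by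
  have hΩ : Ω ≤ 0 := by
    by_contra hpos
    push Not at hpos
    have hsub : {x : ℂ | R < ‖x‖} ⊆ {x | ¬ (2 * Ω ≤ ω x)} := by
      intro x hx
      simp only [mem_ofPred_eq] at hx ⊢
      rw [h.supp x hx.le]; linarith
    have h0 : volume {x : ℂ | R < ‖x‖} = 0 := measure_mono_null hsub hnn
    have ho : IsOpen {x : ℂ | R < ‖x‖} := isOpen_lt continuous_const continuous_norm
    have hne : {x : ℂ | R < ‖x‖}.Nonempty := by
      refine ⟨((R + 1 : ℝ) : ℂ), ?_⟩
      simp only [mem_ofPred_eq, Complex.norm_real, Real.norm_eq_abs]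
      exact lt_of_lt_of_le (by linarith) (le_abs_self _)
    exact (ho.measure_pos volume hne).ne' h0
  obtain ⟨v, hv⟩ : ∃ v : ℂ → ℝ, v = fun x => max (ω x) (2 * Ω) := ⟨_, rfl⟩
  have hae : v =ᵐ[volume] ω := by
    filter_upwards [hnn] with x hx
    rw [hv]; exact max_eq_left hx
  have hV : Vort v (C + 2 * |Ω|) R := by
    refine ⟨?_, ?_, h.R0, fun x => ?_, fun x hx => ?_⟩
    · rw [hv]; exact h.meas.max measurable_const
    · have := h.C0; positivity
    · rw [hv]
      have h1 := h.bdd x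
      have h2 := abs_nonneg Ω
      refine (abs_max_le_max_abs_abs).trans (max_le (by linarith) ?_)
      rw [abs_mul, abs_two]; linarith [h.C0]
    · rw [hv]; simp only [h.supp x hx]; exact max_eq_left (by linarith)
  have hpot : ∀ x, pot v x = pot ω x := by
    intro x
    unfold pot
    refine integral_congr_ae ?_
    filter_upwards [hae] with y hy
    rw [hy]
  have huu : ∀ x, uu v Ω x = uu ω Ω x := fun x => by unfold uu; rw [hpot]
  have hnn' : ∀ x, 2 * Ω ≤ v x := fun x => by rw [hv]; exact le_max_right _ _
  have hloc' : ∀ x, uu v Ω x ∉ T → ∀ᶠ y in 𝓝 x, v y = v x := by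
    intro x hx
    rw [huu] at hx
    filter_upwards [hloc x hx] with y hy
    simp only [hv, hy]
  by_cases hcase : Ω < 0 ∨ (Ω = 0 ∧ 0 < ∫ y, v y)
  · have K := hV.core hcase hnn' hT hloc'
    have hVan := hV.vanish hΩ K
    obtain ⟨c, hc⟩ := K.bary hVan
    obtain ⟨G, hG⟩ := K.radial hVan hc
    refine ⟨c, fun s => G s + 2 * Ω, ?_, fun h0 => hV.center (lt_of_le_of_ne hΩ h0) K hc⟩
    filter_upwards [hG, hae] with x h1 h2
    rw [← h1, ← h2, ff]; ring
  · push Not at hcase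
    have h0 : Ω = 0 := le_antisymm hΩ hcase.1
    have hi := hcase.2 h0
    subst h0
    have hp : 0 ≤ v := fun x => by simpa using hnn' x
    have hz : ∫ y, v y = 0 := le_antisymm hi (integral_nonneg hp)
    rw [integral_eq_zero_iff_of_nonneg hp hV.integrable] at hz
    refine ⟨0, fun _ => 0, ?_, fun _ => rfl⟩
    exact hae.symm.trans hz

lemma Vort.neg (h : Vort ω C R) : Vort (fun x => - ω x) C R :=
  ⟨h.meas.neg, h.C0, h.R0, fun x => by rw [abs_neg]; exact h.bdd x, fun x hx => by rw [h.supp x hx, neg_zero]⟩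

lemma uu_neg (x : ℂ) : uu (fun x => - ω x) (-Ω) x = - uu ω Ω x := by
  unfold uu pot
  simp only [mul_neg, integral_neg]
  ring

lemma Vort.main_both (h : Vort ω C R) (hnn : (∀ᵐ x, 2 * Ω ≤ ω x) ∨ (∀ᵐ x, ω x ≤ 2 * Ω)) {T : Set ℝ} (hT : T.Finite)
    (hloc : ∀ x, uu ω Ω x ∉ T → ∀ᶠ y in 𝓝 x, ω y = ω x) :
    ∃ (c : ℂ) (G : ℝ → ℝ), (ω =ᵐ[volume] fun x => G ‖x - c‖) ∧ (Ω ≠ 0 → c = 0) := by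
  rcases hnn with hnn | hnn
  · exact h.main_lower hnn hT hloc
  · obtain ⟨c, G, h1, h2⟩ := h.neg.main_lower (Ω := -Ω) (T := Neg.neg '' T)
      (by filter_upwards [hnn] with x hx; linarith) (hT.image _) (by
        intro x hx
        rw [uu_neg] at hx
        filter_upwards [hloc x (fun hm => hx ⟨_, hm, rfl⟩)] with y hy
        rw [hy])
    refine ⟨c, fun s => - G s, ?_, fun h0 => h2 (neg_ne_zero.2 h0)⟩
    filter_upwards [h1] with x hx
    rw [← hx, neg_neg]

end RotPatch

namespace RotPatch
open Topology

lemma const_on_curve {Γ : Set E2} (hΓ : IsJordanCurve Γ) {S : Set E2} (hS : Γ ⊆ S) {u : E2 → ℝ}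
    (hu : ∀ x ∈ S, ∀ y ∈ connectedComponentIn S x, u y = u x) : (u '' Γ).Finite := by
  obtain ⟨f, hf, -, rfl⟩ := hΓ
  have hs : IsPreconnected (Metric.sphere (0 : E2) 1) := by
    refine isPreconnected_sphere ?_ _ _
    rw [← Module.finrank_eq_rank]
    simp
  have : PreconnectedSpace (Metric.sphere (0 : E2) 1) := isPreconnected_iff_preconnectedSpace.1 hs
  have hr : IsPreconnected (range f) := isPreconnected_range hf
  refine Set.Subsingleton.finite ?_
  rintro _ ⟨x, hx, rfl⟩ _ ⟨y, hy, rfl⟩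
  exact (hu x (hS hx) y (hr.subset_connectedComponentIn hx hS hy)).symm

lemma indicator_loc {D : Set E2} (hD : IsOpen D) {x : E2} (hx : x ∉ frontier D) :
    ∀ᶠ y in 𝓝 x, (D.indicator 1 y : ℝ) = D.indicator 1 x := by
  by_cases hxD : x ∈ D
  · filter_upwards [hD.mem_nhds hxD] with y hy
    rw [indicator_of_mem hy, indicator_of_mem hxD]; rfl
  · have hxc : x ∈ (closure D)ᶜ := by
      intro hc
      exact hx (by rw [hD.frontier_eq]; exact ⟨hc, hxD⟩)
    filter_upwards [isClosed_closure.isOpen_compl.mem_nhds hxc] with y hy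
    rw [indicator_of_notMem hxD, indicator_of_notMem (fun h => hy (subset_closure h))]

end RotPatch

/-- Radial symmetry of the multi-patch vorticity `ω₀ = Σⱼ αⱼ 1_{Dⱼ}` for a uniformly rotating
multi-patch solution of the 2D Euler equation with angular velocity
`Ω ≤ (1/2) ess inf ω₀` or `Ω ≥ (1/2) ess sup ω₀`. -/
theorem radial_symmetry_of_uniformly_rotating_multipatch
    (n : ℕ) (D : Fin n → Set E2) (α : Fin n → ℝ) (Ω : ℝ)
    (hDopen : ∀ j, IsOpen (D j)) (hDconn : ∀ j, IsConnected (D j))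
    (hDbdd : ∀ j, Bornology.IsBounded (D j))
    (hDbdry : ∀ j, BoundaryIsFiniteUnionOfJordanCurves (D j))
    (ω₀ : E2 → ℝ) (hω₀ : ω₀ = fun x => ∑ j, α j * (D j).indicator 1 x)
    -- the stream function `u = N*ω₀ + (Ω/2)|x|²` :
    (u : E2 → ℝ) (hu : u = fun x => newtonConv ω₀ x + Ω / 2 * ‖x‖ ^ 2)
    -- uniformly rotating multi-patch solution: `u` is constant on every connected
    -- component of `∂Dⱼ` for every `j` :
    (hrot : ∀ j, ∀ x ∈ frontier (D j), ∀ y ∈ connectedComponentIn (frontier (D j)) x,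
      u y = u x)
    -- the angular velocity condition :
    (hΩ : Ω ≤ (1 / 2) * essInf ω₀ volume ∨ (1 / 2) * essSup ω₀ volume ≤ Ω) :
    (Ω ≠ 0 → ∃ g : ℝ → ℝ, ω₀ =ᵐ[volume] fun x => g ‖x‖) ∧
    (Ω = 0 → ∃ (a : E2) (g : ℝ → ℝ), ω₀ =ᵐ[volume] fun x => g ‖x - a‖) := by
  set e : ℂ ≃ₗᵢ[ℝ] E2 := Complex.orthonormalBasisOneI.repr with he
  have hmp : MeasurePreserving e volume volume := e.measurePreserving
  have hme : MeasurableEmbedding e := e.toHomeomorph.measurableEmbedding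
  set C := ∑ j, |α j| with hC
  have hmeas : Measurable ω₀ := by
    rw [hω₀]
    refine Finset.measurable_sum _ fun j _ => ?_
    exact measurable_const.mul (measurable_one.indicator (hDopen j).measurableSet)
  have hbd : ∀ x, |ω₀ x| ≤ C := by
    intro x
    rw [hω₀]
    refine (Finset.abs_sum_le_sum_abs _ _).trans (Finset.sum_le_sum fun j _ => ?_)
    rw [abs_mul]
    refine mul_le_of_le_one_right (abs_nonneg _) ?_
    by_cases hx : x ∈ D j
    · rw [indicator_of_mem hx]; simp
    · rw [indicator_of_notMem hx]; simp
  obtain ⟨R, hR0, hR⟩ : ∃ R : ℝ, 0 < R ∧ ∀ x, R ≤ ‖x‖ → ω₀ x = 0 := by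
    have hb : Bornology.IsBounded (⋃ j, D j) := Bornology.isBounded_iUnion.2 hDbdd
    obtain ⟨R, hR⟩ := hb.subset_ball (0 : E2)
    refine ⟨max R 1, by positivity, fun x hx => ?_⟩
    rw [hω₀]
    refine Finset.sum_eq_zero fun j _ => ?_
    rw [indicator_of_notMem, mul_zero]
    intro hxD
    have := hR (mem_iUnion.2 ⟨j, hxD⟩)
    rw [mem_ball_zero_iff] at this
    linarith [le_max_left R 1]
  have hV : RotPatch.Vort (fun z => ω₀ (e z)) C R := by
    refine ⟨hmeas.comp hmp.measurable, Finset.sum_nonneg fun _ _ => abs_nonneg _, hR0, fun z => hbd _, fun z hz => ?_⟩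
    exact hR _ (by rwa [LinearIsometryEquiv.norm_map])
  have hpot : ∀ z, RotPatch.uu (fun z => ω₀ (e z)) Ω z = u (e z) := by
    intro z
    rw [hu]
    simp only [RotPatch.uu, RotPatch.pot, newtonConv, LinearIsometryEquiv.norm_map]
    rw [← hmp.integral_comp hme]
    congr 2
    ext y
    rw [NewtonianPotential, ← map_sub, LinearIsometryEquiv.norm_map, one_div ‖_‖, Real.log_inv]
    ring
  set T := u '' ⋃ j, frontier (D j) with hT
  have hTf : T.Finite := by
    rw [hT, image_iUnion]
    refine finite_iUnion fun j => ?_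
    obtain ⟨k, Γ, h1, -, h3⟩ := hDbdry j
    have hsub : ∀ i, Γ i ⊆ frontier (D j) := fun i => by rw [h3]; exact subset_iUnion _ i
    have hfin : ∀ i, (u '' Γ i).Finite := fun i => RotPatch.const_on_curve (h1 i) (hsub i) (hrot j)
    rw [h3, image_iUnion]
    exact finite_iUnion hfin
  have hloc : ∀ z, RotPatch.uu (fun z => ω₀ (e z)) Ω z ∉ T → ∀ᶠ y in nhds z, ω₀ (e y) = ω₀ (e z) := by
    intro z hz
    rw [hpot] at hz
    have hx : ∀ j, e z ∉ frontier (D j) := fun j hj => hz ⟨_, mem_iUnion.2 ⟨j, hj⟩, rfl⟩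
    have hev : ∀ᶠ y in nhds (e z), ω₀ y = ω₀ (e z) := by
      have hall : ∀ᶠ y in nhds (e z), ∀ j, ((D j).indicator 1 y : ℝ) = (D j).indicator 1 (e z) :=
        eventually_all.2 fun j => RotPatch.indicator_loc (hDopen j) (hx j)
      filter_upwards [hall] with y hy
      rw [hω₀]
      simp only [hy]
    exact e.continuous.continuousAt.eventually hev
  have hab : IsBoundedUnder (· ≤ ·) (ae volume) ω₀ := isBoundedUnder_of ⟨C, fun x => (abs_le.1 (hbd x)).2⟩
  have hbe : IsBoundedUnder (· ≥ ·) (ae volume) ω₀ := isBoundedUnder_of ⟨-C, fun x => (abs_le.1 (hbd x)).1⟩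
  have hcond : (∀ᵐ z, 2 * Ω ≤ ω₀ (e z)) ∨ (∀ᵐ z, ω₀ (e z) ≤ 2 * Ω) := by
    rcases hΩ with hΩ | hΩ
    · left
      have h1 : ∀ᵐ x, essInf ω₀ volume ≤ ω₀ x := ae_essInf_le hbe
      filter_upwards [hmp.quasiMeasurePreserving.ae h1] with z hz
      linarith
    · right
      have h1 : ∀ᵐ x, ω₀ x ≤ essSup ω₀ volume := ae_le_essSup hab
      filter_upwards [hmp.quasiMeasurePreserving.ae h1] with z hz
      linarith
  obtain ⟨c, G, hG, hc⟩ := hV.main_both hcond hTf hloc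
  have hmp' : MeasurePreserving e.symm volume volume := e.symm.measurePreserving
  have hfin : ω₀ =ᵐ[volume] fun x => G ‖x - e c‖ := by
    filter_upwards [hmp'.quasiMeasurePreserving.ae hG] with x hx
    rw [LinearIsometryEquiv.apply_symm_apply] at hx
    rw [hx, ← LinearIsometryEquiv.norm_map e, map_sub, LinearIsometryEquiv.apply_symm_apply]
  refine ⟨fun h0 => ⟨G, ?_⟩, fun _ => ⟨e c, G, hfin⟩⟩
  rw [hc h0] at hfin
  simpa using hfin
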